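/- Let G ∈ G(n,p) with log⁵ n ≪ d = p(n−1) ≤ n(1 − 3 log log n / log n). Let i ≥ 0 be the largest integer such that d^i = o(n), let c = d^{i+1}/n, and let q = (e^{−c})² + (1 − e^{−c})² if p = o(1) and q = p² + (1−p)² if p = Θ(1). If e^c > (log n)/(3 log log n), then asymptotically almost surely: β(G) = Θ(e^c log n) = Θ(log n / log(1/q)) if e^{−c} = Ω(d^i/n), and β(G) = Θ(n log n / d^i) if e^{−c} ≪ d^i/n; in all cases β(G) ≫ log n. -/

import Mathlib

open Filter Real Asymptotics
open scoped Topology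

/-- `R` is a resolving set of the graph `G`: every pair of distinct vertices is
distinguished by its distances to some vertex of `R`. -/
def Resolves {V : Type*} (G : SimpleGraph V) (R : Set V) : Prop :=
  ∀ ⦃v w : V⦄, v ≠ w → ∃ u ∈ R, G.dist u v ≠ G.dist u w

/-- The metric dimension of a graph `G`: the smallest cardinality of a resolving set. -/
noncomputable def metricDim {V : Type*} (G : SimpleGraph V) : ℕ :=
  sInf {k : ℕ | ∃ R : Set V, R.Finite ∧ R.ncard = k ∧ Resolves G R}

/-- The `G(n,p)` probability weight of a single graph on `Fin n`. -/
noncomputable def gnpWeight (n : ℕ) (p : ℝ) (G : SimpleGraph (Fin n)) : ℝ :=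
  p ^ Nat.card G.edgeSet * (1 - p) ^ (n.choose 2 - Nat.card G.edgeSet)

/-- The probability of an event `A` under the binomial random graph `G(n,p)`. -/
noncomputable def gnpProb (n : ℕ) (p : ℝ) (A : Set (SimpleGraph (Fin n))) : ℝ :=
  ∑' G : SimpleGraph (Fin n), A.indicator (gnpWeight n p) G

/-- `S(v,i)`: the set of vertices at graph distance exactly `i` from `v`. -/
def gSphere {V : Type*} (G : SimpleGraph V) (v : V) (i : ℕ) : Set V :=
  {u | G.Reachable v u ∧ G.dist v u = i}

/-- `N(v,i)`: the set of vertices at graph distance at most `i` from `v`. -/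
def gBall {V : Type*} (G : SimpleGraph V) (v : V) (i : ℕ) : Set V :=
  {u | G.Reachable v u ∧ G.dist v u ≤ i}

/-- `S(V',i)`: union of the spheres around the vertices of `V'`. -/
def gSphereSet {V : Type*} (G : SimpleGraph V) (W : Set V) (i : ℕ) : Set V :=
  ⋃ v ∈ W, gSphere G v i

/-- `N(V',i)`: union of the balls around the vertices of `V'`. -/
def gBallSet {V : Type*} (G : SimpleGraph V) (W : Set V) (i : ℕ) : Set V :=
  ⋃ v ∈ W, gBall G v i

/-! ### Expectations under `G(n,p)` and resampling of edges -/

section Resampling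

open scoped Classical

/-- The expectation of `F` under the binomial random graph `G(n,p)`. -/
noncomputable def gnpExp (n : ℕ) (p : ℝ) (F : SimpleGraph (Fin n) → ℝ) : ℝ :=
  ∑ G : SimpleGraph (Fin n), gnpWeight n p G * F G

/-- The graph that agrees with `H` on the pairs in `S` and with `G` elsewhere. -/
def mixGraph {V : Type*} (S : Set (Sym2 V)) (G H : SimpleGraph V) : SimpleGraph V :=
  SimpleGraph.fromEdgeSet ((G.edgeSet \ S) ∪ (H.edgeSet ∩ S))

/-- `F` only depends on the adjacency of the pairs in `S`. -/
def EdgeLocal {V : Type*} {β : Sort*} (S : Set (Sym2 V)) (F : SimpleGraph V → β) : Prop :=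
  ∀ ⦃G H : SimpleGraph V⦄, (∀ e ∈ S, e ∈ G.edgeSet ↔ e ∈ H.edgeSet) → F G = F H

lemma edgeSet_mixGraph {V : Type*} (S : Set (Sym2 V)) (G H : SimpleGraph V) :
    (mixGraph S G H).edgeSet = (G.edgeSet \ S) ∪ (H.edgeSet ∩ S) := by
  rw [mixGraph, SimpleGraph.edgeSet_fromEdgeSet]
  ext e
  simp only [Set.mem_sdiff, Set.mem_union, Set.mem_inter_iff]
  constructor
  · exact fun h => h.1
  · intro h
    refine ⟨h, fun hd => ?_⟩
    rcases h with h | h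
    · exact G.not_isDiag_of_mem_edgeSet h.1 hd
    · exact H.not_isDiag_of_mem_edgeSet h.1 hd

lemma mixGraph_adj {V : Type*} (S : Set (Sym2 V)) (G H : SimpleGraph V) (a b : V) :
    (mixGraph S G H).Adj a b ↔ (s(a, b) ∉ S ∧ G.Adj a b) ∨ (s(a, b) ∈ S ∧ H.Adj a b) := by
  rw [← SimpleGraph.mem_edgeSet, edgeSet_mixGraph]
  simp only [Set.mem_union, Set.mem_sdiff, Set.mem_inter_iff, SimpleGraph.mem_edgeSet]
  tauto

lemma mixGraph_mixGraph {V : Type*} (S : Set (Sym2 V)) (G H : SimpleGraph V) :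
    mixGraph S (mixGraph S G H) (mixGraph S H G) = G := by
  ext a b
  simp only [mixGraph_adj]
  tauto

lemma EdgeLocal.mono {V : Type*} {β : Sort*} {S T : Set (Sym2 V)} {F : SimpleGraph V → β}
    (h : EdgeLocal S F) (hST : S ⊆ T) : EdgeLocal T F :=
  fun _ _ hGH => h fun e he => hGH e (hST he)

lemma EdgeLocal.apply_mixGraph {V : Type*} {β : Sort*} {S : Set (Sym2 V)}
    {F : SimpleGraph V → β} (h : EdgeLocal S F) (G H : SimpleGraph V) :
    F (mixGraph S G H) = F H := by
  refine h fun e he => ?_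
  simp [edgeSet_mixGraph, he]

lemma EdgeLocal.apply_mixGraph_of_disjoint {V : Type*} {β : Sort*} {S T : Set (Sym2 V)}
    {F : SimpleGraph V → β} (h : EdgeLocal T F) (hST : Disjoint S T) (G H : SimpleGraph V) :
    F (mixGraph S G H) = F G := by
  refine h fun e he => ?_
  have : e ∉ S := fun h' => Set.disjoint_left.1 hST h' he
  simp [edgeSet_mixGraph, this]

lemma card_edgeSet_le_choose {n : ℕ} (G : SimpleGraph (Fin n)) :
    Nat.card G.edgeSet ≤ n.choose 2 := by
  have := G.card_edgeFinset_le_card_choose_two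
  rwa [SimpleGraph.edgeFinset_card, ← Nat.card_eq_fintype_card, Fintype.card_fin] at this

lemma gnpWeight_nonneg {n : ℕ} {p : ℝ} (hp : 0 ≤ p) (hp1 : p ≤ 1) (G : SimpleGraph (Fin n)) :
    0 ≤ gnpWeight n p G :=
  mul_nonneg (pow_nonneg hp _) (pow_nonneg (sub_nonneg.2 hp1) _)

lemma gnpWeight_mul_eq {n : ℕ} (p : ℝ) {G H G' H' : SimpleGraph (Fin n)}
    (h : Nat.card G.edgeSet + Nat.card H.edgeSet
      = Nat.card G'.edgeSet + Nat.card H'.edgeSet) :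
    gnpWeight n p G * gnpWeight n p H = gnpWeight n p G' * gnpWeight n p H' := by
  have h1 := card_edgeSet_le_choose G
  have h2 := card_edgeSet_le_choose H
  have h3 := card_edgeSet_le_choose G'
  have h4 := card_edgeSet_le_choose H'
  have key : ∀ A B : SimpleGraph (Fin n), gnpWeight n p A * gnpWeight n p B
      = p ^ (Nat.card A.edgeSet + Nat.card B.edgeSet)
        * (1 - p) ^ (n.choose 2 - Nat.card A.edgeSet + (n.choose 2 - Nat.card B.edgeSet)) := by
    intro A B
    rw [gnpWeight, gnpWeight, pow_add, pow_add]
    ring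
  rw [key, key, h]
  congr 2
  omega

lemma gnpWeight_mixGraph_mul {n : ℕ} (p : ℝ) (S : Set (Sym2 (Fin n)))
    (G H : SimpleGraph (Fin n)) :
    gnpWeight n p (mixGraph S G H) * gnpWeight n p (mixGraph S H G)
      = gnpWeight n p G * gnpWeight n p H := by
  apply gnpWeight_mul_eq
  have key : ∀ A B : Set (Sym2 (Fin n)),
      Nat.card ((A \ S) ∪ (B ∩ S) : Set (Sym2 (Fin n))) = (A \ S).ncard + (B ∩ S).ncard := by
    intro A B
    rw [Nat.card_coe_set_eq, Set.ncard_union_eq]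
    exact Set.disjoint_left.2 fun e he he' => he.2 he'.2
  have key2 : ∀ A : Set (Sym2 (Fin n)), Nat.card A = (A \ S).ncard + (A ∩ S).ncard := by
    intro A
    rw [← key A A, Set.sdiff_union_inter]
  rw [edgeSet_mixGraph, edgeSet_mixGraph, key, key, key2 G.edgeSet, key2 H.edgeSet]
  ring

lemma sum_gnpWeight (n : ℕ) (p : ℝ) : ∑ G : SimpleGraph (Fin n), gnpWeight n p G = 1 := by
  have h := Finset.sum_pow_mul_eq_add_pow p (1 - p) (⊤ : SimpleGraph (Fin n)).edgeFinset
  rw [add_sub_cancel, one_pow, SimpleGraph.card_edgeFinset_top_eq_card_choose_two,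
    Fintype.card_fin] at h
  rw [← h]
  refine Finset.sum_bij' (fun G _ => G.edgeFinset)
    (fun s _ => SimpleGraph.fromEdgeSet (s : Set (Sym2 (Fin n)))) ?_ ?_ ?_ ?_ ?_
  · intro G _
    rw [Finset.mem_powerset]
    exact SimpleGraph.edgeFinset_mono le_top
  · intro s _
    exact Finset.mem_univ _
  · intro G _
    simp
  · intro s hs
    rw [Finset.mem_powerset] at hs
    ext e
    simp only [SimpleGraph.mem_edgeFinset, SimpleGraph.edgeSet_fromEdgeSet, Set.mem_sdiff,
      Finset.mem_coe]
    refine ⟨fun h => h.1, fun h => ⟨h, fun hd => ?_⟩⟩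
    exact (⊤ : SimpleGraph (Fin n)).not_isDiag_of_mem_edgeSet
      (SimpleGraph.mem_edgeFinset.1 (hs h)) hd
  · intro G _
    rw [gnpWeight, Nat.card_eq_fintype_card, SimpleGraph.edgeFinset_card]

lemma gnpExp_const (n : ℕ) (p a : ℝ) : gnpExp n p (fun _ => a) = a := by
  rw [gnpExp, ← Finset.sum_mul, sum_gnpWeight, one_mul]

lemma gnpExp_mono {n : ℕ} {p : ℝ} (hp : 0 ≤ p) (hp1 : p ≤ 1) {F K : SimpleGraph (Fin n) → ℝ}
    (h : ∀ G, F G ≤ K G) : gnpExp n p F ≤ gnpExp n p K :=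
  Finset.sum_le_sum fun G _ => mul_le_mul_of_nonneg_left (h G) (gnpWeight_nonneg hp hp1 G)

lemma gnpProb_eq_gnpExp (n : ℕ) (p : ℝ) (A : Set (SimpleGraph (Fin n))) :
    gnpProb n p A = gnpExp n p (A.indicator 1) := by
  rw [gnpProb, tsum_fintype, gnpExp]
  refine Finset.sum_congr rfl fun G _ => ?_
  by_cases h : G ∈ A <;> simp [h]

lemma gnpProb_mono {n : ℕ} {p : ℝ} (hp : 0 ≤ p) (hp1 : p ≤ 1) {A B : Set (SimpleGraph (Fin n))}
    (h : A ⊆ B) : gnpProb n p A ≤ gnpProb n p B := by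
  rw [gnpProb_eq_gnpExp, gnpProb_eq_gnpExp]
  exact gnpExp_mono hp hp1 fun G => Set.indicator_le_indicator_of_subset h (fun _ => zero_le_one) G

lemma gnpProb_nonneg {n : ℕ} {p : ℝ} (hp : 0 ≤ p) (hp1 : p ≤ 1)
    (A : Set (SimpleGraph (Fin n))) : 0 ≤ gnpProb n p A := by
  rw [gnpProb_eq_gnpExp]
  exact Finset.sum_nonneg fun G _ => mul_nonneg (gnpWeight_nonneg hp hp1 G)
    (Set.indicator_nonneg (fun _ _ => zero_le_one) G)

lemma gnpProb_univ (n : ℕ) (p : ℝ) : gnpProb n p Set.univ = 1 := by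
  rw [gnpProb_eq_gnpExp, Set.indicator_univ]
  exact gnpExp_const n p 1

lemma gnpProb_empty (n : ℕ) (p : ℝ) : gnpProb n p ∅ = 0 := by
  rw [gnpProb_eq_gnpExp, Set.indicator_empty]
  exact gnpExp_const n p 0

lemma gnpProb_le_one {n : ℕ} {p : ℝ} (hp : 0 ≤ p) (hp1 : p ≤ 1)
    (A : Set (SimpleGraph (Fin n))) : gnpProb n p A ≤ 1 :=
  (gnpProb_mono hp hp1 (Set.subset_univ A)).trans_eq (gnpProb_univ n p)

lemma gnpProb_compl (n : ℕ) (p : ℝ) (A : Set (SimpleGraph (Fin n))) :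
    gnpProb n p Aᶜ = 1 - gnpProb n p A := by
  rw [eq_sub_iff_add_eq, ← gnpProb_univ n p, gnpProb_eq_gnpExp, gnpProb_eq_gnpExp,
    gnpProb_eq_gnpExp, gnpExp, gnpExp, gnpExp, ← Finset.sum_add_distrib]
  refine Finset.sum_congr rfl fun G _ => ?_
  by_cases h : G ∈ A <;> simp [h]

lemma gnpProb_biUnion_le {n : ℕ} {p : ℝ} (hp : 0 ≤ p) (hp1 : p ≤ 1) {ι : Type*} (s : Finset ι)
    (A : ι → Set (SimpleGraph (Fin n))) :
    gnpProb n p {G | ∃ j ∈ s, G ∈ A j} ≤ ∑ j ∈ s, gnpProb n p (A j) := by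
  simp only [gnpProb_eq_gnpExp, gnpExp]
  rw [Finset.sum_comm]
  refine Finset.sum_le_sum fun G _ => ?_
  rw [← Finset.mul_sum]
  refine mul_le_mul_of_nonneg_left ?_ (gnpWeight_nonneg hp hp1 G)
  have h0 : ∀ j ∈ s, (0 : ℝ) ≤ (A j).indicator 1 G :=
    fun j _ => Set.indicator_nonneg (fun _ _ => zero_le_one) G
  by_cases h : ∃ j ∈ s, G ∈ A j
  · obtain ⟨j, hj, hG⟩ := h
    refine le_trans ?_ (Finset.single_le_sum h0 hj)
    rw [Set.indicator_of_mem hG]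
    exact Set.indicator_le_self' (fun _ _ => zero_le_one) G
  · rw [Set.indicator_of_notMem (show G ∉ {G | ∃ j ∈ s, G ∈ A j} from h)]
    exact Finset.sum_nonneg h0

lemma gnpProb_union_le {n : ℕ} {p : ℝ} (hp : 0 ≤ p) (hp1 : p ≤ 1)
    (A B : Set (SimpleGraph (Fin n))) :
    gnpProb n p (A ∪ B) ≤ gnpProb n p A + gnpProb n p B := by
  have h := gnpProb_biUnion_le hp hp1 (Finset.univ : Finset Bool) (fun b => if b then A else B)
  simp only [Finset.mem_univ, true_and, Bool.exists_bool, Fintype.sum_bool, if_true,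
    Bool.false_eq_true, if_false] at h
  refine le_trans (gnpProb_mono hp hp1 ?_) h
  rintro G (hG | hG)
  exacts [Or.inr hG, Or.inl hG]

/-- Resampling the pairs in a set `S G` that is itself determined by the pairs outside it
leaves the distribution `G(n,p)` unchanged. -/
lemma gnpExp_resample {n : ℕ} (p : ℝ) (S : SimpleGraph (Fin n) → Set (Sym2 (Fin n)))
    (hS : ∀ G H, S (mixGraph (S G) G H) = S G) (F : SimpleGraph (Fin n) → ℝ) :
    gnpExp n p F
      = ∑ G : SimpleGraph (Fin n),
          gnpWeight n p G * gnpExp n p (fun H => F (mixGraph (S G) G H)) := by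
  let Φ : SimpleGraph (Fin n) × SimpleGraph (Fin n) → SimpleGraph (Fin n) × SimpleGraph (Fin n) :=
    fun x => (mixGraph (S x.1) x.1 x.2, mixGraph (S x.1) x.2 x.1)
  have hΦ : Function.Involutive Φ := by
    rintro ⟨G, H⟩
    simp only [Φ, hS, mixGraph_mixGraph]
  let f : SimpleGraph (Fin n) × SimpleGraph (Fin n) → ℝ :=
    fun x => gnpWeight n p x.1 * gnpWeight n p x.2 * F x.1
  have h1 : ∑ x, f x = gnpExp n p F := by
    rw [Fintype.sum_prod_type, gnpExp]
    refine Finset.sum_congr rfl fun G _ => ?_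
    have : ∀ H, f (G, H) = gnpWeight n p G * F G * gnpWeight n p H := fun H => by
      simp only [f]; ring
    simp only [this]
    rw [← Finset.mul_sum, sum_gnpWeight, mul_one]
  rw [← h1, ← Equiv.sum_comp hΦ.toPerm f, Fintype.sum_prod_type]
  refine Finset.sum_congr rfl fun G _ => ?_
  rw [gnpExp, Finset.mul_sum]
  refine Finset.sum_congr rfl fun H _ => ?_
  simp only [Function.Involutive.coe_toPerm, Φ, f, gnpWeight_mixGraph_mul]
  ring

lemma gnpProb_le_of_resample {n : ℕ} {p ε : ℝ} (hp : 0 ≤ p) (hp1 : p ≤ 1)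
    (S : SimpleGraph (Fin n) → Set (Sym2 (Fin n)))
    (hS : ∀ G H, S (mixGraph (S G) G H) = S G) (B : Set (SimpleGraph (Fin n)))
    (hB : ∀ G, gnpProb n p {H | mixGraph (S G) G H ∈ B} ≤ ε) : gnpProb n p B ≤ ε := by
  rw [gnpProb_eq_gnpExp, gnpExp_resample p S hS]
  calc _ ≤ ∑ G : SimpleGraph (Fin n), gnpWeight n p G * ε := by
        refine Finset.sum_le_sum fun G _ => ?_
        refine mul_le_mul_of_nonneg_left ?_ (gnpWeight_nonneg hp hp1 G)
        refine le_trans (le_of_eq ?_) (hB G)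
        rw [gnpProb_eq_gnpExp]
        rfl
    _ = ε := by rw [← Finset.sum_mul, sum_gnpWeight, one_mul]

lemma EdgeLocal.gnpExp_mul {n : ℕ} (p : ℝ) {S T : Set (Sym2 (Fin n))} (hST : Disjoint S T)
    {F K : SimpleGraph (Fin n) → ℝ} (hF : EdgeLocal S F) (hK : EdgeLocal T K) :
    gnpExp n p (fun G => F G * K G) = gnpExp n p F * gnpExp n p K := by
  rw [gnpExp_resample p (fun _ => S) (fun _ _ => rfl)]
  simp only [hF.apply_mixGraph, hK.apply_mixGraph_of_disjoint hST]
  simp only [gnpExp, Finset.sum_mul, Finset.mul_sum]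
  refine Finset.sum_congr rfl fun G _ => Finset.sum_congr rfl fun H _ => ?_
  ring

lemma EdgeLocal.gnpExp_prod {n : ℕ} (p : ℝ) {ι : Type*} (s : Finset ι)
    (S : ι → Set (Sym2 (Fin n))) (F : ι → SimpleGraph (Fin n) → ℝ)
    (hS : ∀ j ∈ s, ∀ k ∈ s, j ≠ k → Disjoint (S j) (S k))
    (hF : ∀ j ∈ s, EdgeLocal (S j) (F j)) :
    gnpExp n p (fun G => ∏ j ∈ s, F j G) = ∏ j ∈ s, gnpExp n p (F j) := by
  induction s using Finset.induction_on with
  | empty => simp [gnpExp_const]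
  | insert a s ha ih =>
    simp only [Finset.prod_insert ha]
    rw [← ih (fun j hj k hk => hS j (Finset.mem_insert_of_mem hj) k (Finset.mem_insert_of_mem hk))
      (fun j hj => hF j (Finset.mem_insert_of_mem hj))]
    refine EdgeLocal.gnpExp_mul p (T := ⋃ j ∈ s, S j) ?_ (hF a (Finset.mem_insert_self a s)) ?_
    · rw [Set.disjoint_iUnion₂_right]
      intro j hj
      exact hS a (Finset.mem_insert_self a s) j (Finset.mem_insert_of_mem hj)
        (fun h => ha (h ▸ hj))
    · intro G H hGH
      refine Finset.prod_congr rfl fun j hj => ?_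
      refine hF j (Finset.mem_insert_of_mem hj) fun e he => hGH e ?_
      exact Set.mem_biUnion hj he

lemma gnpProb_adj {n : ℕ} (p : ℝ) {a b : Fin n} (hab : a ≠ b) :
    gnpProb n p {G | G.Adj a b} = p := by
  set S : Set (Sym2 (Fin n)) := {s(a, b)} with hS
  let Φ : SimpleGraph (Fin n) → SimpleGraph (Fin n) := fun G => mixGraph S G Gᶜ
  have hcompl : ∀ G : SimpleGraph (Fin n), (Φ G).Adj a b ↔ ¬ G.Adj a b := by
    intro G
    simp [Φ, mixGraph_adj, S, hab]
  have hΦ : Function.Involutive Φ := by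
    intro G
    ext x y
    by_cases hxy : s(x, y) ∈ S
    · have hne : x ≠ y := by
        rintro rfl
        rw [hS, Set.mem_singleton_iff, Sym2.eq_iff] at hxy
        rcases hxy with ⟨h1, h2⟩ | ⟨h1, h2⟩
        · exact hab (h1.symm.trans h2)
        · exact hab (h2.symm.trans h1)
      simp [Φ, mixGraph_adj, hxy, hne]
    · simp [Φ, mixGraph_adj, hxy]
  have hw : ∀ G : SimpleGraph (Fin n), ¬ G.Adj a b →
      gnpWeight n p (Φ G) * (1 - p) = gnpWeight n p G * p := by
    intro G hG
    have he : (Φ G).edgeSet = insert s(a, b) G.edgeSet := by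
      ext e
      induction e with
      | h x y =>
        simp only [SimpleGraph.mem_edgeSet, Set.mem_insert_iff]
        by_cases hxy : s(x, y) = s(a, b)
        · have : s(x, y) ∈ (Φ G).edgeSet := by
            rw [hxy, SimpleGraph.mem_edgeSet, hcompl]; exact hG
          simp only [hxy, true_or, iff_true]
          exact this
        · simp [Φ, mixGraph_adj, S, hxy]
    have hcard : Nat.card (Φ G).edgeSet = Nat.card G.edgeSet + 1 := by
      rw [he, Nat.card_coe_set_eq, Set.ncard_insert_of_notMem, Nat.card_coe_set_eq]
      rwa [SimpleGraph.mem_edgeSet]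
    have hle := card_edgeSet_le_choose (Φ G)
    rw [gnpWeight, gnpWeight, hcard]
    rw [hcard] at hle
    obtain ⟨m, hm⟩ := Nat.exists_eq_add_of_le hle
    rw [hm, show Nat.card G.edgeSet + 1 + m - (Nat.card G.edgeSet + 1) = m by omega,
      show Nat.card G.edgeSet + 1 + m - Nat.card G.edgeSet = m + 1 by omega]
    ring
  have h1 : gnpProb n p {G | G.Adj a b} * (1 - p)
      = gnpProb n p {G | G.Adj a b}ᶜ * p := by
    rw [gnpProb_eq_gnpExp, gnpProb_eq_gnpExp, gnpExp, gnpExp, Finset.sum_mul, Finset.sum_mul,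
      ← Equiv.sum_comp hΦ.toPerm]
    refine Finset.sum_congr rfl fun G _ => ?_
    by_cases hG : G.Adj a b
    · have : ¬ (Φ G).Adj a b := by rw [hcompl]; exact fun h => h hG
      simp [hG, this]
    · have := hw G hG
      have h' : (Φ G).Adj a b := by rw [hcompl]; exact hG
      simp [hG, h', this]
  rw [gnpProb_compl] at h1
  linarith

/-- The probability that `v` has no neighbour in a set not containing `v`. -/
lemma gnpProb_no_neighbor {n : ℕ} (p : ℝ) (v : Fin n) (L : Finset (Fin n)) (hv : v ∉ L) :
    gnpProb n p {G | ∀ x ∈ L, ¬ G.Adj v x} = (1 - p) ^ L.card := by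
  have h := EdgeLocal.gnpExp_prod p L (fun x => {s(v, x)})
    (fun x => ({G : SimpleGraph (Fin n) | G.Adj v x}ᶜ).indicator 1) ?_ ?_
  · have h2 : ∀ x ∈ L, gnpExp n p (({G : SimpleGraph (Fin n) | G.Adj v x}ᶜ).indicator 1)
        = 1 - p := by
      intro x hx
      rw [← gnpProb_eq_gnpExp, gnpProb_compl, gnpProb_adj]
      rintro rfl
      exact hv hx
    rw [Finset.prod_congr rfl h2, Finset.prod_const] at h
    rw [← h, gnpProb_eq_gnpExp]
    congr 1
    ext G
    by_cases hG : ∀ x ∈ L, ¬ G.Adj v x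
    · rw [Set.indicator_of_mem (show G ∈ {G | ∀ x ∈ L, ¬ G.Adj v x} from hG),
        Finset.prod_eq_one]
      · rfl
      · intro x hx
        rw [Set.indicator_of_mem]
        · rfl
        · exact hG x hx
    · rw [Set.indicator_of_notMem (show G ∉ {G | ∀ x ∈ L, ¬ G.Adj v x} from hG)]
      push Not at hG
      obtain ⟨x, hx, hG⟩ := hG
      rw [Finset.prod_eq_zero hx]
      rw [Set.indicator_of_notMem]
      exact fun h => h hG
  · intro x hx y hy hxy
    rw [Set.disjoint_singleton]
    intro h
    rw [Sym2.eq_iff] at h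
    rcases h with h | h
    · exact hxy h.2
    · exact hxy (h.2.trans h.1)
  · intro x hx G H hGH
    have := hGH s(v, x) rfl
    simp only [SimpleGraph.mem_edgeSet] at this
    simp only [Set.indicator, Set.mem_compl_iff, Set.mem_ofPred_eq, this, Pi.one_apply]

/-- The Harris inequality for two increasing events. -/
lemma gnpProb_inter_ge_of_monotone {n : ℕ} {p : ℝ} (hp : 0 ≤ p) (hp1 : p ≤ 1)
    {A B : Set (SimpleGraph (Fin n))} (hA : IsUpperSet A) (hB : IsUpperSet B) :
    gnpProb n p A * gnpProb n p B ≤ gnpProb n p (A ∩ B) := by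
  have hmono : ∀ C : Set (SimpleGraph (Fin n)), IsUpperSet C →
      Monotone (C.indicator (1 : SimpleGraph (Fin n) → ℝ)) := by
    intro C hC G H hGH
    by_cases h : G ∈ C
    · rw [Set.indicator_of_mem h, Set.indicator_of_mem (hC hGH h)]
      rfl
    · rw [Set.indicator_of_notMem h]
      exact Set.indicator_nonneg (fun _ _ => zero_le_one) H
  have hnn : ∀ C : Set (SimpleGraph (Fin n)),
      (0 : SimpleGraph (Fin n) → ℝ) ≤ C.indicator (1 : SimpleGraph (Fin n) → ℝ) :=
    fun C G => Set.indicator_nonneg (fun _ _ => zero_le_one) G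
  have h := fkg (μ := gnpWeight n p) (f := A.indicator 1) (g := B.indicator 1)
    (fun G => gnpWeight_nonneg hp hp1 G) (hnn A) (hnn B) (hmono A hA) (hmono B hB) ?_
  · rw [sum_gnpWeight, one_mul] at h
    rw [gnpProb_eq_gnpExp, gnpProb_eq_gnpExp, gnpProb_eq_gnpExp]
    refine h.trans (le_of_eq ?_)
    refine Finset.sum_congr rfl fun G _ => ?_
    rw [Set.inter_indicator_one]
    rfl
  · intro G H
    refine le_of_eq (gnpWeight_mul_eq p ?_)
    rw [SimpleGraph.edgeSet_inf, SimpleGraph.edgeSet_sup, Nat.card_coe_set_eq,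
      Nat.card_coe_set_eq, Nat.card_coe_set_eq, Nat.card_coe_set_eq, add_comm (Set.ncard (_ ∩ _)),
      Set.ncard_union_add_ncard_inter]

lemma gnpProb_forall_ge_prod {n : ℕ} {p : ℝ} (hp : 0 ≤ p) (hp1 : p ≤ 1) {ι : Type*}
    (s : Finset ι) (A : ι → Set (SimpleGraph (Fin n))) (hA : ∀ j ∈ s, IsUpperSet (A j)) :
    ∏ j ∈ s, gnpProb n p (A j) ≤ gnpProb n p {G | ∀ j ∈ s, G ∈ A j} := by
  induction s using Finset.induction_on with
  | empty => simp [gnpProb_univ]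
  | insert a s ha ih =>
    rw [Finset.prod_insert ha]
    have h1 := ih fun j hj => hA j (Finset.mem_insert_of_mem hj)
    have h2 : IsUpperSet {G | ∀ j ∈ s, G ∈ A j} :=
      fun G H hGH hG j hj => hA j (Finset.mem_insert_of_mem hj) hGH (hG j hj)
    refine (mul_le_mul_of_nonneg_left h1 (gnpProb_nonneg hp hp1 _)).trans ?_
    refine (gnpProb_inter_ge_of_monotone hp hp1 (hA a (Finset.mem_insert_self a s)) h2).trans ?_
    refine gnpProb_mono hp hp1 ?_
    rintro G ⟨h3, h4⟩ j hj
    rcases Finset.mem_insert.1 hj with rfl | hj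
    exacts [h3, h4 j hj]

end Resampling

/-! ### Breadth-first layers and distances -/

section Layers

open scoped Classical

variable {V : Type*} [Fintype V]

/-- The vertices with a neighbour in `A`. -/
noncomputable def nbrs (G : SimpleGraph V) (A : Finset V) : Finset V :=
  Finset.univ.filter fun x => ∃ a ∈ A, G.Adj a x

/-- The vertices within distance `j` of the set `R`. -/
noncomputable def bfsBall (G : SimpleGraph V) (R : Finset V) : ℕ → Finset V
  | 0 => R
  | j + 1 => bfsBall G R j ∪ nbrs G (bfsBall G R j)

/-- The vertices at distance `j` from the set `R` that are reached in `j` steps from `A ⊆ R`. -/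
noncomputable def bfsLayer (G : SimpleGraph V) (R A : Finset V) : ℕ → Finset V
  | 0 => A
  | j + 1 => nbrs G (bfsLayer G R A j) \ bfsBall G R j

/-- The pairs with one element in `L` and the other in `U`. -/
def crossPairs (L U : Finset V) : Set (Sym2 V) :=
  {e | ∃ a ∈ L, ∃ b ∈ U, e = s(a, b)}

/-- The vertices whose distances to `v` and `w` differ. -/
noncomputable def distinguishers (G : SimpleGraph V) (v w : V) : Finset V :=
  Finset.univ.filter fun u => G.dist u v ≠ G.dist u w

lemma mem_nbrs {G : SimpleGraph V} {A : Finset V} {x : V} :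
    x ∈ nbrs G A ↔ ∃ a ∈ A, G.Adj a x := by simp [nbrs]

lemma nbrs_mono (G : SimpleGraph V) {A B : Finset V} (h : A ⊆ B) : nbrs G A ⊆ nbrs G B := by
  intro x hx
  obtain ⟨a, ha, hax⟩ := mem_nbrs.1 hx
  exact mem_nbrs.2 ⟨a, h ha, hax⟩

lemma bfsBall_mono (G : SimpleGraph V) (R : Finset V) : Monotone (bfsBall G R) :=
  monotone_nat_of_le_succ fun _ => Finset.subset_union_left

lemma bfsLayer_subset_bfsBall (G : SimpleGraph V) {R A : Finset V} (hA : A ⊆ R) (j : ℕ) :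
    bfsLayer G R A j ⊆ bfsBall G R j := by
  induction j with
  | zero => exact hA
  | succ j ih =>
    exact (Finset.sdiff_subset.trans (nbrs_mono G ih)).trans Finset.subset_union_right

lemma notMem_bfsBall_of_mem_bfsLayer {G : SimpleGraph V} {R A : Finset V} {x : V} {j k : ℕ}
    (hx : x ∈ bfsLayer G R A j) (hk : k < j) : x ∉ bfsBall G R k := by
  obtain ⟨j, rfl⟩ := Nat.exists_eq_add_of_lt hk
  intro h
  rw [show k + j + 1 = (k + j) + 1 from rfl, bfsLayer, Finset.mem_sdiff] at hx
  exact hx.2 (bfsBall_mono G R (Nat.le_add_right k j) h)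

lemma mem_bfsLayer_self_succ {G : SimpleGraph V} {R : Finset V} {x : V} {j : ℕ} :
    x ∈ bfsLayer G R R (j + 1) ↔ x ∈ bfsBall G R (j + 1) ∧ x ∉ bfsBall G R j := by
  refine ⟨fun h => ⟨bfsLayer_subset_bfsBall G subset_rfl _ h,
    notMem_bfsBall_of_mem_bfsLayer h (Nat.lt_succ_self j)⟩, ?_⟩
  induction j generalizing x with
  | zero =>
    rintro ⟨h1, h2⟩
    rw [bfsBall, Finset.mem_union] at h1
    exact Finset.mem_sdiff.2 ⟨h1.resolve_left h2, h2⟩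
  | succ j ih =>
    rintro ⟨h1, h2⟩
    rw [bfsBall, Finset.mem_union] at h1
    obtain ⟨a, ha, hax⟩ := mem_nbrs.1 (h1.resolve_left h2)
    refine Finset.mem_sdiff.2 ⟨mem_nbrs.2 ⟨a, ih ⟨ha, fun ha' => h2 ?_⟩, hax⟩, h2⟩
    exact Finset.mem_union_right _ (mem_nbrs.2 ⟨a, ha', hax⟩)

lemma bfsBall_succ_eq (G : SimpleGraph V) (R : Finset V) (j : ℕ) :
    bfsBall G R (j + 1) = bfsBall G R j ∪ bfsLayer G R R (j + 1) := by
  ext x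
  rw [Finset.mem_union, mem_bfsLayer_self_succ]
  have := bfsBall_mono G R (Nat.le_succ j)
  exact ⟨fun h => by tauto, fun h => h.elim (fun h => this h) (fun h => h.1)⟩

lemma mem_bfsLayer_iff_exists {G : SimpleGraph V} {R A : Finset V} {x : V} {j : ℕ} :
    x ∈ bfsLayer G R A j ↔ ∃ u ∈ A, x ∈ bfsLayer G R {u} j := by
  induction j generalizing x with
  | zero => simp [bfsLayer]
  | succ j ih =>
    simp only [bfsLayer, Finset.mem_sdiff, mem_nbrs, ih]
    constructor
    · rintro ⟨⟨a, ⟨u, hu, hau⟩, hax⟩, hx⟩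
      exact ⟨u, hu, ⟨a, hau, hax⟩, hx⟩
    · rintro ⟨u, hu, ⟨a, hau, hax⟩, hx⟩
      exact ⟨⟨a, ⟨u, hu, hau⟩, hax⟩, hx⟩

lemma mem_bfsBall_of_walk {G : SimpleGraph V} {R : Finset V} {u x : V} (w : G.Walk u x) {k : ℕ}
    (hu : u ∈ bfsBall G R k) : x ∈ bfsBall G R (k + w.length) := by
  induction w generalizing k with
  | nil => exact hu
  | cons h w ih =>
    have := ih (k := k + 1) (Finset.mem_union_right _ (mem_nbrs.2 ⟨_, hu, h⟩))
    rw [SimpleGraph.Walk.length_cons]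
    rwa [show k + (w.length + 1) = k + 1 + w.length by ring]

lemma mem_bfsBall_dist {G : SimpleGraph V} {R : Finset V} {u x : V} (hu : u ∈ R)
    (h : G.Reachable u x) : x ∈ bfsBall G R (G.dist u x) := by
  obtain ⟨w, hw⟩ := h.exists_walk_length_eq_dist
  have := mem_bfsBall_of_walk w (show u ∈ bfsBall G R 0 from hu)
  rwa [zero_add, hw] at this

lemma exists_walk_of_mem_bfsLayer {G : SimpleGraph V} {R : Finset V} {u x : V} {j : ℕ}
    (h : x ∈ bfsLayer G R {u} j) : ∃ w : G.Walk x u, w.length = j := by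
  induction j generalizing x with
  | zero =>
    rw [bfsLayer, Finset.mem_singleton] at h
    subst h
    exact ⟨SimpleGraph.Walk.nil, rfl⟩
  | succ j ih =>
    rw [bfsLayer, Finset.mem_sdiff] at h
    obtain ⟨a, ha, hax⟩ := mem_nbrs.1 h.1
    obtain ⟨w, hw⟩ := ih ha
    exact ⟨SimpleGraph.Walk.cons hax.symm w, by rw [SimpleGraph.Walk.length_cons, hw]⟩

lemma dist_of_mem_bfsLayer {G : SimpleGraph V} {R : Finset V} {u x : V} {j : ℕ} (hu : u ∈ R)
    (h : x ∈ bfsLayer G R {u} j) : G.Reachable u x ∧ G.dist u x = j := by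
  obtain ⟨w, hw⟩ := exists_walk_of_mem_bfsLayer h
  have hr : G.Reachable u x := ⟨w.reverse⟩
  refine ⟨hr, le_antisymm ?_ ?_⟩
  · rw [SimpleGraph.dist_comm, ← hw]
    exact SimpleGraph.dist_le w
  · by_contra! hlt
    exact notMem_bfsBall_of_mem_bfsLayer h hlt (mem_bfsBall_dist hu hr)

lemma mem_bfsLayer_of_walk {G : SimpleGraph V} {R : Finset V} {u x : V} (w : G.Walk x u)
    (h : ∀ k < w.length, x ∉ bfsBall G R k) : x ∈ bfsLayer G R {u} w.length := by
  induction w with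
  | nil => exact Finset.mem_singleton_self _
  | @cons x y u hxy w ih =>
    rw [SimpleGraph.Walk.length_cons] at h ⊢
    refine Finset.mem_sdiff.2 ⟨mem_nbrs.2 ⟨y, ih ?_, hxy.symm⟩, h _ (Nat.lt_succ_self _)⟩
    intro k hk hy
    exact h (k + 1) (by omega) (Finset.mem_union_right _ (mem_nbrs.2 ⟨y, hy, hxy.symm⟩))

lemma bfsLayer_sdiff_subset_distinguishers [DecidableEq V] (G : SimpleGraph V) {v w : V}
    {j : ℕ} (hj : j ≠ 0) :
    bfsLayer G {v, w} {v} j \ bfsLayer G {v, w} {w} j ⊆ distinguishers G v w := by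
  intro x hx
  rw [Finset.mem_sdiff] at hx
  have h1 := dist_of_mem_bfsLayer (by simp) hx.1
  rw [distinguishers, Finset.mem_filter]
  refine ⟨Finset.mem_univ _, fun h => hx.2 ?_⟩
  rw [SimpleGraph.dist_comm, h1.2] at h
  have hr : G.Reachable x w := SimpleGraph.Reachable.of_dist_ne_zero (h ▸ hj)
  obtain ⟨q, hq⟩ := hr.exists_walk_length_eq_dist
  have h2 := mem_bfsLayer_of_walk (R := {v, w}) q fun k hk =>
    notMem_bfsBall_of_mem_bfsLayer hx.1 (by omega)
  rwa [hq, ← h] at h2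

/-- If many vertices outside the `j`-ball of `R` are at distance exactly `j + 1` from all of
`T ⊆ R`, and the remaining vertices of `R` have neighbours in `T`, then `R` is not resolving. -/
lemma not_resolves_of_card_lt [DecidableEq V] {G : SimpleGraph V} {R T X : Finset V} {j : ℕ}
    (hT : T ⊆ R)
    (hnb : ∀ u ∈ R \ T, ∃ u' ∈ T, G.Adj u u')
    (hX : ∀ x ∈ X, x ∉ bfsBall G R j ∧ ∀ u ∈ T, ∃ a ∈ bfsLayer G R {u} j, G.Adj a x)
    (hcard : 2 ^ (R \ T).card < X.card) : ¬ Resolves G (R : Set V) := by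
  have hd : ∀ x ∈ X, ∀ u ∈ T, G.Reachable u x ∧ G.dist u x = j + 1 := by
    intro x hx u hu
    refine dist_of_mem_bfsLayer (j := j + 1) (hT hu) ?_
    simp only [bfsLayer, Finset.mem_sdiff]
    refine ⟨mem_nbrs.2 ?_, (hX x hx).1⟩
    exact (hX x hx).2 u hu
  have hd2 : ∀ x ∈ X, ∀ u ∈ R \ T, G.dist u x = j + 1 ∨ G.dist u x = j + 2 := by
    intro x hx u hu
    obtain ⟨u', hu', hadj⟩ := hnb u hu
    obtain ⟨hr, hdist⟩ := hd x hx u' hu'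
    obtain ⟨w, hw⟩ := hr.exists_walk_length_eq_dist
    have hle := SimpleGraph.dist_le (SimpleGraph.Walk.cons hadj w)
    rw [SimpleGraph.Walk.length_cons, hw, hdist] at hle
    have hlt : j < G.dist u x := by
      by_contra! hle
      exact (hX x hx).1 (bfsBall_mono G R hle
        (mem_bfsBall_dist (Finset.mem_sdiff.1 hu).1 (hadj.reachable.trans hr)))
    omega
  obtain ⟨x, hx, y, hy, hxy, heq⟩ := Finset.exists_ne_map_eq_of_card_lt_of_maps_to
    (t := (R \ T).powerset) (f := fun x => (R \ T).filter fun u => G.dist u x = j + 1)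
    (by rwa [Finset.card_powerset])
    (fun x _ => Finset.mem_coe.2 (Finset.mem_powerset.2 (Finset.filter_subset _ _)))
  intro hres
  obtain ⟨u, hu, hne⟩ := hres hxy
  by_cases huT : u ∈ T
  · exact hne ((hd x hx u huT).2.trans (hd y hy u huT).2.symm)
  · have hu' : u ∈ R \ T := Finset.mem_sdiff.2 ⟨hu, huT⟩
    have h := Finset.ext_iff.1 heq u
    simp only [Finset.mem_filter, hu', true_and] at h
    rcases hd2 x hx u hu' with h1 | h1 <;> rcases hd2 y hy u hu' with h2 | h2 <;> omega

/-! The layers up to `j` do not change when the pairs between the `j`-th layer and the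
complement of the `j`-ball are resampled. -/

/-- The pairs between the `j`-th layer around `R` and the complement of the `j`-ball. -/
def freshPairs (G : SimpleGraph V) (R : Finset V) (j : ℕ) : Set (Sym2 V) :=
  crossPairs (bfsLayer G R R j) (bfsBall G R j)ᶜ

lemma notMem_freshPairs {G : SimpleGraph V} {R : Finset V} {j k : ℕ} (hk : k < j) {a x : V}
    (ha : a ∈ bfsBall G R k) : s(a, x) ∉ freshPairs G R j := by
  rintro ⟨b, hb, c, hc, h⟩
  rw [Sym2.eq_iff] at h
  rw [Finset.mem_compl] at hc
  rcases h with ⟨rfl, rfl⟩ | ⟨rfl, rfl⟩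
  · exact notMem_bfsBall_of_mem_bfsLayer hb hk ha
  · exact hc (bfsBall_mono G R hk.le ha)

lemma nbrs_mixGraph_freshPairs {G : SimpleGraph V} {R A : Finset V} {j k : ℕ} (hk : k < j)
    (hA : A ⊆ bfsBall G R k) (H : SimpleGraph V) :
    nbrs (mixGraph (freshPairs G R j) G H) A = nbrs G A := by
  ext x
  simp only [mem_nbrs]
  refine exists_congr fun a => and_congr_right fun ha => ?_
  have := notMem_freshPairs hk (hA ha) (x := x)
  simp [mixGraph_adj, this]

lemma bfsBall_mixGraph (G H : SimpleGraph V) (R : Finset V) {j k : ℕ} (hk : k ≤ j) :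
    bfsBall (mixGraph (freshPairs G R j) G H) R k = bfsBall G R k := by
  induction k with
  | zero => rfl
  | succ k ih =>
    rw [bfsBall, ih (by omega), nbrs_mixGraph_freshPairs hk subset_rfl, bfsBall]

lemma bfsLayer_mixGraph (G H : SimpleGraph V) {R A : Finset V} (hA : A ⊆ R) {j k : ℕ}
    (hk : k ≤ j) :
    bfsLayer (mixGraph (freshPairs G R j) G H) R A k = bfsLayer G R A k := by
  induction k with
  | zero => rfl
  | succ k ih =>
    rw [bfsLayer, ih (by omega), nbrs_mixGraph_freshPairs hk (bfsLayer_subset_bfsBall G hA k),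
      bfsBall_mixGraph G H R (by omega), bfsLayer]

lemma freshPairs_mixGraph (G H : SimpleGraph V) (R : Finset V) (j : ℕ) :
    freshPairs (mixGraph (freshPairs G R j) G H) R j = freshPairs G R j := by
  rw [freshPairs, bfsLayer_mixGraph G H subset_rfl le_rfl, bfsBall_mixGraph G H R le_rfl,
    freshPairs]

lemma mixGraph_freshPairs_adj {G H : SimpleGraph V} {R : Finset V} {j : ℕ} {a x : V}
    (ha : a ∈ bfsLayer G R R j) (hx : x ∉ bfsBall G R j) :
    (mixGraph (freshPairs G R j) G H).Adj a x ↔ H.Adj a x := by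
  have : s(a, x) ∈ freshPairs G R j := ⟨a, ha, x, Finset.mem_compl.2 hx, rfl⟩
  simp [mixGraph_adj, this]

/-! Sizes of layers. -/

lemma card_nbrs_le {G : SimpleGraph V} {D : ℝ} (hD : ∀ v, ((nbrs G {v}).card : ℝ) ≤ D)
    (A : Finset V) : ((nbrs G A).card : ℝ) ≤ A.card * D := by
  have h : nbrs G A ⊆ A.biUnion fun a => nbrs G {a} := by
    intro x hx
    obtain ⟨a, ha, hax⟩ := mem_nbrs.1 hx
    exact Finset.mem_biUnion.2 ⟨a, ha, mem_nbrs.2 ⟨a, Finset.mem_singleton_self a, hax⟩⟩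
  calc ((nbrs G A).card : ℝ) ≤ ((∑ a ∈ A, (nbrs G {a}).card : ℕ) : ℝ) := by
        exact_mod_cast (Finset.card_le_card h).trans Finset.card_biUnion_le
    _ ≤ ∑ a ∈ A, D := by
        push_cast
        exact Finset.sum_le_sum fun a _ => hD a
    _ = A.card * D := by rw [Finset.sum_const, nsmul_eq_mul]

lemma card_bfsLayer_le {G : SimpleGraph V} {D : ℝ} (hD0 : 0 ≤ D)
    (hD : ∀ v, ((nbrs G {v}).card : ℝ) ≤ D) (R A : Finset V) (j : ℕ) :
    ((bfsLayer G R A j).card : ℝ) ≤ A.card * D ^ j := by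
  induction j with
  | zero => simp [bfsLayer]
  | succ j ih =>
    calc ((bfsLayer G R A (j + 1)).card : ℝ) ≤ (nbrs G (bfsLayer G R A j)).card := by
          exact_mod_cast Finset.card_le_card Finset.sdiff_subset
      _ ≤ (bfsLayer G R A j).card * D := card_nbrs_le hD _
      _ ≤ A.card * D ^ j * D := mul_le_mul_of_nonneg_right ih hD0
      _ = A.card * D ^ (j + 1) := by ring

lemma card_bfsBall_le {G : SimpleGraph V} {D : ℝ} (hD2 : 2 ≤ D)
    (hD : ∀ v, ((nbrs G {v}).card : ℝ) ≤ D) (R : Finset V) (j : ℕ) :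
    ((bfsBall G R j).card : ℝ) ≤ 2 * R.card * D ^ j := by
  induction j with
  | zero =>
    have : (0 : ℝ) ≤ R.card := Nat.cast_nonneg _
    simp only [bfsBall, pow_zero, mul_one]
    linarith
  | succ j ih =>
    have h1 : ((bfsBall G R (j + 1)).card : ℝ)
        ≤ (bfsBall G R j).card + (bfsLayer G R R (j + 1)).card := by
      rw [bfsBall_succ_eq]
      exact_mod_cast Finset.card_union_le _ _
    have h2 := card_bfsLayer_le (by linarith) hD R R (j + 1)
    have h3 : (0 : ℝ) ≤ R.card * D ^ j := by positivity
    have h4 : (R.card : ℝ) * D ^ (j + 1) = R.card * D ^ j * D := by ring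
    nlinarith

/-- Expansion from a set `R` of vertices, given a lower bound on the sizes of neighbourhoods
and an upper bound on the degrees. -/
lemma card_bfsLayer_self_ge {G : SimpleGraph V} {D s t : ℝ} (hD2 : 2 ≤ D)
    (hD : ∀ v, ((nbrs G {v}).card : ℝ) ≤ D) (hs : 0 ≤ s) (R : Finset V) (j : ℕ)
    (hexp : ∀ k < j, t * (bfsLayer G R R k).card
      ≤ (bfsLayer G (bfsLayer G R R k) (bfsLayer G R R k) 1).card)
    (hst : ∀ k < j, 2 * D ^ k ≤ (t - s) * s ^ k) (hst0 : s ≤ t) :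
    R.card * s ^ j ≤ (bfsLayer G R R j).card := by
  induction j with
  | zero => simp [bfsLayer]
  | succ j ih =>
    have ih' := ih (fun k hk => hexp k (by omega)) (fun k hk => hst k (by omega))
    have h1 := hexp j (by omega)
    have h2 := hst j (by omega)
    have h3 := card_bfsBall_le hD2 hD R j
    have h4 : ((bfsLayer G (bfsLayer G R R j) (bfsLayer G R R j) 1).card : ℝ)
        ≤ (bfsLayer G R R (j + 1)).card + (bfsBall G R j).card := by
      rw [← Nat.cast_add, Nat.cast_le]
      refine le_trans ?_ (Finset.card_union_le _ _)
      refine Finset.card_le_card fun x hx => ?_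
      rw [bfsLayer, Finset.mem_sdiff] at hx
      by_cases h : x ∈ bfsBall G R j
      · exact Finset.mem_union_right _ h
      · exact Finset.mem_union_left _ (Finset.mem_sdiff.2 ⟨hx.1, h⟩)
    have h5 : (0 : ℝ) ≤ R.card := Nat.cast_nonneg _
    have h6 : t * (R.card * s ^ j) ≤ t * (bfsLayer G R R j).card :=
      mul_le_mul_of_nonneg_left ih' (hs.trans hst0)
    have h7 : R.card * (2 * D ^ j) ≤ R.card * ((t - s) * s ^ j) :=
      mul_le_mul_of_nonneg_left h2 h5
    rw [pow_succ]
    nlinarith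

end Layers

/-! ### Metric dimension -/

section MetricDim

open scoped Classical

lemma metricDim_le_card {V : Type*} {G : SimpleGraph V} {R : Finset V}
    (h : Resolves G (R : Set V)) :
    metricDim G ≤ R.card :=
  Nat.sInf_le ⟨R, R.finite_toSet, Set.ncard_coe_finset R, h⟩

variable {V : Type*} [Fintype V]

lemma resolves_univ_of_distinguishers {G : SimpleGraph V}
    (h : ∀ v w, v ≠ w → (distinguishers G v w).Nonempty) :
    Resolves G ((Finset.univ : Finset V) : Set V) := by
  intro v w hvw
  obtain ⟨u, hu⟩ := h v w hvw
  exact ⟨u, by simp, (Finset.mem_filter.1 hu).2⟩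

lemma lt_metricDim {G : SimpleGraph V} {r : ℕ} (hr : r ≤ Fintype.card V)
    (hG : Resolves G ((Finset.univ : Finset V) : Set V))
    (h : ∀ R : Finset V, R.card = r → ¬ Resolves G (R : Set V)) : r < metricDim G := by
  by_contra! hle
  have hne : {k : ℕ | ∃ R : Set V, R.Finite ∧ R.ncard = k ∧ Resolves G R}.Nonempty :=
    ⟨_, _, Finset.finite_toSet _, rfl, hG⟩
  obtain ⟨R, hfin, hcard, hres⟩ := Nat.sInf_mem hne
  lift R to Finset V using hfin
  rw [Set.ncard_coe_finset] at hcard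
  have hcard' : R.card ≤ r := hcard.trans_le hle
  obtain ⟨R', hRR', -, hR'⟩ := Finset.exists_subsuperset_card_eq (Finset.subset_univ R) hcard'
    (by rwa [Finset.card_univ])
  refine h R' hR' fun v w hvw => ?_
  obtain ⟨u, hu, hne⟩ := hres hvw
  exact ⟨u, Finset.mem_coe.2 (hRR' (Finset.mem_coe.1 hu)), hne⟩

/-- If all pairs have at least `m` distinguishers, a random sequence of `k` vertices resolves
the graph with positive probability as soon as `n² exp (-mk/n) < 1`. -/
lemma metricDim_le_of_distinguishers {n : ℕ} {G : SimpleGraph (Fin n)} {m : ℝ} {k : ℕ}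
    (hn : 0 < n) (h : ∀ v w, v ≠ w → m ≤ (distinguishers G v w).card)
    (hk : (n : ℝ) ^ 2 * Real.exp (-(m / n * k)) < 1) : metricDim G ≤ k := by
  have hn' : (0 : ℝ) < n := Nat.cast_pos.2 hn
  let bad : Fin n × Fin n → Finset (Fin k → Fin n) := fun x =>
    Fintype.piFinset fun _ => (distinguishers G x.1 x.2)ᶜ
  have hbad : ∀ x : Fin n × Fin n, x.1 ≠ x.2 →
      ((bad x).card : ℝ) ≤ (n : ℝ) ^ k * Real.exp (-(m / n * k)) := by
    intro x hx
    have h1 : ((bad x).card : ℝ) = ((distinguishers G x.1 x.2)ᶜ.card : ℝ) ^ k := by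
      simp [bad, Fintype.card_piFinset]
    have h2 : ((distinguishers G x.1 x.2)ᶜ.card : ℝ) ≤ n * Real.exp (-(m / n)) := by
      have h3 : ((distinguishers G x.1 x.2)ᶜ.card : ℝ) = n - (distinguishers G x.1 x.2).card := by
        rw [Finset.card_compl, Fintype.card_fin, Nat.cast_sub]
        simpa using Finset.card_le_univ (distinguishers G x.1 x.2)
      have h4 := Real.add_one_le_exp (-(m / n))
      have h5 := mul_le_mul_of_nonneg_left h4 hn'.le
      have h6 : (n : ℝ) * (-(m / n) + 1) = n - m := by field_simp; ring
      have h7 := h x.1 x.2 hx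
      linarith
    rw [h1]
    calc ((distinguishers G x.1 x.2)ᶜ.card : ℝ) ^ k ≤ (n * Real.exp (-(m / n))) ^ k :=
          pow_le_pow_left₀ (Nat.cast_nonneg _) h2 k
      _ = (n : ℝ) ^ k * Real.exp (-(m / n * k)) := by
          rw [mul_pow, ← Real.exp_nat_mul]
          ring_nf
  have hunion : ((Finset.univ.filter fun x : Fin n × Fin n => x.1 ≠ x.2).biUnion bad).card
      < Fintype.card (Fin k → Fin n) := by
    have h1 : ((((Finset.univ.filter fun x : Fin n × Fin n => x.1 ≠ x.2).biUnion bad).card : ℕ)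
        : ℝ) ≤ (n : ℝ) ^ 2 * ((n : ℝ) ^ k * Real.exp (-(m / n * k))) := by
      calc _ ≤ ((∑ x ∈ Finset.univ.filter fun x : Fin n × Fin n => x.1 ≠ x.2,
              (bad x).card : ℕ) : ℝ) := by exact_mod_cast Finset.card_biUnion_le
        _ ≤ ∑ x ∈ Finset.univ.filter fun x : Fin n × Fin n => x.1 ≠ x.2,
              (n : ℝ) ^ k * Real.exp (-(m / n * k)) := by
            push_cast
            exact Finset.sum_le_sum fun x hx => hbad x (Finset.mem_filter.1 hx).2
        _ ≤ ∑ x : Fin n × Fin n, (n : ℝ) ^ k * Real.exp (-(m / n * k)) :=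
            Finset.sum_le_sum_of_subset_of_nonneg (Finset.filter_subset _ _)
              fun _ _ _ => by positivity
        _ = _ := by
            rw [Finset.sum_const, Finset.card_univ, Fintype.card_prod, Fintype.card_fin,
              nsmul_eq_mul]
            push_cast
            ring
    have h2 : (n : ℝ) ^ 2 * ((n : ℝ) ^ k * Real.exp (-(m / n * k))) < (n : ℝ) ^ k := by
      have h3 : (0 : ℝ) < (n : ℝ) ^ k := by positivity
      nlinarith
    have h4 : (Fintype.card (Fin k → Fin n) : ℝ) = (n : ℝ) ^ k := by simp
    have h5 := h1.trans_lt h2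
    rw [← h4] at h5
    exact_mod_cast h5
  obtain ⟨f, hf⟩ : ∃ f : Fin k → Fin n,
      f ∉ (Finset.univ.filter fun x : Fin n × Fin n => x.1 ≠ x.2).biUnion bad := by
    by_contra! hall
    refine hunion.ne ?_
    rw [Finset.eq_univ_of_forall hall, Finset.card_univ]
  have hres : Resolves G ((Finset.univ.image f : Finset (Fin n)) : Set (Fin n)) := by
    intro v w hvw
    by_contra! hcon
    refine hf (Finset.mem_biUnion.2 ⟨(v, w), by simpa using hvw, ?_⟩)
    refine Fintype.mem_piFinset.2 fun a => ?_
    rw [Finset.mem_compl, distinguishers, Finset.mem_filter]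
    rintro ⟨-, hne⟩
    exact hne (hcon (f a) (by simp))
  refine (metricDim_le_card hres).trans (Finset.card_image_le.trans ?_)
  simp

end MetricDim

/-! ### Concentration for counts of independent events -/

section Concentration

open scoped Classical

lemma gnpExp_add_mul {n : ℕ} (p a b : ℝ) (F : SimpleGraph (Fin n) → ℝ) :
    gnpExp n p (fun G => a + b * F G) = a + b * gnpExp n p F := by
  rw [← gnpExp_const n p a]
  simp only [gnpExp, Finset.mul_sum, ← Finset.sum_add_distrib]
  refine Finset.sum_congr rfl fun G _ => ?_
  rw [← gnpExp, gnpExp_const]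
  ring

lemma gnpProb_le_gnpExp {n : ℕ} {p : ℝ} (hp : 0 ≤ p) (hp1 : p ≤ 1)
    {A : Set (SimpleGraph (Fin n))} {F : SimpleGraph (Fin n) → ℝ} (hF : ∀ G, 0 ≤ F G)
    (hA : ∀ G ∈ A, 1 ≤ F G) : gnpProb n p A ≤ gnpExp n p F := by
  rw [gnpProb_eq_gnpExp]
  refine gnpExp_mono hp hp1 fun G => ?_
  by_cases h : G ∈ A
  · simpa [h] using hA G h
  · simpa [h] using hF G

/-- The moment generating function of the number of events that hold, for independent events. -/
lemma gnpExp_exp_card_le {n : ℕ} {p : ℝ} {ι : Type*} (U : Finset ι)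
    (S : ι → Set (Sym2 (Fin n))) (Q : ι → Set (SimpleGraph (Fin n)))
    (hS : ∀ j ∈ U, ∀ k ∈ U, j ≠ k → Disjoint (S j) (S k))
    (hQ : ∀ j ∈ U, EdgeLocal (S j) (fun G => G ∈ Q j)) (hp : 0 ≤ p) (hp1 : p ≤ 1) (t : ℝ) :
    gnpExp n p (fun G => Real.exp (t * (U.filter fun j => G ∈ Q j).card))
      ≤ Real.exp ((Real.exp t - 1) * ∑ j ∈ U, gnpProb n p (Q j)) := by
  have h1 : (fun G : SimpleGraph (Fin n) => Real.exp (t * (U.filter fun j => G ∈ Q j).card))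
      = fun G => ∏ j ∈ U, (1 + (Real.exp t - 1) * (Q j).indicator 1 G) := by
    funext G
    rw [Finset.card_filter, Nat.cast_sum, Finset.mul_sum, Real.exp_sum]
    refine Finset.prod_congr rfl fun j _ => ?_
    by_cases h : G ∈ Q j <;> simp [h]
  rw [h1, EdgeLocal.gnpExp_prod p U S (fun j G => 1 + (Real.exp t - 1) * (Q j).indicator 1 G) hS,
    Finset.mul_sum, Real.exp_sum]
  · refine Finset.prod_le_prod (fun j _ => ?_) fun j _ => ?_
    · refine le_trans (gnpExp_const n p 0).ge (gnpExp_mono hp hp1 fun G => ?_)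
      by_cases h : G ∈ Q j
      · simpa [h] using (Real.exp_pos t).le
      · simp [h]
    · rw [gnpExp_add_mul, ← gnpProb_eq_gnpExp, add_comm]
      exact Real.add_one_le_exp _
  · intro j hj G H hGH
    have := hQ j hj hGH
    simp only [eq_iff_iff] at this
    simp only [Set.indicator_apply, this, Pi.one_apply]

/-- Lower tail for the number of events that hold, for independent events. -/
lemma gnpProb_card_filter_le {n : ℕ} {p : ℝ} (hp : 0 ≤ p) (hp1 : p ≤ 1) {ι : Type*} (U : Finset ι)
    (S : ι → Set (Sym2 (Fin n))) (Q : ι → Set (SimpleGraph (Fin n)))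
    (hS : ∀ j ∈ U, ∀ k ∈ U, j ≠ k → Disjoint (S j) (S k))
    (hQ : ∀ j ∈ U, EdgeLocal (S j) (fun G => G ∈ Q j)) {ρ θ : ℝ}
    (hρ : ∀ j ∈ U, ρ ≤ gnpProb n p (Q j)) (hρ0 : 0 ≤ ρ) (hθ : 0 ≤ θ) (hθ1 : θ ≤ 1) :
    gnpProb n p {G | ((U.filter fun j => G ∈ Q j).card : ℝ) ≤ (1 - θ) * (ρ * U.card)}
      ≤ Real.exp (-(θ ^ 2 * (ρ * U.card) / 4)) := by
  set μ := ρ * U.card with hμ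
  have hμ0 : 0 ≤ μ := by positivity
  have hsum : μ ≤ ∑ j ∈ U, gnpProb n p (Q j) := by
    rw [hμ, mul_comm, ← nsmul_eq_mul]
    exact Finset.card_nsmul_le_sum _ _ _ hρ
  have hmgf := gnpExp_exp_card_le U S Q hS hQ hp hp1 (-(θ / 2))
  have hmarkov := gnpProb_le_gnpExp (n := n) hp hp1
    (A := {G | ((U.filter fun j => G ∈ Q j).card : ℝ) ≤ (1 - θ) * μ})
    (F := fun G => 0 + Real.exp (θ / 2 * ((1 - θ) * μ)) *
      Real.exp (-(θ / 2) * (U.filter fun j => G ∈ Q j).card))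
    (fun G => by positivity) (fun G hG => by
      simp only [zero_add]
      rw [← Real.exp_add]
      apply Real.one_le_exp
      have h2 : ((U.filter fun j => G ∈ Q j).card : ℝ) ≤ (1 - θ) * μ := hG
      nlinarith)
  rw [gnpExp_add_mul, zero_add] at hmarkov
  refine hmarkov.trans ((mul_le_mul_of_nonneg_left hmgf (Real.exp_pos _).le).trans ?_)
  rw [← Real.exp_add]
  apply Real.exp_le_exp.2
  have he := (abs_le.1 (Real.abs_exp_sub_one_sub_id_le (x := -(θ / 2))
    (by rw [abs_neg, abs_of_nonneg] <;> linarith))).2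
  have h3 : (Real.exp (-(θ / 2)) - 1) ≤ -(θ / 2) + (θ / 2) ^ 2 := by nlinarith
  have h4 : -(θ / 2) + (θ / 2) ^ 2 ≤ 0 := by nlinarith
  have h0 : Real.exp (-(θ / 2)) - 1 ≤ 0 := h3.trans h4
  nlinarith

/-- Upper tail for the number of events that hold, for independent events. -/
lemma gnpProb_le_card_filter {n : ℕ} {p : ℝ} (hp : 0 ≤ p) (hp1 : p ≤ 1) {ι : Type*} (U : Finset ι)
    (S : ι → Set (Sym2 (Fin n))) (Q : ι → Set (SimpleGraph (Fin n)))
    (hS : ∀ j ∈ U, ∀ k ∈ U, j ≠ k → Disjoint (S j) (S k))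
    (hQ : ∀ j ∈ U, EdgeLocal (S j) (fun G => G ∈ Q j)) {θ μ : ℝ}
    (hμ : ∑ j ∈ U, gnpProb n p (Q j) ≤ μ) (hμ0 : 0 ≤ μ) (hθ : 0 ≤ θ) (hθ1 : θ ≤ 1) :
    gnpProb n p {G | (1 + θ) * μ ≤ (U.filter fun j => G ∈ Q j).card}
      ≤ Real.exp (-(θ ^ 2 * μ / 4)) := by
  have hmgf := gnpExp_exp_card_le U S Q hS hQ hp hp1 (θ / 2)
  have hmarkov := gnpProb_le_gnpExp (n := n) hp hp1
    (A := {G | (1 + θ) * μ ≤ ((U.filter fun j => G ∈ Q j).card : ℝ)})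
    (F := fun G => 0 + Real.exp (-(θ / 2 * ((1 + θ) * μ))) *
      Real.exp (θ / 2 * (U.filter fun j => G ∈ Q j).card))
    (fun G => by positivity) (fun G hG => by
      simp only [zero_add]
      rw [← Real.exp_add]
      apply Real.one_le_exp
      have h2 : (1 + θ) * μ ≤ ((U.filter fun j => G ∈ Q j).card : ℝ) := hG
      nlinarith)
  rw [gnpExp_add_mul, zero_add] at hmarkov
  refine hmarkov.trans ((mul_le_mul_of_nonneg_left hmgf (Real.exp_pos _).le).trans ?_)
  rw [← Real.exp_add]
  apply Real.exp_le_exp.2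
  have he := (abs_le.1 (Real.abs_exp_sub_one_sub_id_le (x := θ / 2)
    (by rw [abs_of_nonneg] <;> linarith))).2
  have h3 : (Real.exp (θ / 2) - 1) ≤ θ / 2 + (θ / 2) ^ 2 := by nlinarith
  have h0 : 0 ≤ Real.exp (θ / 2) - 1 := by
    have := Real.add_one_le_exp (θ / 2); linarith
  nlinarith

end Concentration

/-! ### Exposing the next layer -/

section Exposure

open scoped Classical

lemma gnpProb_exists_neighbor {n : ℕ} (p : ℝ) (v : Fin n) (L : Finset (Fin n)) (hv : v ∉ L) :
    gnpProb n p {G | ∃ x ∈ L, G.Adj x v} = 1 - (1 - p) ^ L.card := by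
  rw [← gnpProb_no_neighbor p v L hv, ← gnpProb_compl]
  congr 1
  ext G
  simp [SimpleGraph.adj_comm]

/-- `F` only depends on which elements of `L` are adjacent to `x`. -/
def NbrLocal {V : Type*} {β : Sort*} (L : Finset V) (x : V) (F : SimpleGraph V → β) : Prop :=
  ∀ ⦃G H : SimpleGraph V⦄, (∀ a ∈ L, G.Adj a x ↔ H.Adj a x) → F G = F H

lemma NbrLocal.edgeLocal {V : Type*} {β : Sort*} {L : Finset V} {x : V} {F : SimpleGraph V → β}
    (h : NbrLocal L x F) : EdgeLocal (crossPairs L {x}) F := by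
  intro G H hGH
  refine h fun a ha => ?_
  have := hGH s(a, x) ⟨a, ha, x, Finset.mem_singleton_self x, rfl⟩
  simpa using this

lemma disjoint_crossPairs_singleton {V : Type*} {L : Finset V} {x y : V} (hx : x ∉ L)
    (hxy : x ≠ y) : Disjoint (crossPairs L {x}) (crossPairs L {y}) := by
  rw [Set.disjoint_left]
  rintro e ⟨a, ha, x', hx', rfl⟩ ⟨b, hb, y', hy', h⟩
  obtain rfl := Finset.mem_singleton.1 hx'
  obtain rfl := Finset.mem_singleton.1 hy'
  rcases Sym2.eq_iff.1 h with ⟨-, h2⟩ | ⟨-, h2⟩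
  · exact hxy h2
  · exact hx (h2 ▸ hb)

/-- Conditionally on the layers up to level `j`, the events `W G x` for the vertices `x` outside
the `j`-ball are independent if they only depend on the pairs between `x` and the `j`-th layer. -/
lemma gnpProb_exposure_le {n : ℕ} {p : ℝ} (hp : 0 ≤ p) (hp1 : p ≤ 1) (R : Finset (Fin n)) (j : ℕ)
    (C : Set (SimpleGraph (Fin n)))
    (hC : ∀ G H, mixGraph (freshPairs G R j) G H ∈ C → G ∈ C)
    (W : SimpleGraph (Fin n) → Fin n → Set (SimpleGraph (Fin n)))
    (hW : ∀ G H, W (mixGraph (freshPairs G R j) G H) = W G)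
    (hloc : ∀ G x, NbrLocal (bfsLayer G R R j) x (fun H => H ∈ W G x))
    {M θ : ℝ} (ρ : SimpleGraph (Fin n) → ℝ) (hρ0 : ∀ G ∈ C, 0 ≤ ρ G)
    (hρ : ∀ G ∈ C, ∀ x ∈ (bfsBall G R j)ᶜ, ρ G ≤ gnpProb n p (W G x))
    (hM : ∀ G ∈ C, M ≤ ρ G * (bfsBall G R j)ᶜ.card) (hθ : 0 ≤ θ) (hθ1 : θ ≤ 1) :
    gnpProb n p {G | G ∈ C ∧
        ((((bfsBall G R j)ᶜ.filter fun x => G ∈ W G x).card : ℕ) : ℝ) ≤ (1 - θ) * M}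
      ≤ Real.exp (-(θ ^ 2 * M / 4)) := by
  refine gnpProb_le_of_resample hp hp1 (fun G => freshPairs G R j)
    (fun G H => freshPairs_mixGraph G H R j) _ fun G => ?_
  by_cases hG : G ∈ C
  swap
  · refine le_trans (gnpProb_mono hp hp1 (B := ∅) ?_) ?_
    · intro H hH
      exact hG (hC G H hH.1)
    · rw [gnpProb_empty]
      exact (Real.exp_pos _).le
  have hmem : ∀ H x, x ∉ bfsBall G R j →
      (mixGraph (freshPairs G R j) G H ∈ W G x ↔ H ∈ W G x) := by
    intro H x hx
    exact (hloc G x fun a ha => mixGraph_freshPairs_adj ha hx).to_iff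
  have htail := gnpProb_card_filter_le hp hp1 (bfsBall G R j)ᶜ
    (fun x => crossPairs (bfsLayer G R R j) {x}) (W G)
    (fun x hx y _ hxy => disjoint_crossPairs_singleton
      (fun h => Finset.mem_compl.1 hx (bfsLayer_subset_bfsBall G (Finset.Subset.refl R) j h)) hxy)
    (fun x _ => (hloc G x).edgeLocal) (hρ G hG) (hρ0 G hG) hθ hθ1
  refine (gnpProb_mono hp hp1 ?_).trans (htail.trans ?_)
  · rintro H ⟨-, hH⟩
    simp only [hW, bfsBall_mixGraph G H R le_rfl] at hH
    rw [Finset.filter_congr fun x hx => hmem H x (Finset.mem_compl.1 hx)] at hH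
    exact hH.trans (mul_le_mul_of_nonneg_left (hM G hG) (by linarith))
  · apply Real.exp_le_exp.2
    have := mul_le_mul_of_nonneg_left (hM G hG) (sq_nonneg θ)
    linarith

lemma mul_one_sub_le_one_sub_exp_neg {y : ℝ} (hy : 0 ≤ y) (hy1 : y ≤ 1) :
    y * (1 - y) ≤ 1 - Real.exp (-y) := by
  have he := (abs_le.1 (Real.abs_exp_sub_one_sub_id_le (x := -y)
    (by rwa [abs_neg, abs_of_nonneg hy]))).2
  nlinarith

lemma one_sub_pow_le_exp_neg {p : ℝ} (hp1 : p ≤ 1) (k : ℕ) :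
    (1 - p) ^ k ≤ Real.exp (-(p * k)) := by
  have h : 1 - p ≤ Real.exp (-p) := by have := Real.add_one_le_exp (-p); linarith
  calc (1 - p) ^ k ≤ Real.exp (-p) ^ k := pow_le_pow_left₀ (by linarith) h k
    _ = _ := by rw [← Real.exp_nat_mul]; congr 1; ring

lemma bfsLayer_mono {V : Type*} [Fintype V] (G : SimpleGraph V) (R : Finset V) {A B : Finset V}
    (h : A ⊆ B) (j : ℕ) : bfsLayer G R A j ⊆ bfsLayer G R B j := by
  intro x hx
  obtain ⟨u, hu, hx⟩ := mem_bfsLayer_iff_exists.1 hx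
  exact mem_bfsLayer_iff_exists.2 ⟨u, h hu, hx⟩

/-- A layer with at least `t` vertices is very likely to grow by a factor of about `p n`. -/
lemma gnpProb_card_bfsLayer_succ_le {n : ℕ} {p θ t : ℝ} (hp : 0 ≤ p) (hp1 : p ≤ 1)
    {R A : Finset (Fin n)} (hA : A ⊆ R) (j : ℕ) (hθ : 0 ≤ θ) (hθ1 : θ ≤ 1) (ht : 0 ≤ t)
    (hpt : p * t ≤ θ / 16) :
    gnpProb n p {G | ((bfsBall G R j).card ≤ θ / 16 * n ∧ t ≤ (bfsLayer G R A j).card) ∧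
        ((bfsLayer G R A (j + 1)).card : ℝ) ≤ (1 - θ) * (p * n * t)}
      ≤ Real.exp (-(θ ^ 2 * (p * n * t) / 32)) := by
  set C : Set (SimpleGraph (Fin n)) :=
    {G | (bfsBall G R j).card ≤ θ / 16 * n ∧ t ≤ (bfsLayer G R A j).card} with hC
  have hμ : 0 ≤ p * n * t := by positivity
  have h := gnpProb_exposure_le hp hp1 R j C
    (fun G H h => by
      simpa only [hC, Set.mem_ofPred_eq, bfsBall_mixGraph G H R le_rfl,
        bfsLayer_mixGraph G H hA le_rfl] using h)
    (fun G x => {H | ∃ a ∈ bfsLayer G R A j, H.Adj a x})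
    (fun G H => by simp only [bfsLayer_mixGraph G H hA le_rfl])
    (fun G x H K hHK => by
      simp only [Set.mem_ofPred_eq, eq_iff_iff]
      refine exists_congr fun a => and_congr_right fun ha => hHK a (bfsLayer_mono G R hA j ha))
    (M := (1 - θ / 8) * (p * n * t)) (θ := θ / 2) (fun _ => p * t * (1 - p * t))
    (fun G _ => mul_nonneg (by positivity) (by linarith))
    (fun G hG x hx => by
      rw [gnpProb_exists_neighbor p x _
        (fun h => Finset.mem_compl.1 hx (bfsLayer_subset_bfsBall G hA j h))]
      refine (mul_one_sub_le_one_sub_exp_neg (by positivity) (by linarith)).trans ?_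
      have h1 := one_sub_pow_le_exp_neg hp1 (bfsLayer G R A j).card
      have h2 : Real.exp (-(p * (bfsLayer G R A j).card)) ≤ Real.exp (-(p * t)) := by
        apply Real.exp_le_exp.2
        have := mul_le_mul_of_nonneg_left hG.2 hp
        linarith
      linarith)
    (fun G hG => by
      have h1 : ((bfsBall G R j)ᶜ.card : ℝ) = n - (bfsBall G R j).card := by
        rw [Finset.card_compl, Nat.cast_sub (Finset.card_le_univ _), Fintype.card_fin]
      have h2 : (1 - θ / 16) * n ≤ ((bfsBall G R j)ᶜ.card : ℝ) := by
        rw [h1]; have := hG.1; linarith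
      have h3 : (1 - θ / 16) * ((1 - θ / 16) * n) ≤ (1 - p * t) * (bfsBall G R j)ᶜ.card :=
        mul_le_mul (by linarith) h2 (mul_nonneg (by linarith) (by positivity)) (by linarith)
      have h4 : (1 - θ / 8) * n ≤ (1 - p * t) * (bfsBall G R j)ᶜ.card := by
        refine le_trans ?_ h3
        have : (0 : ℝ) ≤ n := by positivity
        nlinarith [mul_nonneg this (sq_nonneg θ)]
      calc _ = (p * t) * ((1 - θ / 8) * n) := by ring
        _ ≤ (p * t) * ((1 - p * t) * (bfsBall G R j)ᶜ.card) :=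
          mul_le_mul_of_nonneg_left h4 (by positivity)
        _ = _ := by ring)
    (by linarith) (by linarith)
  refine (gnpProb_mono hp hp1 ?_).trans (h.trans ?_)
  · rintro G ⟨hG1, hG2⟩
    refine ⟨hG1, ?_⟩
    refine le_trans (le_of_eq (congrArg Nat.cast (congrArg Finset.card ?_))) (hG2.trans ?_)
    · ext x
      simp [bfsLayer, mem_nbrs, and_comm]
    rw [← mul_assoc (1 - θ / 2)]
    refine mul_le_mul_of_nonneg_right ?_ hμ
    nlinarith
  · apply Real.exp_le_exp.2
    have : θ ^ 2 * (p * n * t) * (1 / 2) ≤ θ ^ 2 * (p * n * t) * (1 - θ / 8) :=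
      mul_le_mul_of_nonneg_left (by linarith) (by positivity)
    nlinarith

/-- The degrees are at most `(1 + θ) p (n - 1)` with high probability. -/
lemma gnpProb_exists_degree_ge {n : ℕ} {p θ : ℝ} (hn : 0 < n) (hp : 0 ≤ p) (hp1 : p ≤ 1)
    (hθ : 0 ≤ θ) (hθ1 : θ ≤ 1) :
    gnpProb n p {G | ∃ v, (1 + θ) * (p * (n - 1)) ≤ ((nbrs G {v}).card : ℝ)}
      ≤ n * Real.exp (-(θ ^ 2 * (p * (n - 1)) / 4)) := by
  have hn1 : (1 : ℝ) ≤ n := by exact_mod_cast hn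
  have h1 : ∀ v : Fin n, gnpProb n p {G | (1 + θ) * (p * (n - 1)) ≤ ((nbrs G {v}).card : ℝ)}
      ≤ Real.exp (-(θ ^ 2 * (p * (n - 1)) / 4)) := by
    intro v
    have h := gnpProb_le_card_filter hp hp1 ({v}ᶜ : Finset (Fin n))
      (fun x => crossPairs {v} {x}) (fun x => {G | G.Adj v x})
      (fun x hx y _ hxy => disjoint_crossPairs_singleton (by simpa using hx) hxy)
      (fun x _ => NbrLocal.edgeLocal fun G H hGH => by simpa using hGH v (by simp))
      (θ := θ) (μ := p * (n - 1))
      (by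
        rw [Finset.sum_congr rfl fun x hx => gnpProb_adj p (a := v) (b := x)
          (fun h => by simp [h] at hx), Finset.sum_const, Finset.card_compl, Fintype.card_fin,
          Finset.card_singleton, nsmul_eq_mul, Nat.cast_sub hn]
        simp [mul_comm]) (mul_nonneg hp (by linarith)) hθ hθ1
    refine (gnpProb_mono hp hp1 ?_).trans h
    intro G hG
    have : nbrs G {v} = ({v}ᶜ : Finset (Fin n)).filter fun x => G ∈ {G | G.Adj v x} := by
      ext x
      simp only [mem_nbrs, Finset.mem_singleton, Finset.mem_filter, Finset.mem_compl,
        Set.mem_ofPred_eq, exists_eq_left]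
      exact ⟨fun h => ⟨h.ne', h⟩, fun h => h.2⟩
    rwa [Set.mem_ofPred_eq, this] at hG
  have h2 := gnpProb_biUnion_le hp hp1 (Finset.univ : Finset (Fin n))
    (fun v => {G | (1 + θ) * (p * (n - 1)) ≤ ((nbrs G {v}).card : ℝ)})
  simp only [Finset.mem_univ, true_and] at h2
  refine h2.trans ((Finset.sum_le_card_nsmul _ _ _ fun v _ => h1 v).trans ?_)
  simp

end Exposure

/-! ### The exceptional events -/

section Events

open scoped Classical

/-- With high probability all sets of at most `m` vertices expand. -/
lemma gnpProb_exists_not_expanding_le {n : ℕ} {p θ m : ℝ} (hp : 0 ≤ p) (hp1 : p ≤ 1)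
    (hθ : 0 ≤ θ) (hθ1 : θ ≤ 1) (hm : p * m ≤ θ / 16) (hm' : m ≤ θ / 16 * n)
    (hx : n * Real.exp (-(θ ^ 2 * (p * n) / 32)) ≤ 1) :
    gnpProb n p {G | ∃ A : Finset (Fin n), (A.card : ℝ) ≤ m ∧
        ((bfsLayer G A A 1).card : ℝ) < (1 - θ) * (p * n * A.card)}
      ≤ 2 * (n * Real.exp (-(θ ^ 2 * (p * n) / 32))) := by
  set x := Real.exp (-(θ ^ 2 * (p * n) / 32)) with hxdef
  have hx0 : 0 < x := Real.exp_pos _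
  have h1 : ∀ A : Finset (Fin n), gnpProb n p {G | (A.card : ℝ) ≤ m ∧
        ((bfsLayer G A A 1).card : ℝ) < (1 - θ) * (p * n * A.card)}
      ≤ if A = ∅ then 0 else x ^ A.card := by
    intro A
    split_ifs with hA
    · subst hA
      rw [← gnpProb_empty n p]
      refine gnpProb_mono hp hp1 ?_
      rintro G ⟨-, hG⟩
      simp only [Finset.card_empty, Nat.cast_zero, mul_zero] at hG
      exact absurd hG (not_lt.2 (Nat.cast_nonneg _))
    by_cases hAm : (A.card : ℝ) ≤ m
    · have h := gnpProb_card_bfsLayer_succ_le hp hp1 (Finset.Subset.refl A) 0 hθ hθ1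
        (t := A.card) (by positivity) ((mul_le_mul_of_nonneg_left hAm hp).trans hm)
      refine (gnpProb_mono hp hp1 ?_).trans (h.trans (le_of_eq ?_))
      · rintro G ⟨-, hG⟩
        exact ⟨⟨hAm.trans hm', le_rfl⟩, hG.le⟩
      · rw [hxdef, ← Real.exp_nat_mul]
        congr 1
        ring
    · rw [show {G : SimpleGraph (Fin n) | (A.card : ℝ) ≤ m ∧
        ((bfsLayer G A A 1).card : ℝ) < (1 - θ) * (p * n * A.card)} = ∅ from
          Set.eq_empty_of_forall_notMem fun G hG => hAm hG.1, gnpProb_empty]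
      positivity
  have h2 := gnpProb_biUnion_le hp hp1 (Finset.univ : Finset (Finset (Fin n)))
    (fun A => {G | (A.card : ℝ) ≤ m ∧ ((bfsLayer G A A 1).card : ℝ) < (1 - θ) * (p * n * A.card)})
  simp only [Finset.mem_univ, true_and] at h2
  refine h2.trans ((Finset.sum_le_sum fun A _ => h1 A).trans ?_)
  have h3 : ∑ A : Finset (Fin n), (if A = ∅ then 0 else x ^ A.card) = (x + 1) ^ n - 1 := by
    have h4 := Finset.sum_pow_mul_eq_add_pow x 1 (Finset.univ : Finset (Fin n))
    simp only [one_pow, mul_one, Finset.powerset_univ, Finset.card_univ, Fintype.card_fin] at h4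
    rw [← h4, ← Finset.add_sum_erase _ _ (Finset.mem_univ (∅ : Finset (Fin n))),
      ← Finset.add_sum_erase Finset.univ (fun A : Finset (Fin n) => x ^ A.card)
        (Finset.mem_univ (∅ : Finset (Fin n)))]
    simp only [if_true, Finset.card_empty, pow_zero, zero_add, add_sub_cancel_left]
    exact Finset.sum_congr rfl fun A hA => if_neg (Finset.mem_erase.1 hA).1
  rw [h3]
  have h5 : (x + 1) ^ n ≤ Real.exp (n * x) := by
    rw [Real.exp_nat_mul]
    exact pow_le_pow_left₀ (by positivity) (Real.add_one_le_exp x) n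
  have h6 := (abs_le.1 (Real.abs_exp_sub_one_sub_id_le (x := n * x)
    (by rw [abs_of_nonneg (by positivity)]; exact hx))).2
  have h7 : (n * x) ^ 2 ≤ n * x := by
    have : 0 ≤ n * x := by positivity
    nlinarith
  linarith

/-- Many vertices are outside the `(j + 1)`-ball. -/
lemma gnpProb_card_compl_bfsBall_le {n : ℕ} {p : ℝ} (hp : 0 ≤ p) (hp1 : p ≤ 1)
    (R : Finset (Fin n)) (j l : ℕ) :
    gnpProb n p {G | ((bfsBall G R j).card ≤ (n : ℝ) / 2 ∧ (bfsLayer G R R j).card ≤ l) ∧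
        ((bfsBall G R (j + 1))ᶜ.card : ℝ) ≤ (1 - p) ^ l * n / 4}
      ≤ Real.exp (-((1 - p) ^ l * n / 32)) := by
  have h := gnpProb_exposure_le hp hp1 R j
    {G | (bfsBall G R j).card ≤ (n : ℝ) / 2 ∧ (bfsLayer G R R j).card ≤ l}
    (fun G H h => by
      simpa only [Set.mem_ofPred_eq, bfsBall_mixGraph G H R le_rfl,
        bfsLayer_mixGraph G H (Finset.Subset.refl R) le_rfl] using h)
    (fun G x => {H | ∀ a ∈ bfsLayer G R R j, ¬ H.Adj x a})
    (fun G H => by simp only [bfsLayer_mixGraph G H (Finset.Subset.refl R) le_rfl])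
    (fun G x H K hHK => by
      simp only [Set.mem_ofPred_eq, eq_iff_iff]
      refine forall₂_congr fun a ha => ?_
      rw [SimpleGraph.adj_comm, hHK a ha, SimpleGraph.adj_comm])
    (M := (1 - p) ^ l * (n / 2)) (θ := 1 / 2) (fun _ => (1 - p) ^ l)
    (fun G _ => pow_nonneg (by linarith) _)
    (fun G hG x hx => by
      rw [gnpProb_no_neighbor p x _ (fun h => Finset.mem_compl.1 hx
        (bfsLayer_subset_bfsBall G (Finset.Subset.refl R) j h))]
      exact pow_le_pow_of_le_one (by linarith) (by linarith) hG.2)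
    (fun G hG => by
      refine mul_le_mul_of_nonneg_left ?_ (pow_nonneg (by linarith) _)
      rw [Finset.card_compl, Nat.cast_sub (Finset.card_le_univ _), Fintype.card_fin]
      have := hG.1
      linarith)
    (by norm_num) (by norm_num)
  refine (gnpProb_mono hp hp1 ?_).trans (h.trans (le_of_eq ?_))
  · rintro G ⟨hG1, hG2⟩
    refine ⟨hG1, ?_⟩
    refine le_trans (le_of_eq (congrArg Nat.cast (congrArg Finset.card ?_))) (hG2.trans ?_)
    · ext x
      simp only [Finset.mem_filter, Finset.mem_compl, Set.mem_ofPred_eq, bfsBall_succ_eq,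
        Finset.mem_union, bfsLayer, Finset.mem_sdiff, mem_nbrs, G.adj_comm x]
      constructor
      · rintro ⟨h1, h2⟩ (h3 | ⟨⟨a, ha, hax⟩, -⟩)
        · exact h1 h3
        · exact h2 a ha hax
      · intro h1
        exact ⟨fun h2 => h1 (Or.inl h2), fun a ha hax =>
          h1 (Or.inr ⟨⟨a, ha, hax⟩, fun h2 => h1 (Or.inl h2)⟩)⟩
    · linarith
  · congr 1
    ring

/-- Many vertices outside the `j`-ball have neighbours in all layers that are not too small. -/
lemma gnpProb_card_forall_exists_adj_le {n : ℕ} {p t m : ℝ} (hp : 0 ≤ p) (hp1 : p ≤ 1)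
    (ht : 0 ≤ t) (R : Finset (Fin n)) (j : ℕ) :
    gnpProb n p {G | m ≤ ((bfsBall G R j)ᶜ.card : ℝ) ∧
        (((bfsBall G R j)ᶜ.filter fun x => ∀ u ∈ R, t ≤ (bfsLayer G R {u} j).card →
          ∃ a ∈ bfsLayer G R {u} j, G.Adj a x).card : ℝ)
          ≤ (1 - Real.exp (-(p * t))) ^ R.card * m / 2}
      ≤ Real.exp (-((1 - Real.exp (-(p * t))) ^ R.card * m / 16)) := by
  have he : 0 ≤ 1 - Real.exp (-(p * t)) := by
    rw [sub_nonneg, Real.exp_le_one_iff]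
    have := mul_nonneg hp ht
    linarith
  have he1 : 1 - Real.exp (-(p * t)) ≤ 1 := by have := Real.exp_pos (-(p * t)); linarith
  have h := gnpProb_exposure_le hp hp1 R j {G | m ≤ ((bfsBall G R j)ᶜ.card : ℝ)}
    (fun G H h => by
      simpa only [Set.mem_ofPred_eq, bfsBall_mixGraph G H R le_rfl] using h)
    (fun G x => {H | ∀ u ∈ R.filter fun u => t ≤ (bfsLayer G R {u} j).card,
      H ∈ {H : SimpleGraph (Fin n) | ∃ a ∈ bfsLayer G R {u} j, H.Adj a x}})
    (fun G H => by
      funext x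
      ext K
      simp only [Set.mem_ofPred_eq, Finset.mem_filter]
      refine forall_congr' fun u => ?_
      constructor
      · rintro h ⟨hu, hut⟩
        rw [← bfsLayer_mixGraph G H (Finset.singleton_subset_iff.2 hu) le_rfl] at hut ⊢
        exact h ⟨hu, hut⟩
      · rintro h ⟨hu, hut⟩
        rw [bfsLayer_mixGraph G H (Finset.singleton_subset_iff.2 hu) le_rfl] at hut ⊢
        exact h ⟨hu, hut⟩)
    (fun G x H K hHK => by
      simp only [Set.mem_ofPred_eq, eq_iff_iff]
      refine forall₂_congr fun u hu => exists_congr fun a => and_congr_right fun ha => ?_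
      rw [Finset.mem_filter] at hu
      exact hHK a (bfsLayer_mono G R (Finset.singleton_subset_iff.2 hu.1) j ha))
    (M := (1 - Real.exp (-(p * t))) ^ R.card * m) (θ := 1 / 2)
    (fun _ => (1 - Real.exp (-(p * t))) ^ R.card)
    (fun G _ => pow_nonneg he _)
    (fun G hG x hx => by
      refine le_trans ?_ (gnpProb_forall_ge_prod hp hp1
        (R.filter fun u => t ≤ (bfsLayer G R {u} j).card)
        (fun u => {H | ∃ a ∈ bfsLayer G R {u} j, H.Adj a x}) ?_)
      · refine (pow_le_pow_of_le_one he he1 (Finset.card_le_card (Finset.filter_subset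
          (fun u => t ≤ (bfsLayer G R {u} j).card) R))).trans ?_
        rw [← Finset.prod_const]
        refine Finset.prod_le_prod (fun _ _ => he) fun u hu => ?_
        obtain ⟨hu, hut⟩ := Finset.mem_filter.1 hu
        rw [gnpProb_exists_neighbor p x _ (fun h => Finset.mem_compl.1 hx
          (bfsLayer_subset_bfsBall G (Finset.singleton_subset_iff.2 hu) j h))]
        have h1 := one_sub_pow_le_exp_neg hp1 (bfsLayer G R {u} j).card
        have h2 : Real.exp (-(p * (bfsLayer G R {u} j).card)) ≤ Real.exp (-(p * t)) := by
          apply Real.exp_le_exp.2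
          have := mul_le_mul_of_nonneg_left hut hp
          linarith
        linarith
      · rintro u - H K hHK ⟨a, ha, hax⟩
        exact ⟨a, ha, hHK hax⟩)
    (fun G hG => mul_le_mul_of_nonneg_left hG (pow_nonneg he _))
    (by norm_num) (by norm_num)
  refine (gnpProb_mono hp hp1 ?_).trans (h.trans (le_of_eq ?_))
  · rintro G ⟨hG1, hG2⟩
    refine ⟨hG1, ?_⟩
    refine le_trans (le_of_eq (congrArg Nat.cast (congrArg Finset.card ?_))) (hG2.trans ?_)
    · ext x
      simp
    · linarith
  · congr 1
    ring

lemma gnpProb_no_neighbor_inter_exists_neighbor {n : ℕ} (p : ℝ) (x : Fin n)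
    {L K : Finset (Fin n)} (hL : x ∉ L) (hK : x ∉ K) (hLK : Disjoint L K) :
    gnpProb n p {G | (∀ a ∈ L, ¬ G.Adj x a) ∧ ∃ a ∈ K, G.Adj a x}
      = (1 - p) ^ L.card * (1 - (1 - p) ^ K.card) := by
  have hdisj : Disjoint (crossPairs L {x}) (crossPairs K {x}) := by
    rw [Set.disjoint_left]
    rintro e ⟨a, ha, x', hx', rfl⟩ ⟨b, hb, y', hy', h⟩
    obtain rfl := Finset.mem_singleton.1 hx'
    obtain rfl := Finset.mem_singleton.1 hy'
    rcases Sym2.eq_iff.1 h with ⟨h1, -⟩ | ⟨h1, -⟩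
    · exact Finset.disjoint_left.1 hLK ha (h1 ▸ hb)
    · exact hL (h1 ▸ ha)
  have h1 : EdgeLocal (crossPairs L {x})
      (({G | ∀ a ∈ L, ¬ G.Adj x a} : Set (SimpleGraph (Fin n))).indicator (fun _ => (1 : ℝ))) := by
    refine NbrLocal.edgeLocal fun G H hGH => ?_
    have : G ∈ ({G | ∀ a ∈ L, ¬ G.Adj x a} : Set (SimpleGraph (Fin n))) ↔
        H ∈ ({G | ∀ a ∈ L, ¬ G.Adj x a} : Set (SimpleGraph (Fin n))) := by
      refine forall₂_congr fun a ha => ?_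
      rw [SimpleGraph.adj_comm, hGH a ha, SimpleGraph.adj_comm]
    simp only [Set.indicator_apply, this]
  have h2 : EdgeLocal (crossPairs K {x})
      (({G | ∃ a ∈ K, G.Adj a x} : Set (SimpleGraph (Fin n))).indicator (fun _ => (1 : ℝ))) := by
    refine NbrLocal.edgeLocal fun G H hGH => ?_
    have : G ∈ ({G | ∃ a ∈ K, G.Adj a x} : Set (SimpleGraph (Fin n))) ↔
        H ∈ ({G | ∃ a ∈ K, G.Adj a x} : Set (SimpleGraph (Fin n))) :=
      exists_congr fun a => and_congr_right fun ha => hGH a ha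
    simp only [Set.indicator_apply, this]
  rw [← gnpProb_no_neighbor p x L hL, ← gnpProb_exists_neighbor p x K hK, gnpProb_eq_gnpExp,
    gnpProb_eq_gnpExp, gnpProb_eq_gnpExp, Pi.one_def,
    ← EdgeLocal.gnpExp_mul p hdisj h1 h2]
  congr 1
  funext G
  by_cases hG1 : ∀ a ∈ L, ¬ G.Adj x a <;> by_cases hG2 : ∃ a ∈ K, G.Adj a x <;>
    simp [Set.indicator_apply, hG1, hG2]

/-- Many vertices are reached in `j + 1` steps from `v` but not from `w`. -/
lemma gnpProb_card_bfsLayer_sdiff_le {n : ℕ} {p b : ℝ} (hp : 0 ≤ p) (hp1 : p ≤ 1) (hb : 0 ≤ b)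
    (v w : Fin n) (j l : ℕ) :
    gnpProb n p {G | ((bfsBall G {v, w} j).card ≤ (n : ℝ) / 2 ∧
          (bfsLayer G {v, w} {w} j).card ≤ l ∧
          b ≤ (bfsLayer G {v, w} {v} j \ bfsLayer G {v, w} {w} j).card) ∧
        ((bfsLayer G {v, w} {v} (j + 1) \ bfsLayer G {v, w} {w} (j + 1)).card : ℝ)
          ≤ (1 - p) ^ l * (1 - Real.exp (-(p * b))) * n / 4}
      ≤ Real.exp (-((1 - p) ^ l * (1 - Real.exp (-(p * b))) * n / 32)) := by
  have he : 0 ≤ 1 - Real.exp (-(p * b)) := by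
    rw [sub_nonneg, Real.exp_le_one_iff]
    have := mul_nonneg hp hb
    linarith
  have hp1' : 0 ≤ 1 - p := by linarith
  have hv : ({v} : Finset (Fin n)) ⊆ {v, w} := by simp
  have hw : ({w} : Finset (Fin n)) ⊆ {v, w} := by simp
  have h := gnpProb_exposure_le hp hp1 {v, w} j
    {G | (bfsBall G {v, w} j).card ≤ (n : ℝ) / 2 ∧ (bfsLayer G {v, w} {w} j).card ≤ l ∧
          b ≤ (bfsLayer G {v, w} {v} j \ bfsLayer G {v, w} {w} j).card}
    (fun G H h => by
      simpa only [Set.mem_ofPred_eq, bfsBall_mixGraph G H {v, w} le_rfl,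
        bfsLayer_mixGraph G H hv le_rfl, bfsLayer_mixGraph G H hw le_rfl] using h)
    (fun G x => {H | (∀ a ∈ bfsLayer G {v, w} {w} j, ¬ H.Adj x a) ∧
      ∃ a ∈ bfsLayer G {v, w} {v} j \ bfsLayer G {v, w} {w} j, H.Adj a x})
    (fun G H => by
      simp only [bfsLayer_mixGraph G H hv le_rfl, bfsLayer_mixGraph G H hw le_rfl])
    (fun G x H K hHK => by
      simp only [Set.mem_ofPred_eq, eq_iff_iff]
      refine and_congr (forall₂_congr fun a ha => ?_)
        (exists_congr fun a => and_congr_right fun ha => ?_)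
      · rw [SimpleGraph.adj_comm, hHK a (bfsLayer_mono G _ hw j ha), SimpleGraph.adj_comm]
      · exact hHK a (bfsLayer_mono G _ hv j (Finset.mem_sdiff.1 ha).1))
    (M := (1 - p) ^ l * (1 - Real.exp (-(p * b))) * (n / 2)) (θ := 1 / 2)
    (fun _ => (1 - p) ^ l * (1 - Real.exp (-(p * b))))
    (fun G _ => by positivity)
    (fun G hG x hx => by
      have hx' := Finset.mem_compl.1 hx
      rw [gnpProb_no_neighbor_inter_exists_neighbor p x
        (fun h => hx' (bfsLayer_subset_bfsBall G hw j h))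
        (fun h => hx' (bfsLayer_subset_bfsBall G hv j (Finset.mem_sdiff.1 h).1))
        Finset.disjoint_sdiff]
      refine mul_le_mul (pow_le_pow_of_le_one hp1' (by linarith) hG.2.1) ?_ he
        (pow_nonneg hp1' _)
      have h1 := one_sub_pow_le_exp_neg hp1
        (bfsLayer G {v, w} {v} j \ bfsLayer G {v, w} {w} j).card
      have h2 : Real.exp (-(p * (bfsLayer G {v, w} {v} j \ bfsLayer G {v, w} {w} j).card))
          ≤ Real.exp (-(p * b)) := by
        apply Real.exp_le_exp.2
        have := mul_le_mul_of_nonneg_left hG.2.2 hp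
        linarith
      linarith)
    (fun G hG => by
      refine mul_le_mul_of_nonneg_left ?_ (by positivity)
      rw [Finset.card_compl, Nat.cast_sub (Finset.card_le_univ _), Fintype.card_fin]
      have := hG.1
      linarith)
    (by norm_num) (by norm_num)
  refine (gnpProb_mono hp hp1 ?_).trans (h.trans (le_of_eq ?_))
  · rintro G ⟨hG1, hG2⟩
    refine ⟨hG1, ?_⟩
    refine le_trans (Nat.cast_le.2 (Finset.card_le_card ?_)) (hG2.trans ?_)
    · intro x
      simp only [Finset.mem_filter, Finset.mem_compl, Set.mem_ofPred_eq, bfsLayer,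
        Finset.mem_sdiff, mem_nbrs, G.adj_comm x]
      rintro ⟨hx, hx1, a, ⟨ha, -⟩, hax⟩
      refine ⟨⟨⟨a, ha, hax⟩, hx⟩, ?_⟩
      rintro ⟨⟨b, hb, hbx⟩, -⟩
      exact hx1 b hb hbx
    · linarith
  · congr 1
    ring

end Events

/-! ### Bounds on the metric dimension for fixed `n` -/

section Typical

open scoped Classical

/-- All degrees are at most `(1 + θ) d` and all sets of at most `m` vertices expand. -/
structure Typical {n : ℕ} (θ d m : ℝ) (G : SimpleGraph (Fin n)) : Prop where
  degree_le : ∀ v, ((nbrs G {v}).card : ℝ) ≤ (1 + θ) * d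
  expand : ∀ A : Finset (Fin n), (A.card : ℝ) ≤ m → (1 - θ) * d * A.card ≤ (bfsLayer G A A 1).card

lemma gnpProb_not_typical_le {n : ℕ} {p θ m : ℝ} (hn : 0 < n) (hp : 0 ≤ p) (hp1 : p ≤ 1)
    (hθ : 0 ≤ θ) (hθ1 : θ ≤ 1) (hm : p * m ≤ θ / 16) (hm' : m ≤ θ / 16 * n)
    (hx : n * Real.exp (-(θ ^ 2 * (p * (n - 1)) / 32)) ≤ 1) :
    gnpProb n p {G | ¬ Typical θ (p * (n - 1)) m G}
      ≤ 3 * (n * Real.exp (-(θ ^ 2 * (p * (n - 1)) / 32))) := by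
  have hn1 : (1 : ℝ) ≤ n := by exact_mod_cast hn
  have hd0 : 0 ≤ θ ^ 2 * (p * (n - 1)) :=
    mul_nonneg (sq_nonneg _) (mul_nonneg hp (by linarith))
  have hle : θ ^ 2 * (p * (n - 1)) ≤ θ ^ 2 * (p * n) :=
    mul_le_mul_of_nonneg_left (mul_le_mul_of_nonneg_left (by linarith) hp) (sq_nonneg _)
  have h2 : n * Real.exp (-(θ ^ 2 * (p * n) / 32))
      ≤ n * Real.exp (-(θ ^ 2 * (p * (n - 1)) / 32)) :=
    mul_le_mul_of_nonneg_left (Real.exp_le_exp.2 (by linarith)) (by positivity)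
  have h1 : n * Real.exp (-(θ ^ 2 * (p * (n - 1)) / 4))
      ≤ n * Real.exp (-(θ ^ 2 * (p * (n - 1)) / 32)) :=
    mul_le_mul_of_nonneg_left (Real.exp_le_exp.2 (by linarith)) (by positivity)
  have h3 := gnpProb_exists_degree_ge hn hp hp1 hθ hθ1
  have h4 := gnpProb_exists_not_expanding_le hp hp1 hθ hθ1 hm hm' (h2.trans hx)
  refine (gnpProb_mono hp hp1 (B := {G | ∃ v, (1 + θ) * (p * (n - 1)) ≤ ((nbrs G {v}).card : ℝ)} ∪
    {G | ∃ A : Finset (Fin n), (A.card : ℝ) ≤ m ∧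
        ((bfsLayer G A A 1).card : ℝ) < (1 - θ) * (p * n * A.card)}) ?_).trans
    ((gnpProb_union_le hp hp1 _ _).trans (by linarith))
  intro G hG
  by_contra hcon
  simp only [Set.mem_union, Set.mem_ofPred_eq, not_or, not_exists, not_le, not_and, not_lt] at hcon
  refine hG ⟨fun v => (hcon.1 v).le, fun A hA => le_trans ?_ (hcon.2 A hA)⟩
  rw [mul_assoc]
  refine mul_le_mul_of_nonneg_left ?_ (by linarith)
  exact mul_le_mul_of_nonneg_right (mul_le_mul_of_nonneg_left (by linarith) hp) (by positivity)

/-- In a typical graph the `i`-th layers around two vertices differ substantially. -/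
lemma Typical.le_card_bfsLayer_sdiff {n : ℕ} {θ d m : ℝ} {G : SimpleGraph (Fin n)}
    (hG : Typical θ d m G) {i : ℕ} (hθ : 0 ≤ θ) (hθ1 : θ ≤ 1 / 2) (hd : 2 ≤ d)
    (hm : 2 * ((1 + θ) * d) ^ (i - 1) ≤ m)
    (hst : ∀ k < i, 2 * ((1 + θ) * d) ^ k ≤ θ * d * ((1 - 2 * θ) * d) ^ k)
    (hdi : d ^ i / 2 ≤ 2 * ((1 - 2 * θ) * d) ^ i - ((1 + θ) * d) ^ i) {v w : Fin n} (hvw : v ≠ w) :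
    d ^ i / 2 ≤ (bfsLayer G {v, w} {v} i \ bfsLayer G {v, w} {w} i).card := by
  have hD : 2 ≤ (1 + θ) * d := by nlinarith
  have hs : 0 ≤ (1 - 2 * θ) * d := mul_nonneg (by linarith) (by linarith)
  have hcard : (({v, w} : Finset (Fin n)).card : ℝ) = 2 := by
    rw [Finset.card_pair hvw]; norm_num
  have h1 := card_bfsLayer_self_ge hD hG.degree_le hs {v, w} i (t := (1 - θ) * d)
    (fun k hk => by
      refine hG.expand _ ?_
      have h := card_bfsLayer_le (by linarith) hG.degree_le {v, w} {v, w} k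
      rw [hcard] at h
      refine h.trans (le_trans ?_ hm)
      exact mul_le_mul_of_nonneg_left (pow_le_pow_right₀ (by linarith) (by omega)) (by norm_num))
    (fun k hk => (hst k hk).trans (le_of_eq (by ring)))
    (mul_le_mul_of_nonneg_right (by linarith) (by linarith))
  have h2 := card_bfsLayer_le (by linarith) hG.degree_le {v, w} {w} i
  have h3 : (bfsLayer G {v, w} {v, w} i).card ≤
      (bfsLayer G {v, w} {v} i \ bfsLayer G {v, w} {w} i).card
        + (bfsLayer G {v, w} {w} i).card := by
    refine le_trans (Finset.card_le_card ?_) (Finset.card_union_le _ _)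
    intro x hx
    obtain ⟨u, hu, hx⟩ := mem_bfsLayer_iff_exists.1 hx
    rcases Finset.mem_insert.1 hu with rfl | hu
    · by_cases h : x ∈ bfsLayer G {u, w} {w} i
      · exact Finset.mem_union_right _ h
      · exact Finset.mem_union_left _ (Finset.mem_sdiff.2 ⟨hx, h⟩)
    · obtain rfl := Finset.mem_singleton.1 hu
      exact Finset.mem_union_right _ hx
  have h4 : ((bfsLayer G {v, w} {v, w} i).card : ℝ) ≤
      (bfsLayer G {v, w} {v} i \ bfsLayer G {v, w} {w} i).card
        + (bfsLayer G {v, w} {w} i).card := by exact_mod_cast h3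
  rw [hcard] at h1
  rw [Finset.card_singleton, Nat.cast_one, one_mul] at h2
  linarith

/-- With high probability all pairs are distinguished by many vertices of the `(i + 1)`-st layer. -/
lemma gnpProb_exists_card_distinguishers_le {n : ℕ} {p θ d m : ℝ} (hp : 0 ≤ p) (hp1 : p ≤ 1)
    {i : ℕ} (hθ : 0 ≤ θ) (hd : 2 ≤ d) (hD : 4 * ((1 + θ) * d) ^ i ≤ n / 2) :
    gnpProb n p {G | Typical θ d m G ∧ ∃ v w,
        d ^ i / 2 ≤ (bfsLayer G {v, w} {v} i \ bfsLayer G {v, w} {w} i).card ∧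
        ((distinguishers G v w).card : ℝ) ≤ (1 - p) ^ ⌊((1 + θ) * d) ^ i⌋₊ *
          (1 - Real.exp (-(p * (d ^ i / 2)))) * n / 4}
      ≤ n ^ 2 * Real.exp (-((1 - p) ^ ⌊((1 + θ) * d) ^ i⌋₊ *
          (1 - Real.exp (-(p * (d ^ i / 2)))) * n / 32)) := by
  have hD2 : 2 ≤ (1 + θ) * d := by nlinarith
  have hb : 0 ≤ d ^ i / 2 := by positivity
  have h1 := fun x : Fin n × Fin n => gnpProb_card_bfsLayer_sdiff_le hp hp1 hb x.1 x.2 i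
    ⌊((1 + θ) * d) ^ i⌋₊
  have h2 := gnpProb_biUnion_le hp hp1 (Finset.univ : Finset (Fin n × Fin n)) (fun x =>
    {G | ((bfsBall G {x.1, x.2} i).card ≤ (n : ℝ) / 2 ∧
          (bfsLayer G {x.1, x.2} {x.2} i).card ≤ ⌊((1 + θ) * d) ^ i⌋₊ ∧
          d ^ i / 2 ≤ (bfsLayer G {x.1, x.2} {x.1} i \ bfsLayer G {x.1, x.2} {x.2} i).card) ∧
        ((bfsLayer G {x.1, x.2} {x.1} (i + 1) \
          bfsLayer G {x.1, x.2} {x.2} (i + 1)).card : ℝ)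
          ≤ (1 - p) ^ ⌊((1 + θ) * d) ^ i⌋₊ * (1 - Real.exp (-(p * (d ^ i / 2)))) * n / 4})
  refine (gnpProb_mono hp hp1 ?_).trans (h2.trans
    ((Finset.sum_le_card_nsmul _ _ _ fun x _ => h1 x).trans (le_of_eq ?_)))
  · rintro G ⟨hG, v, w, hvw, hle⟩
    refine ⟨(v, w), Finset.mem_univ _, ⟨?_, ?_, hvw⟩, le_trans ?_ hle⟩
    · refine (card_bfsBall_le hD2 hG.degree_le {v, w} i).trans (le_trans ?_ hD)
      refine mul_le_mul_of_nonneg_right ?_ (by positivity)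
      have : (({v, w} : Finset (Fin n)).card : ℝ) ≤ 2 := by exact_mod_cast Finset.card_le_two
      linarith
    · refine Nat.le_floor ?_
      have := card_bfsLayer_le (by linarith) hG.degree_le {v, w} {w} i
      rwa [Finset.card_singleton, Nat.cast_one, one_mul] at this
    · exact Nat.cast_le.2 (Finset.card_le_card
        (bfsLayer_sdiff_subset_distinguishers G (Nat.succ_ne_zero i)))
  · rw [Finset.card_univ, Fintype.card_prod, Fintype.card_fin, nsmul_eq_mul]
    push_cast
    ring

end Typical

section LowerBound

open scoped Classical

/-- If most vertices of `R` have many neighbours outside `R`, and the layers around `R` behave as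
expected, then `R` is not a resolving set. -/
lemma Typical.not_resolves {n : ℕ} {θ d m t Y : ℝ} {G : SimpleGraph (Fin n)}
    (hG : Typical θ d m G) {R : Finset (Fin n)} {i K : ℕ}
    (hK1 : (K : ℝ) + 1 ≤ m) (hK : (K : ℝ) ≤ θ * d)
    (hRK : R.card ≤ θ * d * (K + 1)) (hY : (2 : ℝ) ^ K ≤ Y)
    (hgood : ∀ u ∈ R, (1 - 2 * θ) * d ≤ (bfsLayer G R {u} 1).card →
      t ≤ (bfsLayer G R {u} i).card)
    (hX : Y < (((bfsBall G R i)ᶜ.filter fun x => ∀ u ∈ R, t ≤ (bfsLayer G R {u} i).card →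
          ∃ a ∈ bfsLayer G R {u} i, G.Adj a x).card : ℝ)) : ¬ Resolves G (R : Set (Fin n)) := by
  set T := R.filter fun u => (1 - 2 * θ) * d ≤ (bfsLayer G R {u} 1).card with hT
  have hTR : T ⊆ R := Finset.filter_subset _ _
  have hlayer : ∀ u, bfsLayer G R {u} 1 = nbrs G {u} \ R := fun u => by
    ext x; simp [bfsLayer, bfsBall]
  have hbad : ∀ u ∈ R \ T, ((nbrs G {u} \ R).card : ℝ) < (1 - 2 * θ) * d := by
    intro u hu
    rw [Finset.mem_sdiff, hT, Finset.mem_filter, not_and, not_le] at hu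
    rw [← hlayer]
    exact hu.2 hu.1
  have hcard : (R \ T).card ≤ K := by
    by_contra! hcon
    obtain ⟨B, hB, hBK⟩ := Finset.exists_subset_card_eq (Nat.succ_le_of_lt hcon)
    have hBc : (B.card : ℝ) = K + 1 := by rw [hBK]; push_cast; ring
    have h1 := hG.expand B (by rw [hBc]; exact hK1)
    have h2 : (bfsLayer G B B 1).card ≤ R.card + ∑ u ∈ B, (nbrs G {u} \ R).card := by
      refine le_trans (Finset.card_le_card (t := R ∪ B.biUnion fun u => nbrs G {u} \ R) ?_)
        ((Finset.card_union_le _ _).trans (Nat.add_le_add_left Finset.card_biUnion_le _))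
      intro x hx
      simp only [bfsLayer, Finset.mem_sdiff, mem_nbrs] at hx
      obtain ⟨⟨a, ha, hax⟩, -⟩ := hx
      rw [Finset.mem_union]
      by_cases hxR : x ∈ R
      · exact Or.inl hxR
      · exact Or.inr (Finset.mem_biUnion.2 ⟨a, ha, Finset.mem_sdiff.2
          ⟨mem_nbrs.2 ⟨a, Finset.mem_singleton_self a, hax⟩, hxR⟩⟩)
    have h3 : ((bfsLayer G B B 1).card : ℝ) ≤ R.card + ∑ u ∈ B, ((nbrs G {u} \ R).card : ℝ) := by
      exact_mod_cast h2
    have h4 : ∑ u ∈ B, ((nbrs G {u} \ R).card : ℝ) < ∑ _u ∈ B, (1 - 2 * θ) * d :=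
      Finset.sum_lt_sum_of_nonempty (Finset.card_pos.1 (by omega)) fun u hu => hbad u (hB hu)
    rw [Finset.sum_const, nsmul_eq_mul, hBc] at h4
    rw [hBc] at h1
    nlinarith
  have hnb : ∀ u ∈ R \ T, ∃ u' ∈ T, G.Adj u u' := by
    intro u hu
    by_contra! hcon
    have h1 := hG.expand {u} (by
      rw [Finset.card_singleton, Nat.cast_one]
      exact le_trans (by linarith [(Nat.cast_nonneg K : (0 : ℝ) ≤ K)]) hK1)
    have h2 : (bfsLayer G {u} {u} 1).card ≤ ((R \ T).erase u).card + (nbrs G {u} \ R).card := by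
      refine le_trans (Finset.card_le_card ?_) (Finset.card_union_le _ _)
      intro x hx
      simp only [bfsLayer, Finset.mem_sdiff, mem_nbrs] at hx
      obtain ⟨⟨a, ha, hax⟩, hxu⟩ := hx
      obtain rfl := Finset.mem_singleton.1 ha
      rw [Finset.mem_union]
      by_cases hxR : x ∈ R
      · refine Or.inl (Finset.mem_erase.2 ⟨fun h => hax.ne h.symm, Finset.mem_sdiff.2
          ⟨hxR, fun hxT => hcon x hxT hax⟩⟩)
      · exact Or.inr (Finset.mem_sdiff.2
          ⟨mem_nbrs.2 ⟨a, Finset.mem_singleton_self a, hax⟩, hxR⟩)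
    have h3 : ((R \ T).erase u).card ≤ K :=
      (Finset.card_le_card (Finset.erase_subset _ _)).trans hcard
    have h4 : ((bfsLayer G {u} {u} 1).card : ℝ) ≤ K + (nbrs G {u} \ R).card := by
      exact_mod_cast h2.trans (Nat.add_le_add_right h3 _)
    have h5 := hbad u hu
    rw [Finset.card_singleton, Nat.cast_one, mul_one] at h1
    linarith
  refine not_resolves_of_card_lt (j := i) hTR hnb (X := (bfsBall G R i)ᶜ.filter fun x =>
    ∀ u ∈ R, t ≤ (bfsLayer G R {u} i).card → ∃ a ∈ bfsLayer G R {u} i, G.Adj a x) ?_ ?_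
  · intro x hx
    obtain ⟨hx1, hx2⟩ := Finset.mem_filter.1 hx
    refine ⟨Finset.mem_compl.1 hx1, fun u hu => ?_⟩
    obtain ⟨hu1, hu2⟩ := Finset.mem_filter.1 hu
    exact hx2 u hu1 (hgood u hu1 hu2)
  · have h1 : (2 : ℝ) ^ (R \ T).card ≤ 2 ^ K := pow_le_pow_right₀ (by norm_num) hcard
    have h2 := h1.trans_lt (hY.trans_lt hX)
    exact_mod_cast h2

/-- With high probability all layers below level `i` that start at vertices of `R` with many
neighbours outside `R` expand. -/
lemma gnpProb_exists_card_bfsLayer_succ_le {n : ℕ} {p θ s μ : ℝ} (hp : 0 ≤ p) (hp1 : p ≤ 1)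
    (R : Finset (Fin n)) (i : ℕ) (hθ : 0 ≤ θ) (hθ1 : θ ≤ 1) (hs : 1 ≤ s)
    (hps : p * s ^ (i - 1) ≤ θ / 16) (hμ : μ / 2 ≤ p * n * s) :
    gnpProb n p {G | ∃ x ∈ R ×ˢ Finset.Ico 1 i,
        ((bfsBall G R x.2).card ≤ θ / 16 * n ∧ s ^ x.2 ≤ (bfsLayer G R {x.1} x.2).card) ∧
          ((bfsLayer G R {x.1} (x.2 + 1)).card : ℝ) ≤ (1 - θ) * (p * n * s ^ x.2)}
      ≤ R.card * i * Real.exp (-(θ ^ 2 * μ / 64)) := by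
  have h := gnpProb_biUnion_le hp hp1 (R ×ˢ Finset.Ico 1 i) (fun x => {G |
    ((bfsBall G R x.2).card ≤ θ / 16 * n ∧ s ^ x.2 ≤ (bfsLayer G R {x.1} x.2).card) ∧
      ((bfsLayer G R {x.1} (x.2 + 1)).card : ℝ) ≤ (1 - θ) * (p * n * s ^ x.2)})
  refine h.trans ((Finset.sum_le_card_nsmul _ _ (Real.exp (-(θ ^ 2 * μ / 64))) ?_).trans ?_)
  · rintro ⟨u, j⟩ hx
    simp only [Finset.mem_product, Finset.mem_Ico] at hx
    refine (gnpProb_card_bfsLayer_succ_le hp hp1 (Finset.singleton_subset_iff.2 hx.1) j hθ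
      hθ1 (by positivity) ((mul_le_mul_of_nonneg_left (pow_le_pow_right₀ hs (by omega)) hp).trans
        hps)).trans (Real.exp_le_exp.2 ?_)
    have h1 : s ≤ s ^ j := le_self_pow₀ hs (by omega)
    have h2 : μ / 2 ≤ p * n * s ^ j :=
      hμ.trans (mul_le_mul_of_nonneg_left h1 (by positivity))
    have := mul_le_mul_of_nonneg_left h2 (sq_nonneg θ)
    linarith
  · rw [nsmul_eq_mul]
    refine mul_le_mul_of_nonneg_right ?_ (Real.exp_pos _).le
    rw [Finset.card_product, Nat.cast_mul]
    refine mul_le_mul_of_nonneg_left (Nat.cast_le.2 ?_) (Nat.cast_nonneg _)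
    simp

/-- A fixed set `R` is unlikely to be a resolving set of a typical graph. -/
lemma gnpProb_typical_resolves_le {n : ℕ} {p θ d m Y : ℝ} (hp : 0 ≤ p) (hp1 : p ≤ 1)
    {i r K : ℕ} (hdef : d = p * (n - 1)) (hi : 1 ≤ i) (hθ : 0 ≤ θ) (hθ1 : θ ≤ 1 / 4) (hd : 2 ≤ d)
    (hK1 : (K : ℝ) + 1 ≤ m) (hK : (K : ℝ) ≤ θ * d)
    (hRK : r ≤ θ * d * (K + 1)) (hY : (2 : ℝ) ^ K ≤ Y)
    (hball : 2 * r * ((1 + θ) * d) ^ (i - 1) ≤ θ / 16 * n)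
    (hps : p * ((1 - 2 * θ) * d) ^ (i - 1) ≤ θ / 16)
    (hYle : Y ≤ (1 - Real.exp (-(p * ((1 - 2 * θ) * d) ^ i))) ^ r *
      ((1 - p) ^ ⌊r * ((1 + θ) * d) ^ (i - 1)⌋₊ * n / 4) / 2)
    (R : Finset (Fin n)) (hR : R.card = r) :
    gnpProb n p {G | Typical θ d m G ∧ Resolves G (R : Set (Fin n))}
      ≤ r * i * Real.exp (-(θ ^ 2 * d ^ 2 / 64)) + Real.exp (-(Y / 8)) + Real.exp (-(Y / 8)) := by
  set s := (1 - 2 * θ) * d with hs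
  set D := (1 + θ) * d with hD
  set l := ⌊r * D ^ (i - 1)⌋₊ with hl
  set m1 := (1 - p) ^ l * n / 4 with hm1
  have hD2 : 2 ≤ D := by rw [hD]; nlinarith
  have hs1 : 1 ≤ s := by rw [hs]; nlinarith
  have hsd : d / 2 ≤ s := by rw [hs]; nlinarith
  have hn : (1 : ℝ) ≤ n := by
    by_contra! h
    have : p * ((n : ℝ) - 1) ≤ 0 := mul_nonpos_of_nonneg_of_nonpos hp (by linarith)
    linarith
  have hdn : d ≤ p * n := by
    rw [hdef]; exact mul_le_mul_of_nonneg_left (by linarith) hp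
  have he : 0 ≤ 1 - Real.exp (-(p * s ^ i)) := by
    rw [sub_nonneg, Real.exp_le_one_iff]
    have : 0 ≤ p * s ^ i := by positivity
    linarith
  have he1 : 1 - Real.exp (-(p * s ^ i)) ≤ 1 := by
    have := Real.exp_pos (-(p * s ^ i)); linarith
  have hm10 : 0 ≤ m1 := by
    have : 0 ≤ (1 - p) ^ l := pow_nonneg (by linarith) l
    positivity
  set E1 : Set (SimpleGraph (Fin n)) := {G | ∃ x ∈ R ×ˢ Finset.Ico 1 i,
    ((bfsBall G R x.2).card ≤ θ / 16 * n ∧ s ^ x.2 ≤ (bfsLayer G R {x.1} x.2).card) ∧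
      ((bfsLayer G R {x.1} (x.2 + 1)).card : ℝ) ≤ (1 - θ) * (p * n * s ^ x.2)} with hE1
  set E2 : Set (SimpleGraph (Fin n)) :=
    {G | ((bfsBall G R (i - 1)).card ≤ (n : ℝ) / 2 ∧ (bfsLayer G R R (i - 1)).card ≤ l) ∧
        ((bfsBall G R (i - 1 + 1))ᶜ.card : ℝ) ≤ m1} with hE2
  set E3 : Set (SimpleGraph (Fin n)) :=
    {G | m1 ≤ ((bfsBall G R i)ᶜ.card : ℝ) ∧
        (((bfsBall G R i)ᶜ.filter fun x => ∀ u ∈ R, s ^ i ≤ (bfsLayer G R {u} i).card →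
          ∃ a ∈ bfsLayer G R {u} i, G.Adj a x).card : ℝ)
          ≤ (1 - Real.exp (-(p * s ^ i))) ^ R.card * m1 / 2} with hE3
  have hp1' : gnpProb n p E1 ≤ R.card * i * Real.exp (-(θ ^ 2 * d ^ 2 / 64)) := by
    refine gnpProb_exists_card_bfsLayer_succ_le hp hp1 R i hθ (by linarith) hs1 hps ?_
    have h2 : d * (d / 2) ≤ p * n * s := mul_le_mul hdn hsd (by linarith) (by linarith)
    linarith
  rw [hR] at hp1'
  have hYm : Y ≤ m1 := by
    have : (1 - Real.exp (-(p * s ^ i))) ^ r * m1 ≤ 1 * m1 :=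
      mul_le_mul_of_nonneg_right (pow_le_one₀ he he1) hm10
    linarith
  have hp2' : gnpProb n p E2 ≤ Real.exp (-(Y / 8)) := by
    refine (gnpProb_card_compl_bfsBall_le hp hp1 R (i - 1) l).trans (Real.exp_le_exp.2 ?_)
    have : (1 - p) ^ l * n / 32 = m1 / 8 := by rw [hm1]; ring
    rw [this]
    linarith
  have hp3' : gnpProb n p E3 ≤ Real.exp (-(Y / 8)) := by
    refine (gnpProb_card_forall_exists_adj_le hp hp1 (by positivity) R i).trans
      (Real.exp_le_exp.2 ?_)
    rw [hR]
    linarith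
  refine (gnpProb_mono hp hp1 (B := E1 ∪ E2 ∪ E3) ?_).trans ((gnpProb_union_le hp hp1 _ _).trans
    (add_le_add ((gnpProb_union_le hp hp1 _ _).trans (add_le_add hp1' hp2')) hp3'))
  rintro G ⟨hG, hres⟩
  by_contra hcon
  rw [Set.mem_union, Set.mem_union, not_or, not_or] at hcon
  obtain ⟨⟨hn1, hn2⟩, hn3⟩ := hcon
  have hballj : ∀ j < i, ((bfsBall G R j).card : ℝ) ≤ θ / 16 * n := by
    intro j hj
    refine (card_bfsBall_le hD2 hG.degree_le R j).trans (le_trans ?_ hball)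
    rw [hR]
    exact mul_le_mul_of_nonneg_left (pow_le_pow_right₀ (by linarith) (by omega)) (by positivity)
  have hgood : ∀ u ∈ R, s ≤ (bfsLayer G R {u} 1).card →
      ∀ j < i, s ^ (j + 1) ≤ (bfsLayer G R {u} (j + 1)).card := by
    intro u hu hu1 j
    induction j with
    | zero => intro _; simpa using hu1
    | succ j ih =>
      intro hj
      have ih' := ih (by omega)
      by_contra! hlt
      refine hn1 ⟨(u, j + 1), ?_, ⟨hballj _ hj, ih'⟩, hlt.le.trans ?_⟩
      · simp [hu, hj]
      · have h1 : s ≤ (1 - θ) * (p * n) := by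
          have := mul_le_mul_of_nonneg_left hdn (by linarith : 0 ≤ 1 - θ)
          rw [hs]; nlinarith
        calc s ^ (j + 1 + 1) = s * s ^ (j + 1) := pow_succ' _ _
          _ ≤ (1 - θ) * (p * n) * s ^ (j + 1) := mul_le_mul_of_nonneg_right h1 (by positivity)
          _ = _ := by ring
  have hm1lt : m1 < ((bfsBall G R i)ᶜ.card : ℝ) := by
    by_contra! hle
    refine hn2 ⟨⟨(hballj (i - 1) (by omega)).trans ?_, Nat.le_floor ?_⟩, ?_⟩
    · have : θ / 16 * (n : ℝ) ≤ 1 / 2 * n :=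
        mul_le_mul_of_nonneg_right (by linarith) (by positivity)
      linarith
    · have := card_bfsLayer_le (by linarith) hG.degree_le R R (i - 1)
      rwa [hR] at this
    · rwa [Nat.sub_add_cancel hi]
  refine hG.not_resolves (i := i) (t := s ^ i) (Y := Y) hK1 hK (by rw [hR]; exact hRK) hY ?_ ?_ hres
  · intro u hu hu1
    have := hgood u hu hu1 (i - 1) (by omega)
    rwa [Nat.sub_add_cancel hi] at this
  · by_contra! hle
    refine hn3 ⟨hm1lt.le, hle.trans ?_⟩
    rw [hR]
    exact hYle

/-- With high probability no set of size `r` resolves a typical graph. -/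
lemma gnpProb_typical_exists_resolves_le {n : ℕ} {p θ d m Y : ℝ} (hp : 0 ≤ p) (hp1 : p ≤ 1)
    {i r K : ℕ} (hdef : d = p * (n - 1)) (hi : 1 ≤ i) (hθ : 0 ≤ θ) (hθ1 : θ ≤ 1 / 4) (hd : 2 ≤ d)
    (hK1 : (K : ℝ) + 1 ≤ m) (hK : (K : ℝ) ≤ θ * d)
    (hRK : r ≤ θ * d * (K + 1)) (hY : (2 : ℝ) ^ K ≤ Y)
    (hball : 2 * r * ((1 + θ) * d) ^ (i - 1) ≤ θ / 16 * n)
    (hps : p * ((1 - 2 * θ) * d) ^ (i - 1) ≤ θ / 16)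
    (hYle : Y ≤ (1 - Real.exp (-(p * ((1 - 2 * θ) * d) ^ i))) ^ r *
      ((1 - p) ^ ⌊r * ((1 + θ) * d) ^ (i - 1)⌋₊ * n / 4) / 2) :
    gnpProb n p {G | Typical θ d m G ∧
        ∃ R : Finset (Fin n), R.card = r ∧ Resolves G (R : Set (Fin n))}
      ≤ n ^ r * (r * i * Real.exp (-(θ ^ 2 * d ^ 2 / 64)) + Real.exp (-(Y / 8))
          + Real.exp (-(Y / 8))) := by
  refine (gnpProb_mono hp hp1 ?_).trans ((gnpProb_biUnion_le hp hp1
    (Finset.powersetCard r (Finset.univ : Finset (Fin n)))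
    (fun R => {G | Typical θ d m G ∧ Resolves G (R : Set (Fin n))})).trans
    ((Finset.sum_le_card_nsmul _ _ _ fun R hR => gnpProb_typical_resolves_le hp hp1 hdef hi hθ hθ1
      hd hK1 hK hRK hY hball hps hYle R (Finset.mem_powersetCard.1 hR).2).trans ?_))
  · rintro G ⟨hG, R, hR, hres⟩
    exact ⟨R, Finset.mem_powersetCard.2 ⟨Finset.subset_univ R, hR⟩, hG, hres⟩
  · rw [nsmul_eq_mul, Finset.card_powersetCard, Finset.card_univ, Fintype.card_fin]
    refine mul_le_mul_of_nonneg_right ?_ (by positivity)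
    exact_mod_cast Nat.choose_le_pow n r

end LowerBound

/-! ### The parameter regime of the theorem -/

section Regime

/-- Numerical conditions on the parameters of `G(n,p)` under which the metric dimension can be
estimated; `κ = d ^ i / n`, and `θ` is the relative error in the growth of neighbourhoods. -/
structure Regime (n i : ℕ) (p d κ θ : ℝ) : Prop where
  p_nonneg : 0 ≤ p
  p_le_one : p ≤ 1
  d_eq : d = p * (n - 1)
  pow_eq : d ^ i = κ * n
  θ_eq : θ = 8 * (√κ + 1 / Real.log n)
  one_le_i : 1 ≤ i
  log_ge : 100 ≤ Real.log n
  d_ge : Real.log n ^ 4 ≤ d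
  c_ge : 2 ≤ d * κ
  θ_le : 2 * (i + 2) * θ ≤ 1 / 6

namespace Regime

variable {n i : ℕ} {p d κ θ : ℝ}

lemma exp_log (h : Regime n i p d κ θ) : Real.exp (Real.log n) = n := by
  refine Real.exp_log ?_
  have := h.log_ge
  rcases Nat.eq_zero_or_pos n with h0 | h0
  · subst h0; norm_num at this
  · exact_mod_cast h0

lemma log_lt (h : Regime n i p d κ θ) : Real.log n + 1 ≤ n := by
  have := Real.add_one_le_exp (Real.log n)
  rwa [h.exp_log] at this

lemma n_ge (h : Regime n i p d κ θ) : (101 : ℝ) ≤ n := by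
  linarith [h.log_lt, h.log_ge]

lemma log_pow_le (h : Regime n i p d κ θ) {k : ℕ} (hk : k ≤ 4) : Real.log n ^ k ≤ d :=
  (pow_le_pow_right₀ (by linarith [h.log_ge]) hk).trans h.d_ge

lemma d_ge_hundred (h : Regime n i p d κ θ) : 100 ≤ d := by
  have := h.log_pow_le (k := 1) (by norm_num)
  rw [pow_one] at this
  linarith [h.log_ge]

lemma κ_pos (h : Regime n i p d κ θ) : 0 < κ := by
  have h1 := h.d_ge_hundred
  have h2 := h.n_ge
  have h3 := h.pow_eq
  have h4 : 0 < d ^ i := by positivity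
  by_contra! h0
  nlinarith

lemma d_le (h : Regime n i p d κ θ) : d ≤ κ * n := by
  rw [← h.pow_eq]
  exact le_self_pow₀ (by linarith [h.d_ge_hundred]) (by have := h.one_le_i; omega)

lemma p_ge (h : Regime n i p d κ θ) : d / n ≤ p := by
  have h2 := h.n_ge
  rw [div_le_iff₀ (by linarith), h.d_eq]
  nlinarith [h.p_nonneg]

lemma p_le_mul (h : Regime n i p d κ θ) : p ≤ d / n * (1 + 1 / (n - 1)) := by
  have h2 := h.n_ge
  have h3 : (n : ℝ) - 1 ≠ 0 := by linarith
  have h4 : (n : ℝ) ≠ 0 := by linarith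
  rw [h.d_eq]
  apply le_of_eq
  field_simp
  ring

lemma p_le (h : Regime n i p d κ θ) : p ≤ 2 * (d / n) := by
  have h2 := h.n_ge
  have h3 : 1 / ((n : ℝ) - 1) ≤ 1 := by
    rw [div_le_one (by linarith)]; linarith
  have h4 : 0 ≤ d / n := div_nonneg (by linarith [h.d_ge_hundred]) (by linarith)
  exact h.p_le_mul.trans (by nlinarith)

lemma d_div_le (h : Regime n i p d κ θ) : d / n ≤ κ := by
  rw [div_le_iff₀ (by linarith [h.n_ge])]; exact h.d_le

lemma p_pos (h : Regime n i p d κ θ) : 0 < p :=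
  lt_of_lt_of_le (div_pos (by linarith [h.d_ge_hundred]) (by linarith [h.n_ge])) h.p_ge

lemma θ_ge_inv (h : Regime n i p d κ θ) : 8 / Real.log n ≤ θ := by
  rw [h.θ_eq]
  have := Real.sqrt_nonneg κ
  rw [mul_add, ← mul_div_assoc, mul_one]
  linarith

lemma θ_pos (h : Regime n i p d κ θ) : 0 < θ :=
  lt_of_lt_of_le (div_pos (by norm_num) (by linarith [h.log_ge])) h.θ_ge_inv

lemma κ_le_sq (h : Regime n i p d κ θ) : 64 * κ ≤ θ ^ 2 := by
  have h1 : 8 * √κ ≤ θ := by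
    rw [h.θ_eq]
    have : 0 ≤ 1 / Real.log n := div_nonneg zero_le_one (by linarith [h.log_ge])
    linarith
  have h2 := Real.sq_sqrt h.κ_pos.le
  have h3 := Real.sqrt_nonneg κ
  nlinarith

lemma θ_le_const (h : Regime n i p d κ θ) : θ ≤ 1 / 36 := by
  have h1 := h.θ_le
  have h2 : (1 : ℝ) ≤ i := by exact_mod_cast h.one_le_i
  nlinarith [h.θ_pos]

lemma κ_le (h : Regime n i p d κ θ) : 2304 * κ ≤ θ := by
  have h1 := h.κ_le_sq
  have h2 := h.θ_le_const
  nlinarith [h.θ_pos]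

lemma p_le_θ (h : Regime n i p d κ θ) : p ≤ θ := by
  linarith [h.p_le, h.d_div_le, h.κ_le, h.κ_pos]

lemma log_pow_le_θ_mul (h : Regime n i p d κ θ) : 8 * Real.log n ^ 3 ≤ θ * d := by
  have h0 := h.log_ge
  have h1 : 8 / Real.log n * Real.log n ^ 4 ≤ θ * d :=
    mul_le_mul h.θ_ge_inv h.d_ge (by positivity) h.θ_pos.le
  refine le_trans (le_of_eq ?_) h1
  have : Real.log n ≠ 0 := by linarith
  field_simp

lemma one_add_pow_le (h : Regime n i p d κ θ) {k : ℕ} (hk : k ≤ i + 2) :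
    (1 + θ) ^ k ≤ 1 + 2 * (i + 2) * θ := by
  have h1 : (1 + θ) ^ k ≤ Real.exp (k * θ) := by
    rw [Real.exp_nat_mul]
    exact pow_le_pow_left₀ (by linarith [h.θ_pos]) (by linarith [Real.add_one_le_exp θ]) _
  have hk' : (k : ℝ) ≤ i + 2 := by exact_mod_cast hk
  have h2 : (k : ℝ) * θ ≤ (i + 2) * θ := mul_le_mul_of_nonneg_right hk' h.θ_pos.le
  have h3 : 0 ≤ (k : ℝ) * θ := mul_nonneg (by positivity) h.θ_pos.le
  have h4 := Real.abs_exp_sub_one_sub_id_le (x := k * θ) (by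
    rw [abs_of_nonneg h3]; linarith [h.θ_le])
  have h5 := (abs_le.1 h4).2
  have h6 := h.θ_le
  nlinarith

lemma one_add_pow_le_two (h : Regime n i p d κ θ) {k : ℕ} (hk : k ≤ i + 2) :
    (1 + θ) ^ k ≤ 2 := by
  linarith [h.one_add_pow_le hk, h.θ_le]

lemma one_sub_pow_ge (h : Regime n i p d κ θ) {k : ℕ} (hk : k ≤ i) :
    1 - 2 * (i + 2) * θ ≤ (1 - 2 * θ) ^ k := by
  have h1 := one_add_mul_le_pow (a := -(2 * θ)) (by linarith [h.θ_le_const]) k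
  have hk' : (k : ℝ) ≤ i := by exact_mod_cast hk
  rw [← sub_eq_add_neg] at h1
  have := h.θ_pos
  nlinarith

lemma pow_mul_le (h : Regime n i p d κ θ) {k : ℕ} (hk : k ≤ i) :
    ((1 + θ) * d) ^ k ≤ 2 * d ^ k := by
  rw [mul_pow]
  exact mul_le_mul_of_nonneg_right (h.one_add_pow_le_two (by omega))
    (pow_nonneg (by linarith [h.d_ge_hundred]) _)

lemma p_mul_pow_le (h : Regime n i p d κ θ) : p * d ^ (i - 1) ≤ 2 * κ := by
  have h0 := h.d_ge_hundred
  have hn := h.n_ge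
  have h1 : d / n * d ^ (i - 1) = κ := by
    rw [div_mul_eq_mul_div, mul_pow_sub_one (by have := h.one_le_i; omega), h.pow_eq]
    field_simp
  calc p * d ^ (i - 1) ≤ 2 * (d / n) * d ^ (i - 1) :=
        mul_le_mul_of_nonneg_right h.p_le (by positivity)
    _ = 2 * κ := by rw [mul_assoc, h1]

lemma le_p_mul_pow (h : Regime n i p d κ θ) : d * κ ≤ p * d ^ i := by
  have hn := h.n_ge
  rw [h.pow_eq]
  calc d * κ = d / n * (κ * n) := by field_simp
    _ ≤ p * (κ * n) := mul_le_mul_of_nonneg_right h.p_ge (mul_nonneg h.κ_pos.le (by linarith))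

/-- Failure probability of `Typical`. -/
lemma gnpProb_not_typical_le (h : Regime n i p d κ θ) :
    gnpProb n p {G | ¬ Typical θ d (θ / (16 * p)) G} ≤ 3 * Real.exp (-Real.log n) := by
  have hp := h.p_pos
  have hn := h.n_ge
  have hL := h.log_ge
  have hexp : n * Real.exp (-(θ ^ 2 * d / 32)) ≤ Real.exp (-Real.log n) := by
    nth_rewrite 1 [← h.exp_log]
    rw [← Real.exp_add]
    apply Real.exp_le_exp.2
    have h1 : 8 / Real.log n * (8 * Real.log n ^ 3) ≤ θ * (θ * d) :=
      mul_le_mul h.θ_ge_inv h.log_pow_le_θ_mul (by positivity) h.θ_pos.le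
    have h2 : 8 / Real.log n * (8 * Real.log n ^ 3) = 64 * Real.log n ^ 2 := by
      have : Real.log n ≠ 0 := by linarith
      field_simp
      norm_num
    nlinarith
  have h1 := _root_.gnpProb_not_typical_le (n := n) (p := p) (θ := θ) (m := θ / (16 * p))
    (by exact_mod_cast (by linarith : (0 : ℝ) < n)) h.p_nonneg h.p_le_one h.θ_pos.le
    (by linarith [h.θ_le_const]) (le_of_eq (by field_simp)) (by
      have hpn : 1 ≤ p * n := by
        have := h.p_ge
        rw [div_le_iff₀ (by linarith)] at this
        linarith [h.d_ge_hundred]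
      rw [div_le_iff₀ (by positivity)]
      nlinarith [h.θ_pos]) (by
      rw [← h.d_eq]
      exact hexp.trans (Real.exp_le_one_iff.2 (by linarith)))
  rw [← h.d_eq] at h1
  linarith

/-- In a typical graph any two vertices have many distinguishers at distance `i`. -/
lemma le_card_bfsLayer_sdiff (h : Regime n i p d κ θ) {G : SimpleGraph (Fin n)}
    (hG : Typical θ d (θ / (16 * p)) G) {v w : Fin n} (hvw : v ≠ w) :
    d ^ i / 2 ≤ (bfsLayer G {v, w} {v} i \ bfsLayer G {v, w} {w} i).card := by
  have hd := h.d_ge_hundred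
  refine hG.le_card_bfsLayer_sdiff h.θ_pos.le (by linarith [h.θ_le_const]) (by linarith) ?_ ?_ ?_
    hvw
  · rw [le_div_iff₀ (mul_pos (by norm_num) h.p_pos)]
    have h1 := mul_le_mul_of_nonneg_left (h.pow_mul_le (k := i - 1) (by omega)) h.p_nonneg
    nlinarith [h.p_mul_pow_le, h.κ_le, h.κ_pos]
  · intro k hk
    have h1 := h.pow_mul_le (k := k) (by omega)
    have h2 := h.one_sub_pow_ge (k := k) (by omega)
    have h3 : 8 ≤ θ * d := by
      have := h.log_pow_le_θ_mul
      have := one_le_pow₀ (n := 3) (by linarith [h.log_ge] : 1 ≤ Real.log n)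
      linarith
    have h4 : 0 < d ^ k := by positivity
    rw [mul_pow (1 - 2 * θ)]
    have h5 : d ^ k / 2 ≤ (1 - 2 * θ) ^ k * d ^ k := by
      have := h.θ_le
      nlinarith
    nlinarith
  · have h1 := h.one_add_pow_le (k := i) (by omega)
    have h2 := h.one_sub_pow_ge (k := i) le_rfl
    have h4 : 0 < d ^ i := by positivity
    have h3 := h.θ_le
    rw [mul_pow, mul_pow]
    nlinarith

lemma le_card_distinguishers (h : Regime n i p d κ θ) {G : SimpleGraph (Fin n)}
    (hG : Typical θ d (θ / (16 * p)) G) {v w : Fin n} (hvw : v ≠ w) :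
    d ^ i / 2 ≤ (distinguishers G v w).card := by
  refine (h.le_card_bfsLayer_sdiff hG hvw).trans ?_
  exact_mod_cast Finset.card_le_card
    (bfsLayer_sdiff_subset_distinguishers G (by have := h.one_le_i; omega))

lemma resolves_univ (h : Regime n i p d κ θ) {G : SimpleGraph (Fin n)}
    (hG : Typical θ d (θ / (16 * p)) G) :
    Resolves G ((Finset.univ : Finset (Fin n)) : Set (Fin n)) := by
  refine resolves_univ_of_distinguishers fun v w hvw => ?_
  have h1 := h.le_card_distinguishers hG hvw
  have h2 : 0 < d ^ i := pow_pos (by linarith [h.d_ge_hundred]) _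
  exact Finset.card_pos.1 (by exact_mod_cast (by linarith : (0 : ℝ) < (distinguishers G v w).card))

/-- If every pair has at least `γ n` distinguishers, then `β(G) = O(log n / γ)`. -/
lemma metricDim_le (h : Regime n i p d κ θ) {G : SimpleGraph (Fin n)} {γ : ℝ} (hγ : 0 < γ)
    (hγ1 : γ ≤ 1) (hG : ∀ v w, v ≠ w → γ * n ≤ (distinguishers G v w).card) :
    (metricDim G : ℝ) ≤ 3 / γ * Real.log n := by
  have hL := h.log_ge
  have hn := h.n_ge
  have h1 := metricDim_le_of_distinguishers (k := ⌊2 * Real.log n / γ⌋₊ + 1)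
    (by exact_mod_cast (by linarith : (0 : ℝ) < n)) hG (by
      nth_rewrite 1 [← h.exp_log]
      rw [← Real.exp_nat_mul, ← Real.exp_add, Real.exp_lt_one_iff]
      have h2 := Nat.lt_floor_add_one (2 * Real.log n / γ)
      rw [div_lt_iff₀ hγ] at h2
      have h3 : γ * n / n = γ := by field_simp
      rw [h3]
      push_cast
      linarith)
  have h2 := Nat.floor_le (a := 2 * Real.log n / γ) (by positivity)
  have h3 : (metricDim G : ℝ) ≤ (⌊2 * Real.log n / γ⌋₊ : ℝ) + 1 := by exact_mod_cast h1
  have h4 : 1 ≤ Real.log n / γ := by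
    rw [le_div_iff₀ hγ]; linarith
  have h5 : 3 / γ * Real.log n = 2 * Real.log n / γ + Real.log n / γ := by ring
  linarith

/-- The upper bound `β(G) = O(n log n / d ^ i)`. -/
lemma metricDim_le_of_typical (h : Regime n i p d κ θ) {G : SimpleGraph (Fin n)}
    (hG : Typical θ d (θ / (16 * p)) G) : (metricDim G : ℝ) ≤ 6 / κ * Real.log n := by
  have h1 := h.metricDim_le (G := G) (γ := κ / 2) (by linarith [h.κ_pos])
    (by linarith [h.κ_le, h.κ_pos, h.θ_le_const]) fun v w hvw => by
      refine le_trans (le_of_eq ?_) (h.le_card_distinguishers hG hvw)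
      rw [h.pow_eq]; ring
  refine h1.trans (le_of_eq ?_)
  have := h.κ_pos.ne'
  field_simp
  ring

end Regime

end Regime

section RegimeUpper

namespace Regime

variable {n i : ℕ} {p d κ θ : ℝ}

lemma mul_θ_le (h : Regime n i p d κ θ) (hc : d * κ ≤ 3 * Real.log n) : d * κ * θ ≤ 32 := by
  have hL := h.log_ge
  have hd := h.d_ge
  have hκ := h.κ_pos
  have h1 : d * κ * (1 / Real.log n) ≤ 3 := by
    rw [mul_one_div, div_le_iff₀ (by linarith)]
    exact hc
  have h2 : d * κ * √κ ≤ 1 := by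
    have hd0 : 0 < d := by linarith [h.d_ge_hundred]
    rw [← sq_le_one_iff₀ (by positivity), mul_pow, Real.sq_sqrt hκ.le]
    have h3 : (d * κ) ^ 2 * (d * κ) ≤ (3 * Real.log n) ^ 2 * (3 * Real.log n) :=
      mul_le_mul (pow_le_pow_left₀ (by positivity) hc 2) hc (by positivity) (by positivity)
    have h4 : (3 * Real.log n) ^ 2 * (3 * Real.log n) ≤ d := by
      refine le_trans ?_ hd
      have : 0 ≤ Real.log n ^ 3 := by positivity
      nlinarith
    have h5 : d * ((d * κ) ^ 2 * κ) ≤ d * 1 := by linarith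
    exact le_of_mul_le_mul_left h5 hd0
  rw [h.θ_eq]
  linarith

lemma one_sub_pow_floor_ge (h : Regime n i p d κ θ) (hc : d * κ ≤ 3 * Real.log n) :
    Real.exp (-(64 * (i + 2))) * Real.exp (-(d * κ)) ≤ (1 - p) ^ ⌊((1 + θ) * d) ^ i⌋₊ := by
  have hn := h.n_ge
  have hp := h.p_pos
  have hθ := h.θ_pos
  have hd := h.d_ge_hundred
  have hpθ := h.p_le_θ
  have hθ1 := h.θ_le_const
  have h1 : Real.exp (-(p * (1 + θ))) ≤ 1 - p := by
    have h2 := Real.quadratic_le_exp_of_nonneg (x := p * (1 + θ)) (by positivity)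
    have h3 : p + p ^ 2 ≤ p * (1 + θ) := by nlinarith
    have h4 : p ^ 2 ≤ (p * (1 + θ)) ^ 2 := pow_le_pow_left₀ hp.le (by nlinarith) 2
    have h5 : 1 + p + 3 / 2 * p ^ 2 ≤ Real.exp (p * (1 + θ)) := by linarith
    rw [Real.exp_neg, inv_le_iff_one_le_mul₀ (Real.exp_pos _)]
    nlinarith [mul_le_mul_of_nonneg_left h5 (by linarith : 0 ≤ 1 - p), sq_nonneg p]
  have hinv : 1 / ((n : ℝ) - 1) ≤ θ := by
    refine le_trans ?_ h.θ_ge_inv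
    have := h.log_lt
    have := h.log_ge
    rw [div_le_div_iff₀ (by linarith) (by linarith)]
    linarith
  have hfl := Nat.floor_le (a := ((1 + θ) * d) ^ i) (by positivity)
  have h3 : p * (1 + θ) * ⌊((1 + θ) * d) ^ i⌋₊ ≤ d * κ * (1 + θ) ^ (i + 2) := by
    calc p * (1 + θ) * ⌊((1 + θ) * d) ^ i⌋₊
        ≤ d / n * (1 + θ) * (1 + θ) * ((1 + θ) * d) ^ i := by
          refine mul_le_mul (mul_le_mul_of_nonneg_right ?_ (by linarith)) hfl (by positivity)
            (by positivity)
          exact h.p_le_mul.trans (mul_le_mul_of_nonneg_left (by linarith) (by positivity))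
      _ = d / n * (1 + θ) ^ (i + 2) * d ^ i := by rw [mul_pow]; ring
      _ = d * κ * (1 + θ) ^ (i + 2) := by rw [h.pow_eq]; field_simp
  have h4 := mul_le_mul_of_nonneg_left (h.one_add_pow_le (k := i + 2) le_rfl)
    (mul_nonneg (by linarith) h.κ_pos.le : 0 ≤ d * κ)
  have h5 := h.mul_θ_le hc
  rw [← Real.exp_add]
  refine le_trans ?_ (pow_le_pow_left₀ (Real.exp_pos _).le h1 _)
  rw [← Real.exp_nat_mul]
  apply Real.exp_le_exp.2
  have h6 : d * κ * θ * (2 * (i + 2)) ≤ 32 * (2 * (i + 2)) :=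
    mul_le_mul_of_nonneg_right h5 (by positivity)
  nlinarith

/-- In the first regime, every pair has `Ω(n e⁻ᶜ)` distinguishers. -/
lemma gnpProb_metricDim_gt_le (h : Regime n i p d κ θ) {A γ : ℝ} (hA : 0 < A)
    (hAκ : A * κ ≤ Real.exp (-(d * κ))) (hAL : -Real.log A ≤ Real.log n)
    (hγ : γ = Real.exp (-(64 * (i + 2))) / 8) (hd2 : 24 ≤ γ * A * Real.log n) :
    gnpProb n p {G | Typical θ d (θ / (16 * p)) G ∧
      3 / γ * (Real.exp (d * κ) * Real.log n) < metricDim G} ≤ Real.exp (-Real.log n) := by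
  have hn := h.n_ge
  have hL := h.log_ge
  have hd := h.d_ge_hundred
  have hκ := h.κ_pos
  have hγ0 : 0 < γ := by rw [hγ]; positivity
  have hγ1 : γ ≤ 1 := by
    rw [hγ]
    have : Real.exp (-(64 * ((i : ℝ) + 2))) ≤ 1 := Real.exp_le_one_iff.2 (by
      have : (0 : ℝ) ≤ i := by positivity
      linarith)
    linarith
  have hκn : 1 ≤ κ * n := by linarith [h.d_le]
  have hc : d * κ ≤ 3 * Real.log n := by
    have h1 : Real.log A + Real.log κ ≤ -(d * κ) := by
      rw [← Real.log_mul hA.ne' hκ.ne']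
      exact (Real.log_le_iff_le_exp (by positivity)).2 hAκ
    have h2 : 0 ≤ Real.log κ + Real.log n := by
      rw [← Real.log_mul hκ.ne' (by linarith)]
      exact Real.log_nonneg hκn
    linarith
  have h1 := h.one_sub_pow_floor_ge hc
  have h2 : 1 / 2 ≤ 1 - Real.exp (-(p * (d ^ i / 2))) := by
    have h3 := h.le_p_mul_pow
    have h4 := h.c_ge
    have h5 : Real.exp (-(p * (d ^ i / 2))) ≤ Real.exp (-1) := Real.exp_le_exp.2 (by linarith)
    linarith [Real.exp_neg_one_lt_half]
  set x := Real.exp (-(d * κ)) with hx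
  set F := (1 - p) ^ ⌊((1 + θ) * d) ^ i⌋₊ * (1 - Real.exp (-(p * (d ^ i / 2)))) * n with hF
  have hx1 : x ≤ 1 := Real.exp_le_one_iff.2 (by nlinarith)
  have hx0 : 0 < x := Real.exp_pos _
  have hFge : 4 * (γ * x * n) ≤ F := by
    have h3 : Real.exp (-(64 * ((i : ℝ) + 2))) * x * (1 / 2) ≤
        (1 - p) ^ ⌊((1 + θ) * d) ^ i⌋₊ * (1 - Real.exp (-(p * (d ^ i / 2)))) :=
      mul_le_mul h1 h2 (by norm_num) ((by positivity : (0 : ℝ) ≤ _).trans h1)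
    have h4 := mul_le_mul_of_nonneg_right h3 (by linarith : (0 : ℝ) ≤ n)
    refine le_trans (le_of_eq ?_) h4
    rw [hγ]; ring
  have hD : 4 * ((1 + θ) * d) ^ i ≤ n / 2 := by
    have h3 := h.pow_mul_le (k := i) le_rfl
    have h4 := h.κ_le
    have h5 := h.θ_le_const
    rw [h.pow_eq] at h3
    nlinarith
  have hmain := gnpProb_exists_card_distinguishers_le (d := d) (m := θ / (16 * p)) h.p_nonneg
    h.p_le_one h.θ_pos.le (by linarith) hD
  refine (gnpProb_mono h.p_nonneg h.p_le_one ?_).trans (hmain.trans ?_)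
  · rintro G ⟨hG, hlt⟩
    refine ⟨hG, ?_⟩
    by_contra! hcon
    have h3 := h.metricDim_le (G := G) (γ := γ * x) (by positivity) (by nlinarith) fun v w hvw => by
      have h4 := hcon v w (h.le_card_bfsLayer_sdiff hG hvw)
      linarith
    have h4 : 3 / (γ * x) * Real.log n = 3 / γ * (Real.exp (d * κ) * Real.log n) := by
      rw [hx, Real.exp_neg]
      field_simp
    linarith
  · nth_rewrite 1 [← h.exp_log]
    rw [← Real.exp_nat_mul, ← Real.exp_add]
    apply Real.exp_le_exp.2
    have h3 : γ * (A * κ) * n ≤ γ * x * n := by gcongr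
    have h4 : γ * A * Real.log n ^ 2 ≤ γ * (A * κ) * n := by
      have := h.log_pow_le (k := 2) (by norm_num)
      have h5 := this.trans h.d_le
      calc γ * A * Real.log n ^ 2 ≤ γ * A * (κ * n) := by gcongr
        _ = _ := by ring
    have h5 : 24 * Real.log n ≤ γ * A * Real.log n ^ 2 := by nlinarith
    push_cast
    linarith

end Regime

end RegimeUpper

section RegimeLower

lemma exp_neg_two_mul_le {z : ℝ} (hz : 0 ≤ z) (hz1 : z ≤ 1 / 2) :
    Real.exp (-(2 * z)) ≤ 1 - z := by
  have h2 := Real.quadratic_le_exp_of_nonneg (x := 2 * z) (by linarith)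
  rw [Real.exp_neg, inv_le_iff_one_le_mul₀ (Real.exp_pos _)]
  nlinarith [mul_le_mul_of_nonneg_left h2 (by linarith : 0 ≤ 1 - z)]

namespace Regime

variable {n i : ℕ} {p d κ θ : ℝ}

lemma exp_neg_le (h : Regime n i p d κ θ) :
    Real.exp (-(p * ((1 - 2 * θ) * d) ^ i)) ≤
      Real.exp (64 * (i + 2)) * (Real.exp (-(d * κ)) + κ) := by
  have hκ := h.κ_pos
  have hd := h.d_ge_hundred
  have hn := h.n_ge
  have h1 : d * κ * (1 - 2 * (i + 2) * θ) ≤ p * ((1 - 2 * θ) * d) ^ i := by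
    rw [mul_pow]
    calc d * κ * (1 - 2 * (i + 2) * θ) ≤ p * d ^ i * (1 - 2 * θ) ^ i :=
          mul_le_mul h.le_p_mul_pow (h.one_sub_pow_ge le_rfl) (by linarith [h.θ_le])
            (mul_nonneg h.p_nonneg (by positivity))
      _ = _ := by ring
  have hE : 1 ≤ Real.exp (64 * ((i : ℝ) + 2)) := Real.one_le_exp (by positivity)
  rcases le_total (d * κ) (3 * Real.log n) with hc | hc
  · have h2 := mul_le_mul_of_nonneg_right (h.mul_θ_le hc)
      (by positivity : (0 : ℝ) ≤ 2 * (i + 2))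
    calc Real.exp (-(p * ((1 - 2 * θ) * d) ^ i))
        ≤ Real.exp (64 * (i + 2)) * Real.exp (-(d * κ)) := by
          rw [← Real.exp_add]
          exact Real.exp_le_exp.2 (by nlinarith)
      _ ≤ _ := by gcongr; linarith
  · have h2 : Real.exp (-(p * ((1 - 2 * θ) * d) ^ i)) ≤ Real.exp (-Real.log n) := by
      apply Real.exp_le_exp.2
      have := h.θ_le
      have := h.log_ge
      have := mul_le_mul_of_nonneg_left (by linarith : (1 / 2 : ℝ) ≤ 1 - 2 * (i + 2) * θ)
        (by positivity : 0 ≤ d * κ)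
      linarith
    rw [Real.exp_neg (Real.log n), h.exp_log] at h2
    have h3 : (n : ℝ)⁻¹ ≤ κ := by
      rw [inv_le_iff_one_le_mul₀ (by linarith)]
      linarith [h.d_le]
    have h4 := Real.exp_pos (-(d * κ))
    nlinarith

lemma le_one_sub_pow_mul (h : Regime n i p d κ θ) {ε : ℝ} {r : ℕ} (hε : 0 < ε)
    (hε1 : 40 * Real.exp (64 * (i + 2)) * ε ≤ 1)
    (hsmall : Real.exp (64 * (i + 2)) * (Real.exp (-(d * κ)) + κ) ≤ 1 / 2)
    (hr : r * (Real.exp (-(d * κ)) + κ) ≤ ε * Real.log n) :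
    Real.exp (3 / 4 * Real.log n) / 8 ≤ (1 - Real.exp (-(p * ((1 - 2 * θ) * d) ^ i))) ^ r *
      ((1 - p) ^ ⌊r * ((1 + θ) * d) ^ (i - 1)⌋₊ * n / 4) / 2 := by
  have hn := h.n_ge
  have hL := h.log_ge
  have hκ := h.κ_pos
  have hd := h.d_ge_hundred
  have hp := h.p_pos
  have hθ := h.θ_pos
  have hx0 := Real.exp_pos (-(d * κ))
  have hr0 : (0 : ℝ) ≤ r := by positivity
  have hE : 1 ≤ Real.exp (64 * ((i : ℝ) + 2)) := Real.one_le_exp (by positivity)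
  have h1 := h.exp_neg_le
  set y := Real.exp (-(p * ((1 - 2 * θ) * d) ^ i)) with hy
  set E := Real.exp (64 * ((i : ℝ) + 2)) with hEdef
  have hεs : ε ≤ 1 / 40 := by nlinarith
  have hrκ : r * κ ≤ ε * Real.log n := by nlinarith
  have hy0 : 0 < y := Real.exp_pos _
  have h2 : Real.exp (-(1 / 20 * Real.log n)) ≤ (1 - y) ^ r := by
    refine le_trans ?_ (pow_le_pow_left₀ (Real.exp_pos _).le
      (exp_neg_two_mul_le hy0.le (h1.trans hsmall)) r)
    rw [← Real.exp_nat_mul]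
    apply Real.exp_le_exp.2
    have h3 : r * y ≤ 1 / 40 * Real.log n := by
      calc r * y ≤ r * (E * (Real.exp (-(d * κ)) + κ)) := mul_le_mul_of_nonneg_left h1 hr0
        _ = E * (r * (Real.exp (-(d * κ)) + κ)) := by ring
        _ ≤ E * (ε * Real.log n) := mul_le_mul_of_nonneg_left hr (by linarith)
        _ = (E * ε) * Real.log n := by ring
        _ ≤ 1 / 40 * Real.log n := mul_le_mul_of_nonneg_right (by linarith) (by linarith)
    linarith
  have h3 : Real.exp (-(1 / 5 * Real.log n)) ≤ (1 - p) ^ ⌊r * ((1 + θ) * d) ^ (i - 1)⌋₊ := by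
    refine le_trans ?_ (pow_le_pow_left₀ (Real.exp_pos _).le
      (exp_neg_two_mul_le hp.le (by linarith [h.p_le_θ, h.θ_le_const])) _)
    rw [← Real.exp_nat_mul]
    apply Real.exp_le_exp.2
    have hfl := Nat.floor_le (a := r * ((1 + θ) * d) ^ (i - 1)) (by positivity)
    have hrpow := mul_le_mul_of_nonneg_left (h.pow_mul_le (k := i - 1) (by omega)) hr0
    have h4 : (⌊r * ((1 + θ) * d) ^ (i - 1)⌋₊ : ℝ) * p ≤ 4 * (r * κ) := by
      calc (⌊r * ((1 + θ) * d) ^ (i - 1)⌋₊ : ℝ) * p ≤ 2 * (r * d ^ (i - 1)) * p :=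
            mul_le_mul_of_nonneg_right (by linarith) hp.le
        _ = 2 * r * (p * d ^ (i - 1)) := by ring
        _ ≤ 2 * r * (2 * κ) := mul_le_mul_of_nonneg_left h.p_mul_pow_le (by linarith)
        _ = _ := by ring
    have h5 := mul_le_mul_of_nonneg_right hεs (by linarith : 0 ≤ Real.log n)
    linarith
  have h4 : Real.exp (3 / 4 * Real.log n) = Real.exp (-(1 / 20 * Real.log n)) *
      (Real.exp (-(1 / 5 * Real.log n)) * Real.exp (Real.log n)) := by
    rw [← Real.exp_add, ← Real.exp_add]
    congr 1; ring
  rw [h4, h.exp_log]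
  have h5 := mul_le_mul h2 (mul_le_mul_of_nonneg_right h3 (by linarith : (0 : ℝ) ≤ n))
    (by positivity) ((Real.exp_pos _).le.trans h2)
  linarith

lemma pow_mul_error_le (h : Regime n i p d κ θ) {r : ℕ} (hr : r * κ ≤ Real.log n)
    (hrd : (r : ℝ) ≤ d)
    (hlarge : 64 * (Real.exp (5 / 8 * Real.log n) + Real.log n) ≤ Real.exp (3 / 4 * Real.log n))
    (hlog : Real.log n ^ 3 ≤ Real.exp (1 / 4 * Real.log n)) :
    n ^ r * (r * i * Real.exp (-(θ ^ 2 * d ^ 2 / 64)) +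
        Real.exp (-(Real.exp (3 / 4 * Real.log n) / 8 / 8)) +
        Real.exp (-(Real.exp (3 / 4 * Real.log n) / 8 / 8)))
      ≤ (i + 2) * Real.exp (-Real.log n) := by
  have hL := h.log_ge
  have hd := h.d_ge_hundred
  have hθ := h.θ_pos
  have hr0 : (0 : ℝ) ≤ r := by positivity
  have hθL := h.log_pow_le_θ_mul
  have hrsq : r * Real.log n ≤ Real.exp (5 / 8 * Real.log n) := by
    refine (pow_le_pow_iff_left₀ (by positivity) (Real.exp_pos _).le two_ne_zero).1 ?_
    have h1 : (r : ℝ) ^ 2 ≤ Real.log n * n := by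
      calc (r : ℝ) ^ 2 = r * r := sq _
        _ ≤ r * (κ * n) := mul_le_mul_of_nonneg_left (hrd.trans h.d_le) hr0
        _ = r * κ * n := by ring
        _ ≤ Real.log n * n := by gcongr
    calc (r * Real.log n) ^ 2 = r ^ 2 * Real.log n ^ 2 := mul_pow _ _ _
      _ ≤ Real.log n * n * Real.log n ^ 2 := mul_le_mul_of_nonneg_right h1 (sq_nonneg _)
      _ = Real.log n ^ 3 * Real.exp (Real.log n) := by rw [h.exp_log]; ring
      _ ≤ Real.exp (1 / 4 * Real.log n) * Real.exp (Real.log n) := by gcongr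
      _ = Real.exp (5 / 8 * Real.log n) ^ 2 := by
        rw [← Real.exp_add, ← Real.exp_nat_mul]
        congr 1; push_cast; ring
  have hpow : (n : ℝ) ^ r = Real.exp (r * Real.log n) := by
    rw [Real.exp_nat_mul, h.exp_log]
  have hdL : d * Real.log n ^ 2 ≤ θ ^ 2 * d ^ 2 / 64 := by
    have h1 : 8 / Real.log n * d * (8 * Real.log n ^ 3) ≤ θ * d * (θ * d) :=
      mul_le_mul (mul_le_mul_of_nonneg_right h.θ_ge_inv (by linarith)) hθL (by positivity)
        (by positivity)
    have h2 : 8 / Real.log n * d * (8 * Real.log n ^ 3) = 64 * (d * Real.log n ^ 2) := by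
      have : Real.log n ≠ 0 := by linarith
      field_simp
      norm_num
    linarith
  have hY : Real.exp (r * Real.log n) * Real.exp (-(Real.exp (3 / 4 * Real.log n) / 8 / 8))
      ≤ Real.exp (-Real.log n) := by
    rw [← Real.exp_add]
    exact Real.exp_le_exp.2 (by linarith)
  have hT : Real.exp (r * Real.log n) * (r * Real.exp (-(θ ^ 2 * d ^ 2 / 64)))
      ≤ Real.exp (-Real.log n) := by
    calc Real.exp (r * Real.log n) * (r * Real.exp (-(θ ^ 2 * d ^ 2 / 64)))
        ≤ Real.exp (d * Real.log n) * (Real.exp d * Real.exp (-(d * Real.log n ^ 2))) := by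
          gcongr
          linarith [Real.add_one_le_exp d]
      _ ≤ _ := by
          rw [← Real.exp_add, ← Real.exp_add]
          apply Real.exp_le_exp.2
          have h1 : Real.log n ≤ Real.log n ^ 2 - Real.log n - 1 := by nlinarith
          have h2 := mul_le_mul_of_nonneg_left h1 (by linarith : 0 ≤ d)
          have h3 := mul_le_mul_of_nonneg_right (by linarith : 1 ≤ d)
            (by linarith : 0 ≤ Real.log n)
          linarith
  rw [hpow]
  have hT' := mul_le_mul_of_nonneg_left hT (by positivity : (0 : ℝ) ≤ i)
  linarith

/-- In a typical graph no set of `ε log n / (e⁻ᶜ + κ)` vertices resolves. -/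
lemma gnpProb_exists_resolves_le (h : Regime n i p d κ θ) {ε : ℝ} {r : ℕ} (hε : 0 < ε)
    (hε1 : 40 * Real.exp (64 * (i + 2)) * ε ≤ 1)
    (hsmall : Real.exp (64 * (i + 2)) * (Real.exp (-(d * κ)) + κ) ≤ 1 / 2)
    (hr : r * (Real.exp (-(d * κ)) + κ) ≤ ε * Real.log n)
    (hrd : (r : ℝ) ≤ d)
    (hlarge : 64 * (Real.exp (5 / 8 * Real.log n) + Real.log n) ≤ Real.exp (3 / 4 * Real.log n))
    (hlog : Real.log n ^ 3 ≤ Real.exp (1 / 4 * Real.log n)) :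
    gnpProb n p {G | Typical θ d (θ / (16 * p)) G ∧
        ∃ R : Finset (Fin n), R.card = r ∧ Resolves G (R : Set (Fin n))}
      ≤ (i + 2) * Real.exp (-Real.log n) := by
  have hn := h.n_ge
  have hL := h.log_ge
  have hd := h.d_ge_hundred
  have hκ := h.κ_pos
  have hθ := h.θ_pos
  have hp := h.p_pos
  have hθc := h.θ_le_const
  have hE : 1 ≤ Real.exp (64 * ((i : ℝ) + 2)) := Real.one_le_exp (by positivity)
  have hx0 := Real.exp_pos (-(d * κ))
  have hr0 : (0 : ℝ) ≤ r := by positivity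
  have hεs : ε ≤ 1 / 40 := by nlinarith
  have hrκ : r * κ ≤ ε * Real.log n := by nlinarith
  have hi1 := h.one_le_i
  have hθL := h.log_pow_le_θ_mul
  have hL3 : Real.log n ≤ Real.log n ^ 3 := le_self_pow₀ (by linarith) (by norm_num)
  have hK : (⌊1 / θ⌋₊ : ℝ) ≤ 1 / θ := Nat.floor_le (by positivity)
  have hK' : 1 / θ < (⌊1 / θ⌋₊ : ℝ) + 1 := Nat.lt_floor_add_one _
  have hθinv : 1 / θ ≤ Real.log n / 8 := by
    rw [div_le_iff₀ hθ]
    have := h.θ_ge_inv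
    rw [div_le_iff₀ (by linarith)] at this
    linarith
  have hdpow : d ^ (i - 1) * d = κ * n := by
    rw [pow_sub_one_mul (by omega), h.pow_eq]
  have hrpow : r * ((1 + θ) * d) ^ (i - 1) ≤ 2 * (r * d ^ (i - 1)) := by
    have := mul_le_mul_of_nonneg_left (h.pow_mul_le (k := i - 1) (by omega)) hr0
    linarith
  have hmain := gnpProb_typical_exists_resolves_le (Y := Real.exp (3 / 4 * Real.log n) / 8)
    (m := θ / (16 * p)) (r := r) (K := ⌊1 / θ⌋₊) h.p_nonneg h.p_le_one h.d_eq hi1 hθ.le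
    (by linarith) (by linarith)
    (by
      rw [le_div_iff₀ (by positivity)]
      have h1 : ((⌊1 / θ⌋₊ : ℝ) + 1) * θ ≤ 2 := by
        rw [le_div_iff₀ hθ] at hK
        linarith
      have h2 : p ≤ 2 * κ := by linarith [h.p_le, h.d_div_le]
      have h3 := h.κ_le_sq
      have h4 : ((⌊1 / θ⌋₊ : ℝ) + 1) * (16 * p) * θ ≤ θ * θ := by
        have : ((⌊1 / θ⌋₊ : ℝ) + 1) * θ * (16 * p) ≤ 2 * (16 * p) := by gcongr
        linarith
      exact le_of_mul_le_mul_right h4 hθ)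
    (by linarith)
    (by
      rw [div_lt_iff₀ hθ] at hK'
      nlinarith)
    (by
      have h1 : (2 : ℝ) ≤ Real.exp 1 := by linarith [Real.add_one_le_exp 1]
      calc (2 : ℝ) ^ ⌊1 / θ⌋₊ ≤ Real.exp 1 ^ ⌊1 / θ⌋₊ := pow_le_pow_left₀ (by norm_num) h1 _
        _ = Real.exp ⌊1 / θ⌋₊ := by rw [← Real.exp_nat_mul, mul_one]
        _ ≤ Real.exp (5 / 8 * Real.log n) := Real.exp_le_exp.2 (by linarith)
        _ ≤ _ := by linarith [Real.exp_pos (5 / 8 * Real.log n)])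
    (by
      have h1 : 2 * (r * d ^ (i - 1)) * d ≤ θ / 32 * n * d := by
        have h2 : 2 * (r * d ^ (i - 1)) * d = 2 * (r * κ) * n := by
          rw [mul_assoc, mul_assoc, hdpow]; ring
        rw [h2]
        have h3 : 2 * (r * κ) ≤ θ * d / 32 := by nlinarith
        nlinarith
      have := le_of_mul_le_mul_right h1 (by linarith)
      linarith)
    (by
      have h1 : ((1 - 2 * θ) * d) ^ (i - 1) ≤ d ^ (i - 1) :=
        pow_le_pow_left₀ (mul_nonneg (by linarith) (by linarith)) (by nlinarith) _
      have h2 := mul_le_mul_of_nonneg_left h1 h.p_nonneg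
      linarith [h.p_mul_pow_le, h.κ_le])
    (h.le_one_sub_pow_mul hε hε1 hsmall hr)
  exact hmain.trans (h.pow_mul_error_le (by nlinarith) hrd hlarge hlog)

end Regime

end RegimeLower

section Conclusion

namespace Regime

variable {n i : ℕ} {p d κ θ : ℝ}

lemma le_d_of_mul_le (h : Regime n i p d κ θ) {ε : ℝ} {r : ℕ}
    (hε1 : 2 * (i + 1) * ε ≤ 1) (hr : r * (Real.exp (-(d * κ)) + κ) ≤ ε * Real.log n)
    (hlog : Real.log n ≤ Real.exp (Real.log n / (2 * (i + 1)))) : (r : ℝ) ≤ d := by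
  have hn := h.n_ge
  have hL := h.log_ge
  have hκ := h.κ_pos
  have hd := h.d_ge_hundred
  have hx0 := Real.exp_pos (-(d * κ))
  have hr0 : (0 : ℝ) ≤ r := by positivity
  have hi0 : (0 : ℝ) ≤ i := by positivity
  rcases le_total (Real.log n / (2 * (i + 1))) (d * κ) with hc | hc
  · rw [div_le_iff₀ (by positivity)] at hc
    have hrκ : r * κ ≤ ε * Real.log n := by nlinarith
    rcases le_total ε 0 with hε | hε
    · nlinarith
    have h1 : r * κ ≤ d * κ := by
      calc r * κ ≤ ε * Real.log n := hrκ
        _ ≤ ε * (d * κ * (2 * (i + 1))) := mul_le_mul_of_nonneg_left hc hε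
        _ = 2 * (i + 1) * ε * (d * κ) := by ring
        _ ≤ 1 * (d * κ) := mul_le_mul_of_nonneg_right hε1 (by positivity)
        _ = d * κ := one_mul _
    exact le_of_mul_le_mul_right h1 hκ
  · have hε : ε ≤ 1 := by
      by_contra! hcon
      nlinarith
    have hrx : r * Real.exp (-(d * κ)) ≤ Real.log n := by
      have := mul_le_mul_of_nonneg_right hε (by linarith : 0 ≤ Real.log n)
      have := mul_nonneg hr0 hκ.le
      linarith
    rw [Real.exp_neg, ← div_eq_mul_inv, div_le_iff₀ (Real.exp_pos _)] at hrx
    have h1 : (r : ℝ) ≤ Real.exp (Real.log n / (i + 1)) := by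
      calc (r : ℝ) ≤ Real.log n * Real.exp (d * κ) := hrx
        _ ≤ Real.exp (Real.log n / (2 * (i + 1))) * Real.exp (Real.log n / (2 * (i + 1))) := by
            gcongr
        _ = Real.exp (Real.log n / (i + 1)) := by
            rw [← Real.exp_add]
            congr 1
            field_simp
            norm_num
    refine h1.trans ?_
    refine (pow_le_pow_iff_left₀ (Real.exp_pos _).le (by linarith) (Nat.succ_ne_zero i)).1 ?_
    rw [← Real.exp_nat_mul]
    have h2 : ((i + 1 : ℕ) : ℝ) * (Real.log n / (i + 1)) = Real.log n := by
      push_cast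
      field_simp
    rw [h2, h.exp_log, pow_succ, h.pow_eq]
    nlinarith [h.c_ge]

/-- The lower bound `β(G) = Ω(log n / (e⁻ᶜ + d ^ i / n))`. -/
lemma gnpProb_metricDim_lt_le (h : Regime n i p d κ θ) {ε : ℝ} (hε : 0 < ε)
    (hε1 : 40 * Real.exp (64 * (i + 2)) * ε ≤ 1)
    (hsmall : Real.exp (64 * (i + 2)) * (Real.exp (-(d * κ)) + κ) ≤ 1 / 2)
    (hlog : Real.log n ≤ Real.exp (Real.log n / (2 * (i + 1))))
    (hlarge : 64 * (Real.exp (5 / 8 * Real.log n) + Real.log n) ≤ Real.exp (3 / 4 * Real.log n))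
    (hlog' : Real.log n ^ 3 ≤ Real.exp (1 / 4 * Real.log n)) :
    gnpProb n p {G | Typical θ d (θ / (16 * p)) G ∧
        (metricDim G : ℝ) < ε * Real.log n / (Real.exp (-(d * κ)) + κ)}
      ≤ (i + 2) * Real.exp (-Real.log n) := by
  have hL := h.log_ge
  have hδ : 0 < Real.exp (-(d * κ)) + κ := add_pos (Real.exp_pos _) h.κ_pos
  have hr := Nat.floor_le (a := ε * Real.log n / (Real.exp (-(d * κ)) + κ)) (by positivity)
  have hlt := Nat.lt_floor_add_one (ε * Real.log n / (Real.exp (-(d * κ)) + κ))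
  rw [le_div_iff₀ hδ] at hr
  have hi0 : (0 : ℝ) ≤ i := by positivity
  have hrd := h.le_d_of_mul_le (by
    have := Real.add_one_le_exp (64 * ((i : ℝ) + 2))
    nlinarith) hr hlog
  refine (gnpProb_mono h.p_nonneg h.p_le_one ?_).trans
    (h.gnpProb_exists_resolves_le hε hε1 hsmall hr hrd hlarge hlog')
  rintro G ⟨hG, hdim⟩
  refine ⟨hG, ?_⟩
  by_contra! hcon
  have hrn : ⌊ε * Real.log n / (Real.exp (-(d * κ)) + κ)⌋₊ ≤ n := by
    have h1 : d ≤ n := by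
      have := h.d_le
      have := h.κ_le
      have := h.θ_le_const
      nlinarith [h.n_ge, h.κ_pos]
    exact_mod_cast hrd.trans h1
  have h1 := lt_metricDim (by rwa [Fintype.card_fin]) (h.resolves_univ hG) hcon
  have h2 : (⌊ε * Real.log n / (Real.exp (-(d * κ)) + κ)⌋₊ : ℝ) + 1 ≤ metricDim G := by
    exact_mod_cast h1
  linarith

end Regime

/-- A sequence of events whose complements have probability `O(1 / n)` in `G(n,p)`. -/
def Whp (p : ℕ → ℝ) (E : ∀ n, Set (SimpleGraph (Fin n))) : Prop :=
  ∃ C : ℝ, ∀ᶠ n : ℕ in atTop, gnpProb n (p n) (E n)ᶜ ≤ C * Real.exp (-Real.log n)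

namespace Whp

variable {p : ℕ → ℝ} {E F : ∀ n, Set (SimpleGraph (Fin n))}

lemma inter (hp : ∀ n, 0 ≤ p n ∧ p n ≤ 1) (hE : Whp p E) (hF : Whp p F) :
    Whp p fun n => E n ∩ F n := by
  obtain ⟨C, hC⟩ := hE
  obtain ⟨D, hD⟩ := hF
  refine ⟨C + D, ?_⟩
  filter_upwards [hC, hD] with n h1 h2
  rw [Set.compl_inter]
  exact (gnpProb_union_le (hp n).1 (hp n).2 _ _).trans (by linarith)

lemma mono (hp : ∀ n, 0 ≤ p n ∧ p n ≤ 1) (hE : Whp p E) (h : ∀ᶠ n in atTop, E n ⊆ F n) :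
    Whp p F := by
  obtain ⟨C, hC⟩ := hE
  refine ⟨C, ?_⟩
  filter_upwards [hC, h] with n h1 h2
  exact (gnpProb_mono (hp n).1 (hp n).2 (Set.compl_subset_compl.2 h2)).trans h1

lemma tendsto (hp : ∀ n, 0 ≤ p n ∧ p n ≤ 1) (hE : Whp p E) :
    Tendsto (fun n => gnpProb n (p n) (E n)) atTop (𝓝 1) := by
  obtain ⟨C, hC⟩ := hE
  have h0 : Tendsto (fun n : ℕ => 1 - C * Real.exp (-Real.log n)) atTop (𝓝 1) := by
    have h1 : Tendsto (fun n : ℕ => Real.exp (-Real.log n)) atTop (𝓝 0) :=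
      Real.tendsto_exp_neg_atTop_nhds_zero.comp
        (Real.tendsto_log_atTop.comp tendsto_natCast_atTop_atTop)
    simpa using (h1.const_mul C).const_sub 1
  refine tendsto_of_tendsto_of_tendsto_of_le_of_le' h0 tendsto_const_nhds ?_
    (Eventually.of_forall fun n => gnpProb_le_one (hp n).1 (hp n).2 _)
  filter_upwards [hC] with n hn
  rw [gnpProb_compl] at hn
  linarith

end Whp

lemma tendsto_log_div_log_log_atTop :
    Tendsto (fun n : ℕ => Real.log n / (3 * Real.log (Real.log n))) atTop atTop := by
  have hlog : Tendsto (fun n : ℕ => Real.log n) atTop atTop :=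
    Real.tendsto_log_atTop.comp tendsto_natCast_atTop_atTop
  have h1 : Tendsto (fun n : ℕ => 1 / 3 * (Real.exp (Real.log (Real.log n)) /
      Real.log (Real.log n) ^ 1)) atTop atTop :=
    ((Real.tendsto_exp_div_pow_atTop 1).comp (Real.tendsto_log_atTop.comp hlog)).const_mul_atTop
      (by norm_num)
  refine h1.congr' ?_
  filter_upwards [hlog.eventually_gt_atTop 0] with n hn
  rw [Real.exp_log hn, pow_one]
  ring

lemma eventually_pow_le_exp_mul {b : ℝ} (hb : 0 < b) (k : ℕ) :
    ∀ᶠ x : ℝ in atTop, x ^ k ≤ Real.exp (b * x) := by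
  filter_upwards [(isLittleO_pow_exp_pos_mul_atTop k hb).bound zero_lt_one] with x hx
  rw [one_mul, Real.norm_eq_abs, Real.norm_eq_abs, Real.abs_exp] at hx
  exact (le_abs_self _).trans hx

/-- Standing facts under the hypotheses of the theorem. -/
lemma eventually_regime {p d c : ℕ → ℝ} (hp : ∀ n, 0 ≤ p n ∧ p n ≤ 1)
    (hd : ∀ n, d n = p n * ((n : ℝ) - 1))
    (hd_lower : Tendsto (fun n : ℕ => d n / (Real.log n) ^ 5) atTop atTop)
    {i : ℕ} (hi : (fun n : ℕ => d n ^ i) =o[atTop] (fun n : ℕ => (n : ℝ)))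
    (hc : ∀ n : ℕ, c n = d n ^ (i + 1) / n) (hc_top : Tendsto c atTop atTop) :
    ∀ᶠ n : ℕ in atTop, Regime n i (p n) (d n) (d n ^ i / n)
      (8 * (√(d n ^ i / n) + 1 / Real.log n)) := by
  have hlog : Tendsto (fun n : ℕ => Real.log n) atTop atTop :=
    Real.tendsto_log_atTop.comp tendsto_natCast_atTop_atTop
  have hκ : Tendsto (fun n : ℕ => d n ^ i / n) atTop (𝓝 0) := hi.tendsto_div_nhds_zero
  have hθ : Tendsto (fun n : ℕ => 2 * ((i : ℝ) + 2) * (8 * (√(d n ^ i / n) + 1 / Real.log n)))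
      atTop (𝓝 0) := by
    have h1 : Tendsto (fun n : ℕ => √(d n ^ i / n)) atTop (𝓝 0) := by
      simpa using hκ.sqrt
    have h2 : Tendsto (fun n : ℕ => 1 / Real.log n) atTop (𝓝 0) := by
      simp only [one_div]
      exact hlog.inv_tendsto_atTop
    simpa using ((h1.add h2).const_mul 8).const_mul (2 * ((i : ℝ) + 2))
  filter_upwards [hlog.eventually_ge_atTop 100, hd_lower.eventually_ge_atTop 1,
    hc_top.eventually_ge_atTop 2, hθ.eventually_le_const (by norm_num : (0 : ℝ) < 1 / 6)]
    with n h1 h2 h3 h4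
  have hn0 : (n : ℝ) ≠ 0 := by
    rintro h0
    rw [h0] at h1
    norm_num at h1
  have hn : (1 : ℝ) ≤ n := by
    exact_mod_cast Nat.one_le_iff_ne_zero.2 (by exact_mod_cast hn0)
  refine ⟨(hp n).1, (hp n).2, hd n, by field_simp, rfl, ?_, h1, ?_, ?_, h4⟩
  · rw [Nat.one_le_iff_ne_zero]
    rintro rfl
    rw [hc, hd, zero_add, pow_one, le_div_iff₀ (by linarith)] at h3
    nlinarith [(hp n).1, (hp n).2]
  · rw [one_le_div (by positivity)] at h2
    exact (pow_le_pow_right₀ (by linarith) (by norm_num)).trans h2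
  · rw [hc, pow_succ] at h3
    rwa [mul_comm, div_mul_eq_mul_div]

/-- With probability tending to one, `β(G) = Ω(log n / (e⁻ᶜ + d ^ i / n))` and
`β(G) = O(n log n / d ^ i)`; if moreover `e⁻ᶜ = Ω(d ^ i / n)`, then `β(G) = O(eᶜ log n)`. -/
lemma whp_metricDim {p d c : ℕ → ℝ} (hp : ∀ n, 0 ≤ p n ∧ p n ≤ 1)
    (hd : ∀ n, d n = p n * ((n : ℝ) - 1))
    (hd_lower : Tendsto (fun n : ℕ => d n / (Real.log n) ^ 5) atTop atTop)
    {i : ℕ} (hi : (fun n : ℕ => d n ^ i) =o[atTop] (fun n : ℕ => (n : ℝ)))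
    (hc : ∀ n : ℕ, c n = d n ^ (i + 1) / n) (hc_top : Tendsto c atTop atTop) :
    (∃ ε : ℝ, 0 < ε ∧ Whp p fun n => {G | ε * Real.log n / (Real.exp (-c n) + d n ^ i / n) ≤
        metricDim G}) ∧
    (Whp p fun n => {G | (metricDim G : ℝ) ≤ 6 / (d n ^ i / n) * Real.log n}) ∧
    ((∃ A : ℝ, 0 < A ∧ ∀ᶠ n : ℕ in atTop, A * (d n ^ i / n) ≤ Real.exp (-c n)) →
      ∃ C : ℝ, 0 < C ∧ Whp p fun n => {G | (metricDim G : ℝ) ≤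
        C * (Real.exp (c n) * Real.log n)}) := by
  have hreg := eventually_regime hp hd hd_lower hi hc hc_top
  have hlog : Tendsto (fun n : ℕ => Real.log n) atTop atTop :=
    Real.tendsto_log_atTop.comp tendsto_natCast_atTop_atTop
  have hκ : Tendsto (fun n : ℕ => d n ^ i / n) atTop (𝓝 0) := hi.tendsto_div_nhds_zero
  have hceq : ∀ n, c n = d n * (d n ^ i / n) := fun n => by rw [hc, pow_succ]; ring
  refine ⟨⟨1 / (40 * Real.exp (64 * (i + 2))), by positivity, i + 2 + 3, ?_⟩, ⟨3, ?_⟩, ?_⟩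
  · have hδ : Tendsto (fun n => Real.exp (64 * ((i : ℝ) + 2)) *
        (Real.exp (-c n) + d n ^ i / n)) atTop (𝓝 0) := by
      simpa using ((Real.tendsto_exp_neg_atTop_nhds_zero.comp hc_top).add hκ).const_mul
        (Real.exp (64 * ((i : ℝ) + 2)))
    have hl1 : ∀ᶠ x : ℝ in atTop, x ≤ Real.exp (x / (2 * (i + 1))) := by
      filter_upwards [eventually_pow_le_exp_mul (b := 1 / (2 * ((i : ℝ) + 1))) (by positivity) 1]
        with x hx
      rwa [pow_one, one_div_mul_eq_div] at hx
    have hl2 : ∀ᶠ x : ℝ in atTop,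
        64 * (Real.exp (5 / 8 * x) + x) ≤ Real.exp (3 / 4 * x) := by
      filter_upwards [eventually_pow_le_exp_mul (b := 5 / 8) (by norm_num) 1,
        eventually_pow_le_exp_mul (b := 1 / 8) (by norm_num) 1, eventually_ge_atTop 128]
        with x hx1 hx2 hx3
      rw [pow_one] at hx1 hx2
      have h1 : Real.exp (3 / 4 * x) = Real.exp (1 / 8 * x) * Real.exp (5 / 8 * x) := by
        rw [← Real.exp_add]
        congr 1
        ring
      rw [h1]
      nlinarith [Real.exp_pos (5 / 8 * x)]
    have hl3 := eventually_pow_le_exp_mul (b := 1 / 4) (by norm_num) 3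
    filter_upwards [hreg, hδ.eventually_le_const (by norm_num : (0 : ℝ) < 1 / 2),
      hlog.eventually hl1, hlog.eventually hl2, hlog.eventually hl3] with n h h1 h2 h3 h4
    rw [hceq] at h1 ⊢
    have h5 := h.gnpProb_metricDim_lt_le (ε := 1 / (40 * Real.exp (64 * (i + 2))))
      (by positivity) (le_of_eq (by field_simp)) h1 h2 h3 h4
    have h6 := h.gnpProb_not_typical_le
    refine (gnpProb_mono (hp n).1 (hp n).2 ?_).trans
      ((gnpProb_union_le (hp n).1 (hp n).2 _ _).trans
        ((add_le_add h5 h6).trans (le_of_eq (by ring))))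
    intro G hG
    simp only [Set.mem_compl_iff, Set.mem_ofPred_eq, not_le, Set.mem_union] at hG ⊢
    tauto
  · filter_upwards [hreg] with n h
    refine (gnpProb_mono (hp n).1 (hp n).2 ?_).trans h.gnpProb_not_typical_le
    intro G hG hT
    exact hG (h.metricDim_le_of_typical hT)
  · rintro ⟨A, hA, hAκ⟩
    set γ := Real.exp (-(64 * ((i : ℝ) + 2))) / 8 with hγ
    have hγ0 : 0 < γ := by positivity
    refine ⟨3 / γ, by positivity, 1 + 3, ?_⟩
    filter_upwards [hreg, hAκ, hlog.eventually_ge_atTop (-Real.log A),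
      hlog.eventually_ge_atTop (24 / (γ * A))] with n h h1 h2 h3
    rw [div_le_iff₀' (by positivity)] at h3
    rw [hceq] at h1 ⊢
    have h5 := h.gnpProb_metricDim_gt_le hA h1 h2 hγ h3
    have h6 := h.gnpProb_not_typical_le
    refine (gnpProb_mono (hp n).1 (hp n).2 ?_).trans
      ((gnpProb_union_le (hp n).1 (hp n).2 _ _).trans
        ((add_le_add h5 h6).trans (le_of_eq (by ring))))
    intro G hG
    simp only [Set.mem_compl_iff, Set.mem_ofPred_eq, not_le, Set.mem_union] at hG ⊢
    tauto

end Conclusion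

lemma log_one_div_sq_add_sq_bounds {x : ℝ} (hx : 0 < x) (hx1 : x ≤ 1 / 4) :
    x ≤ Real.log (1 / (x ^ 2 + (1 - x) ^ 2)) ∧
      Real.log (1 / (x ^ 2 + (1 - x) ^ 2)) ≤ 4 * x := by
  have hq : 1 / 2 ≤ x ^ 2 + (1 - x) ^ 2 := by nlinarith
  constructor
  · have h1 := Real.log_le_sub_one_of_pos (by linarith : 0 < x ^ 2 + (1 - x) ^ 2)
    rw [one_div, Real.log_inv]
    nlinarith
  · have h1 := Real.log_le_sub_one_of_pos (by positivity : 0 < 1 / (x ^ 2 + (1 - x) ^ 2))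
    refine h1.trans ?_
    rw [sub_le_iff_le_add, div_le_iff₀ (by linarith)]
    nlinarith

/-- Theorem 1.1(iii), order of magnitude: if `e^c > log n/(3 log log n)`, then a.a.s.
`β(G) = Θ(e^c log n) = Θ(log n/log(1/q))` when `e^{-c} = Ω(d^i/n)`,
`β(G) = Θ(n log n/d^i)` when `e^{-c} ≪ d^i/n`, and in all cases `β(G) ≫ log n`. -/
theorem stmt_3 (p d c q : ℕ → ℝ)
    (hp : ∀ n, 0 ≤ p n ∧ p n ≤ 1)
    (hd : ∀ n, d n = p n * ((n : ℝ) - 1))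
    (hd_lower : Tendsto (fun n : ℕ => d n / (Real.log n) ^ 5) atTop atTop)
    (hd_upper : ∀ᶠ n : ℕ in atTop,
      d n ≤ (n : ℝ) * (1 - 3 * Real.log (Real.log n) / Real.log n))
    (i : ℕ)
    (hi : (fun n : ℕ => d n ^ i) =o[atTop] (fun n : ℕ => (n : ℝ)))
    (hi_max : ∀ j : ℕ, ((fun n : ℕ => d n ^ j) =o[atTop] (fun n : ℕ => (n : ℝ))) → j ≤ i)
    (hc : ∀ n : ℕ, c n = d n ^ (i + 1) / n)
    (hq : (Tendsto p atTop (𝓝 0) ∧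
            ∀ n, q n = Real.exp (-c n) ^ 2 + (1 - Real.exp (-c n)) ^ 2) ∨
          ((∃ C₁ C₂ : ℝ, 0 < C₁ ∧ ∀ᶠ n in atTop, C₁ ≤ p n ∧ p n ≤ C₂) ∧
            ∀ n, q n = p n ^ 2 + (1 - p n) ^ 2))
    (hec : ∀ᶠ n : ℕ in atTop,
      Real.log n / (3 * Real.log (Real.log n)) < Real.exp (c n)) :
    ((∃ A : ℝ, 0 < A ∧ ∀ᶠ n : ℕ in atTop, A * (d n ^ i / n) ≤ Real.exp (-c n)) →
      (∃ C₁ C₂ : ℝ, 0 < C₁ ∧ 0 < C₂ ∧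
        Tendsto (fun n : ℕ => gnpProb n (p n)
          {G : SimpleGraph (Fin n) |
            C₁ * (Real.exp (c n) * Real.log n) ≤ (metricDim G : ℝ) ∧
            (metricDim G : ℝ) ≤ C₂ * (Real.exp (c n) * Real.log n)})
          atTop (𝓝 1)) ∧
      (∃ C₁ C₂ : ℝ, 0 < C₁ ∧ 0 < C₂ ∧
        Tendsto (fun n : ℕ => gnpProb n (p n)
          {G : SimpleGraph (Fin n) |
            C₁ * (Real.log n / Real.log (1 / q n)) ≤ (metricDim G : ℝ) ∧
            (metricDim G : ℝ) ≤ C₂ * (Real.log n / Real.log (1 / q n))})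
          atTop (𝓝 1))) ∧
    (((fun n : ℕ => Real.exp (-c n)) =o[atTop] (fun n : ℕ => d n ^ i / n)) →
      ∃ C₁ C₂ : ℝ, 0 < C₁ ∧ 0 < C₂ ∧
        Tendsto (fun n : ℕ => gnpProb n (p n)
          {G : SimpleGraph (Fin n) |
            C₁ * ((n : ℝ) * Real.log n / d n ^ i) ≤ (metricDim G : ℝ) ∧
            (metricDim G : ℝ) ≤ C₂ * ((n : ℝ) * Real.log n / d n ^ i)})
          atTop (𝓝 1)) ∧
    (∀ K : ℝ, 0 < K →
      Tendsto (fun n : ℕ => gnpProb n (p n)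
        {G : SimpleGraph (Fin n) | K * Real.log n ≤ (metricDim G : ℝ)})
        atTop (𝓝 1)) := by
  have hlog : Tendsto (fun n : ℕ => Real.log n) atTop atTop :=
    Real.tendsto_log_atTop.comp tendsto_natCast_atTop_atTop
  have hc_top : Tendsto c atTop atTop :=
    Real.tendsto_exp_comp_atTop.1 (tendsto_atTop_mono' _ (hec.mono fun n hn => hn.le)
      tendsto_log_div_log_log_atTop)
  have hκ : Tendsto (fun n : ℕ => d n ^ i / n) atTop (𝓝 0) := hi.tendsto_div_nhds_zero
  have hx : Tendsto (fun n : ℕ => Real.exp (-c n)) atTop (𝓝 0) :=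
    Real.tendsto_exp_neg_atTop_nhds_zero.comp hc_top
  have hreg := eventually_regime hp hd hd_lower hi hc hc_top
  obtain ⟨⟨ε, hε, hlow⟩, hup, hup'⟩ := whp_metricDim hp hd hd_lower hi hc hc_top
  have hq' : ∀ n, q n = Real.exp (-c n) ^ 2 + (1 - Real.exp (-c n)) ^ 2 := by
    refine hq.elim (fun h => h.2) fun h => ?_
    obtain ⟨⟨C₁, C₂, hC₁, h1⟩, -⟩ := h
    obtain ⟨n, hn, hn', hr⟩ := (h1.and ((hκ.eventually_lt_const
      (by linarith : (0 : ℝ) < C₁ / 2)).and hreg)).exists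
    linarith [hn.1, hr.p_le, hr.d_div_le]
  refine ⟨fun hA => ?_, fun hsmall => ?_, fun K hK => ?_⟩
  · obtain ⟨C, hC, hupper⟩ := hup' hA
    obtain ⟨A, hA0, hAκ⟩ := hA
    have hlower : Whp p fun n => {G | ε / (1 + 1 / A) * (Real.exp (c n) * Real.log n) ≤
        (metricDim G : ℝ)} := by
      refine hlow.mono hp ?_
      filter_upwards [hAκ, hreg] with n h1 hr G hG
      refine le_trans ?_ (show _ ≤ (metricDim G : ℝ) from hG)
      have hL := hr.log_ge
      rw [le_div_iff₀ (add_pos (Real.exp_pos _) hr.κ_pos)]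
      have h2 : Real.exp (-c n) + d n ^ i / n ≤ (1 + 1 / A) * Real.exp (-c n) := by
        have : d n ^ i / n ≤ 1 / A * Real.exp (-c n) := by
          rw [one_div_mul_eq_div, le_div_iff₀' hA0]
          exact h1
        linarith
      calc ε / (1 + 1 / A) * (Real.exp (c n) * Real.log n) * (Real.exp (-c n) + d n ^ i / n)
          ≤ ε / (1 + 1 / A) * (Real.exp (c n) * Real.log n) *
            ((1 + 1 / A) * Real.exp (-c n)) :=
            mul_le_mul_of_nonneg_left h2 (by positivity)
        _ = ε * Real.log n := by
            rw [Real.exp_neg]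
            field_simp
    have hboth := hlower.inter hp hupper
    refine ⟨⟨ε / (1 + 1 / A), C, by positivity, hC, hboth.tendsto hp⟩,
      ε / (1 + 1 / A), 4 * C, by positivity, by positivity, Whp.tendsto hp ?_⟩
    refine hboth.mono hp ?_
    filter_upwards [hreg, hx.eventually_le_const (by norm_num : (0 : ℝ) < 1 / 4)]
      with n hr hx4 G hG
    have hL := hr.log_ge
    obtain ⟨h1, h2⟩ := log_one_div_sq_add_sq_bounds (Real.exp_pos (-c n)) hx4
    rw [← hq'] at h1 h2
    have hlq : 0 < Real.log (1 / q n) := lt_of_lt_of_le (Real.exp_pos _) h1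
    have h3 : Real.exp (c n) * Real.exp (-c n) = 1 := by
      rw [← Real.exp_add, add_neg_cancel, Real.exp_zero]
    have h4 : Real.log n / Real.log (1 / q n) ≤ Real.exp (c n) * Real.log n := by
      rw [div_le_iff₀ hlq]
      calc Real.log n = Real.exp (c n) * Real.log n * Real.exp (-c n) := by
            linear_combination (-Real.log n) * h3
        _ ≤ _ := by gcongr
    have h5 : Real.exp (c n) * Real.log n ≤ 4 * (Real.log n / Real.log (1 / q n)) := by
      rw [← mul_div_assoc, le_div_iff₀ hlq]
      calc Real.exp (c n) * Real.log n * Real.log (1 / q n)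
          ≤ Real.exp (c n) * Real.log n * (4 * Real.exp (-c n)) := by gcongr
        _ = _ := by linear_combination (4 * Real.log n) * h3
    refine ⟨(mul_le_mul_of_nonneg_left h4 (by positivity)).trans hG.1, hG.2.trans ?_⟩
    have := mul_le_mul_of_nonneg_left h5 hC.le
    linarith
  · refine ⟨ε / 2, 6, by positivity, by norm_num, Whp.tendsto hp ((hlow.inter hp hup).mono hp ?_)⟩
    filter_upwards [hreg, hsmall.bound zero_lt_one] with n hr h1 G hG
    have hL := hr.log_ge
    have hκ0 := hr.κ_pos
    have hn := hr.n_ge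
    rw [one_mul, Real.norm_eq_abs, Real.norm_eq_abs, Real.abs_exp, abs_of_pos hκ0] at h1
    have h2 : (n : ℝ) * Real.log n / d n ^ i = Real.log n / (d n ^ i / n) := by
      field_simp
    have hlo : ε * Real.log n / (Real.exp (-c n) + d n ^ i / n) ≤ metricDim G := hG.1
    have hhi : (metricDim G : ℝ) ≤ 6 / (d n ^ i / n) * Real.log n := hG.2
    refine ⟨le_trans ?_ hlo, hhi.trans (le_of_eq ?_)⟩
    · rw [h2, le_div_iff₀ (add_pos (Real.exp_pos _) hκ0)]
      calc ε / 2 * (Real.log n / (d n ^ i / n)) * (Real.exp (-c n) + d n ^ i / n)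
          ≤ ε / 2 * (Real.log n / (d n ^ i / n)) * (2 * (d n ^ i / n)) := by
            refine mul_le_mul_of_nonneg_left (by linarith) ?_
            exact mul_nonneg (by linarith) (div_nonneg (by linarith) hκ0.le)
        _ = ε * Real.log n * ((d n ^ i / n) / (d n ^ i / n)) := by ring
        _ = ε * Real.log n := by rw [div_self hκ0.ne', mul_one]
    · rw [h2]; ring
  · refine Whp.tendsto hp (hlow.mono hp ?_)
    have hδ : Tendsto (fun n => Real.exp (-c n) + d n ^ i / n) atTop (𝓝 0) := by
      simpa using hx.add hκ
    filter_upwards [hreg, hδ.eventually_le_const (by positivity : (0 : ℝ) < ε / K)]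
      with n hr h1 G hG
    have hL := hr.log_ge
    refine le_trans ?_ (show _ ≤ (metricDim G : ℝ) from hG)
    rw [le_div_iff₀ (add_pos (Real.exp_pos _) hr.κ_pos)]
    rw [le_div_iff₀ hK] at h1
    nlinarith
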